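/- Let r ≥ 5 be a prime and let K = ℚ(ζ_r) be the r-th cyclotomic field, with ring of integers O_K = ℤ[ζ_r]. For each s ∈ (ℤ/rℤ)ˣ let σ_s be the field automorphism of K determined by σ_s(ζ_r) = ζ_r^s, acting on the ideal class group Cl(O_K) by mapping the class of an ideal 𝔞 to the class of σ_s(𝔞). Suppose c ∈ Cl(O_K) satisfies c^r = 1 and, for every s ∈ (ℤ/rℤ)ˣ, σ_s(c) = c^{n_s} where n_s is any integer with n_s ≡ s² (mod r). Then c = 1. -/

import Mathlib

open scoped nonZeroDivisors

instance (n : ℕ+) : NumberField (CyclotomicField n ℚ) :=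
  letI := CyclotomicField.algebra n ℚ
  IsCyclotomicExtension.numberField {(n : ℕ)} ℚ (CyclotomicField n ℚ)


namespace OmegaSq
section ModA
open NumberField IsDedekindDomain Filter Topology

section Euler
variable {K : Type*} [Field K] [NumberField K]

/-- ideals not divisible by any prime of `S` -/
def copr (S : Finset (HeightOneSpectrum (𝓞 K))) : Set (Ideal (𝓞 K)) :=
  {I | ∀ P ∈ S, ¬ P.asIdeal ∣ I}

theorem tsum_copr_insert (f : Ideal (𝓞 K) →*₀ ℂ) (hf : Summable fun I => ‖f I‖)
    (S : Finset (HeightOneSpectrum (𝓞 K))) (P : HeightOneSpectrum (𝓞 K)) (hP : P ∉ S) 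
    [DecidableEq (HeightOneSpectrum (𝓞 K))] :
    ∑' I : Ideal (𝓞 K), (copr (insert P S)).indicator f I =
      (1 - f P.asIdeal) * ∑' I, (copr S).indicator f I := by
  have hf' : Summable (f : Ideal (𝓞 K) → ℂ) := hf.of_norm
  have hinj : Function.Injective (fun J : Ideal (𝓞 K) => P.asIdeal * J) := by
    intro a b h
    exact mul_left_cancel₀ (by simpa using P.ne_bot) h
  have h1 : ∀ I, (copr S).indicator f I = (copr (insert P S)).indicator f I +
      (copr S ∩ Set.range (fun J : Ideal (𝓞 K) => P.asIdeal * J)).indicator f I := by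
    intro I
    have hr : I ∈ Set.range (fun J : Ideal (𝓞 K) => P.asIdeal * J) ↔ P.asIdeal ∣ I := by
      constructor
      · rintro ⟨J, rfl⟩; exact dvd_mul_right _ _
      · rintro ⟨J, rfl⟩; exact ⟨J, rfl⟩
    by_cases hI : I ∈ copr S
    · by_cases hd : P.asIdeal ∣ I
      · have : I ∉ copr (insert P S) := fun h => h P (by simp) hd
        simp [hI, this, hr.2 hd, Set.indicator]
      · have : I ∈ copr (insert P S) := by
          intro Q hQ
          rcases Finset.mem_insert.1 hQ with rfl | hQ
          · exact hd
          · exact hI Q hQ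
        rw [Set.indicator_of_mem hI, Set.indicator_of_mem this, Set.indicator_of_notMem, add_zero]
        intro h; exact hd (hr.1 h.2)
    · have : I ∉ copr (insert P S) := fun h => hI fun Q hQ => h Q (by simp [hQ])
      rw [Set.indicator_of_notMem hI, Set.indicator_of_notMem this, Set.indicator_of_notMem, add_zero]
      exact fun h => hI h.1
  have h2 : ∑' I, (copr S ∩ Set.range (fun J : Ideal (𝓞 K) => P.asIdeal * J)).indicator f I =
      f P.asIdeal * ∑' I, (copr S).indicator f I := by
    rw [← tsum_mul_left]
    rw [← hinj.tsum_eq]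
    · refine tsum_congr fun J => ?_
      have : P.asIdeal * J ∈ (copr S ∩ Set.range (fun J : Ideal (𝓞 K) => P.asIdeal * J)) ↔
          J ∈ copr S := by
        constructor
        · intro h Q hQ hd
          exact h.1 Q hQ (hd.mul_left _)
        · intro h
          refine ⟨fun Q hQ hd => ?_, ⟨J, rfl⟩⟩
          rcases (Q.prime.dvd_or_dvd hd) with h' | h'
          · have : Q = P := by
              ext1
              have := Ideal.dvd_iff_le.1 h'
              exact (P.isMaximal.eq_of_le Q.isPrime.ne_top this).symm
            exact hP (this ▸ hQ)
          · exact h Q hQ h'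
      by_cases hJ : J ∈ copr S
      · rw [Set.indicator_of_mem (this.2 hJ), Set.indicator_of_mem hJ, map_mul]
      · rw [Set.indicator_of_notMem (fun h => hJ (this.1 h)), Set.indicator_of_notMem hJ, mul_zero]
    · intro I hI
      have := Set.mem_of_indicator_ne_zero hI
      exact this.2
  have h3 := congrArg tsum (funext h1)
  rw [Summable.tsum_add (hf'.indicator _) (hf'.indicator _), h2] at h3
  linear_combination -h3

theorem prod_mul_tsum (f : Ideal (𝓞 K) →*₀ ℂ) (hf : Summable fun I => ‖f I‖)
    (S : Finset (HeightOneSpectrum (𝓞 K))) :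
    ∑' I : Ideal (𝓞 K), (copr S).indicator f I =
      (∏ P ∈ S, (1 - f P.asIdeal)) * ∑' I, f I := by
  classical
  induction S using Finset.induction_on with
  | empty =>
    simp [copr]
  | insert P S hP ih =>
    rw [tsum_copr_insert f hf S P hP, ih, Finset.prod_insert hP, mul_assoc]

theorem tendsto_euler (f : Ideal (𝓞 K) →*₀ ℂ) (hf : Summable fun I => ‖f I‖) :
    Tendsto (fun S : Finset (HeightOneSpectrum (𝓞 K)) => 
      (∏ P ∈ S, (1 - f P.asIdeal)) * ∑' I, f I) atTop (𝓝 1) := by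
  simp_rw [← prod_mul_tsum f hf]
  have : (1 : ℂ) = ∑' I : Ideal (𝓞 K), (if I = ⊤ then 1 else 0) := by
    rw [tsum_ite_eq]
  rw [this]
  refine tendsto_tsum_of_dominated_convergence hf (fun I => ?_) (Eventually.of_forall fun S I => ?_)
  · by_cases hI : I = ⊤
    · refine tendsto_const_nhds.congr fun S => ?_
      rw [Set.indicator_of_mem]
      · simp [hI, ← Ideal.one_eq_top]
      · intro P _ hd
        rw [hI, ← Ideal.one_eq_top] at hd
        exact P.prime.not_isUnit (isUnit_of_dvd_one hd)
    · simp only [hI, if_false]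
      by_cases h0 : I = ⊥
      · refine tendsto_const_nhds.congr fun S => ?_
        have : f I = 0 := by rw [h0]; exact map_zero f
        rw [eq_comm, Set.indicator_apply_eq_zero]; intro _; exact this
      · obtain ⟨m, hm, hle⟩ := Ideal.exists_le_maximal I hI
        have hmb : m ≠ ⊥ := fun h => h0 (by rw [h] at hle; exact le_bot_iff.1 hle)
        refine tendsto_const_nhds.congr' ?_
        filter_upwards [eventually_ge_atTop {(⟨m, hm.isPrime, hmb⟩ : HeightOneSpectrum (𝓞 K))}] with S hS
        rw [Set.indicator_of_notMem]
        intro h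
        exact h _ (hS (Finset.mem_singleton_self _)) (Ideal.dvd_iff_le.2 hle)
  · exact norm_indicator_le_norm_self _ _

theorem log_bd {z : ℂ} (hz : ‖z‖ ≤ 1/2) :
    Real.exp (-z.re - ‖z‖^2) ≤ ‖1 - z‖ ∧ ‖1 - z‖ ≤ Real.exp (-z.re + ‖z‖^2) := by
  have h := Complex.norm_log_one_add_sub_self_le (z := -z) (by rw [norm_neg]; linarith)
  rw [norm_neg] at h
  have h2 : ‖z‖ ^ 2 * (1 - ‖z‖)⁻¹ / 2 ≤ ‖z‖^2 := by
    have : (1 - ‖z‖)⁻¹ ≤ 2 := by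
      rw [inv_le_comm₀ (by linarith) (by norm_num)]; linarith
    nlinarith [sq_nonneg ‖z‖]
  have h3 := (Complex.abs_re_le_norm _).trans (h.trans h2)
  have hne : (1 + -z) ≠ 0 := by
    intro h0
    have : z = 1 := by linear_combination -h0
    rw [this] at hz; norm_num at hz
  rw [Complex.sub_re, Complex.log_re, Complex.neg_re, abs_le] at h3
  rw [← sub_eq_add_neg] at h3 hne
  have hp : 0 < ‖1 - z‖ := norm_pos_iff.2 hne
  constructor
  · rw [← Real.le_log_iff_exp_le hp]; linarith
  · rw [← Real.log_le_iff_le_exp hp]; linarith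

theorem euler_bounds (f : Ideal (𝓞 K) →*₀ ℂ) (hf : Summable fun I => ‖f I‖)
    (hh : ∀ P : HeightOneSpectrum (𝓞 K), ‖f P.asIdeal‖ ≤ 1/2) :
    (∑' P : HeightOneSpectrum (𝓞 K), (f P.asIdeal).re) - ∑' P : HeightOneSpectrum (𝓞 K), ‖f P.asIdeal‖^2
      ≤ Real.log ‖∑' I, f I‖ ∧ 
    Real.log ‖∑' I, f I‖ ≤ 
    (∑' P : HeightOneSpectrum (𝓞 K), (f P.asIdeal).re) + ∑' P : HeightOneSpectrum (𝓞 K), ‖f P.asIdeal‖^2 ∧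
    0 < ‖∑' I, f I‖ := by
  have hinj : Function.Injective (fun P : HeightOneSpectrum (𝓞 K) => P.asIdeal) := by
    intro P Q h; exact HeightOneSpectrum.ext h
  have hs : Summable fun P : HeightOneSpectrum (𝓞 K) => ‖f P.asIdeal‖ := hf.comp_injective hinj
  have hre : Summable fun P : HeightOneSpectrum (𝓞 K) => (f P.asIdeal).re :=
    .of_norm_bounded hs fun P => Complex.abs_re_le_norm _
  have hsq : Summable fun P : HeightOneSpectrum (𝓞 K) => ‖f P.asIdeal‖^2 :=
    .of_nonneg_of_le (fun P => by positivity) (fun P => by nlinarith [hh P, norm_nonneg (f P.asIdeal)]) hs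
  have ht := (tendsto_euler f hf).norm
  simp only [norm_mul, norm_prod, norm_one] at ht
  have hpos : 0 < ‖∑' I, f I‖ := by
    rw [norm_pos_iff]; intro h0
    simp [h0] at ht
  refine ⟨?_, ?_, hpos⟩
  · rw [Real.le_log_iff_exp_le hpos]
    have h1 : Tendsto (fun S : Finset (HeightOneSpectrum (𝓞 K)) =>
        Real.exp (∑ P ∈ S, (-(f P.asIdeal).re + ‖f P.asIdeal‖^2)) * ‖∑' I, f I‖) atTop
        (𝓝 (Real.exp (∑' P : HeightOneSpectrum (𝓞 K), (-(f P.asIdeal).re + ‖f P.asIdeal‖^2)) * ‖∑' I, f I‖)) :=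
      ((Real.continuous_exp.tendsto _).comp (hre.neg.add hsq).hasSum).mul_const _
    have h2 := le_of_tendsto_of_tendsto' ht h1 (fun S => by
      gcongr
      rw [Real.exp_sum]
      exact Finset.prod_le_prod (fun _ _ => norm_nonneg _) fun P _ => (log_bd (hh P)).2)
    rw [Summable.tsum_add hre.neg hsq, tsum_neg] at h2
    rw [show (∑' P : HeightOneSpectrum (𝓞 K), (f P.asIdeal).re) - ∑' P : HeightOneSpectrum (𝓞 K), ‖f P.asIdeal‖^2 = -(-(∑' P : HeightOneSpectrum (𝓞 K), (f P.asIdeal).re) + ∑' P : HeightOneSpectrum (𝓞 K), ‖f P.asIdeal‖^2) by ring, Real.exp_neg]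
    rw [inv_le_iff_one_le_mul₀ (Real.exp_pos _)]; linarith
  · rw [Real.log_le_iff_le_exp hpos]
    have h1 : Tendsto (fun S : Finset (HeightOneSpectrum (𝓞 K)) =>
        Real.exp (∑ P ∈ S, (-(f P.asIdeal).re - ‖f P.asIdeal‖^2)) * ‖∑' I, f I‖) atTop
        (𝓝 (Real.exp (∑' P : HeightOneSpectrum (𝓞 K), (-(f P.asIdeal).re - ‖f P.asIdeal‖^2)) * ‖∑' I, f I‖)) :=
      ((Real.continuous_exp.tendsto _).comp (hre.neg.sub hsq).hasSum).mul_const _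
    have h2 := le_of_tendsto_of_tendsto' h1 ht (fun S => by
      gcongr
      rw [Real.exp_sum]
      exact Finset.prod_le_prod (fun _ _ => (Real.exp_pos _).le) fun P _ => (log_bd (hh P)).1)
    rw [Summable.tsum_sub hre.neg hsq, tsum_neg] at h2
    rw [show (∑' P : HeightOneSpectrum (𝓞 K), (f P.asIdeal).re) + ∑' P : HeightOneSpectrum (𝓞 K), ‖f P.asIdeal‖^2 = -(-(∑' P : HeightOneSpectrum (𝓞 K), (f P.asIdeal).re) - ∑' P : HeightOneSpectrum (𝓞 K), ‖f P.asIdeal‖^2) by ring, Real.exp_neg]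
    rw [le_inv_comm₀ hpos (Real.exp_pos _)]
    rw [← one_div, le_div_iff₀ hpos]; exact h2

end Euler
end ModA
end OmegaSq


namespace OmegaSq
section ModA2
open NumberField IsDedekindDomain Filter Topology
open scoped nonZeroDivisors

section Zeta
variable (K : Type*) [Field K] [NumberField K]

theorem lseries_summable (s : ℝ) (hs : 1 < s) :
    LSeriesSummable (fun n ↦ (Nat.card {I : Ideal (𝓞 K) // Ideal.absNorm I = n} : ℂ)) (s : ℂ) := by
  have h1 := tendsto_sub_one_mul_dedekindZeta_nhdsGT K
  have h2 : ∀ᶠ t : ℝ in 𝓝[>] 1, ((t : ℂ) - 1) * dedekindZeta K t ≠ 0 :=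
    h1.eventually_ne (by exact_mod_cast dedekindZeta_residue_ne_zero K)
  have h3 : ∀ᶠ t : ℝ in 𝓝[>] 1, t < s := 
    mem_nhdsWithin_of_mem_nhds (Iio_mem_nhds hs)
  obtain ⟨t, ht, hts⟩ := (h2.and h3).exists
  have h4 : LSeriesSummable (fun n ↦ (Nat.card {I : Ideal (𝓞 K) // Ideal.absNorm I = n} : ℂ)) (t : ℂ) := by
    by_contra hc
    apply ht
    rw [dedekindZeta, LSeries, tsum_eq_zero_of_not_summable hc, mul_zero]
  exact h4.of_re_le_re (by simpa using hts.le)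

theorem zeta_hasSum (s : ℝ) (hs : 1 < s) :
    Summable (fun I : Ideal (𝓞 K) => (Ideal.absNorm I : ℝ) ^ (-s)) ∧
    ((∑' I : Ideal (𝓞 K), (Ideal.absNorm I : ℝ) ^ (-s) : ℝ) : ℂ) = dedekindZeta K s := by
  have hL := lseries_summable K s hs
  have hterm : ∀ n : ℕ, LSeries.term (fun n ↦ (Nat.card {I : Ideal (𝓞 K) // Ideal.absNorm I = n} : ℂ)) (s : ℂ) n = 
      (((Nat.card {I : Ideal (𝓞 K) // Ideal.absNorm I = n} : ℝ) * (n : ℝ) ^ (-s) : ℝ) : ℂ) := by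
    intro n
    rcases eq_or_ne n 0 with rfl | hn
    · simp [Real.zero_rpow (by linarith : -s ≠ 0)]
    · rw [LSeries.term_of_ne_zero hn]
      push_cast
      rw [Complex.ofReal_cpow (by positivity)]
      push_cast
      rw [Complex.cpow_neg, div_eq_mul_inv]
  have hS : Summable fun n : ℕ => (Nat.card {I : Ideal (𝓞 K) // Ideal.absNorm I = n} : ℝ) * (n : ℝ) ^ (-s) := by
    have : Summable _ := hL
    simp_rw [funext hterm] at this
    exact Complex.summable_ofReal.1 this
  have hfin : ∀ n : ℕ, ∀ x : {I : Ideal (𝓞 K) // Ideal.absNorm I = n}, (Ideal.absNorm (x : Ideal (𝓞 K)) : ℝ) ^ (-s) = (n:ℝ)^(-s) := by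
    rintro n ⟨x, rfl⟩; rfl
  have hF : ∀ n : ℕ, Finite {I : Ideal (𝓞 K) // Ideal.absNorm I = n} := fun n => by
    exact (Ideal.finite_setOfPred_absNorm_eq n).to_subtype
  have hsig : Summable (fun x : (Σ n : ℕ, {I : Ideal (𝓞 K) // Ideal.absNorm I = n}) => (Ideal.absNorm (x.2 : Ideal (𝓞 K)) : ℝ) ^ (-s)) := by
    rw [summable_sigma_of_nonneg (fun x => by positivity)]
    refine ⟨fun n => Summable.of_finite, ?_⟩
    refine hS.congr fun n => ?_
    rw [tsum_congr (hfin n), tsum_const, nsmul_eq_mul]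
  have hsm : Summable (fun I : Ideal (𝓞 K) => (Ideal.absNorm I : ℝ) ^ (-s)) := by
    rw [← (Equiv.sigmaFiberEquiv (fun I : Ideal (𝓞 K) => Ideal.absNorm I)).summable_iff]
    exact hsig
  refine ⟨hsm, ?_⟩
  rw [dedekindZeta, LSeries, tsum_congr hterm, ← Complex.ofReal_tsum]
  congr 1
  rw [← (Equiv.sigmaFiberEquiv (fun I : Ideal (𝓞 K) => Ideal.absNorm I)).tsum_eq]
  refine (hsig.tsum_sigma' (fun n => Summable.of_finite)).trans ?_
  refine tsum_congr fun n => ?_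
  rw [tsum_congr (hfin n), tsum_const, nsmul_eq_mul]

theorem zeta_bounds : ∃ c₁ c₂ δ : ℝ, 0 < c₁ ∧ 0 < c₂ ∧ 0 < δ ∧ δ ≤ 1 ∧ ∀ s : ℝ, 1 < s → s < 1 + δ → 
    c₁ / (s - 1) ≤ ∑' I : Ideal (𝓞 K), (Ideal.absNorm I : ℝ) ^ (-s) ∧
    ∑' I : Ideal (𝓞 K), (Ideal.absNorm I : ℝ) ^ (-s) ≤ c₂ / (s - 1) := by
  have h1 := tendsto_sub_one_mul_dedekindZeta_nhdsGT K
  have hpos := dedekindZeta_residue_pos K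
  set ρ := dedekindZeta_residue K
  have h2 : Tendsto (fun s : ℝ => (s - 1) * ∑' I : Ideal (𝓞 K), (Ideal.absNorm I : ℝ) ^ (-s)) (𝓝[>] 1) (𝓝 ρ) := by
    rw [← Filter.tendsto_ofReal_iff]
    refine h1.congr' ?_
    filter_upwards [self_mem_nhdsWithin] with s hs
    rw [← (zeta_hasSum K s hs).2]; push_cast; rfl
  have h3 := h2.eventually (Icc_mem_nhds (show ρ / 2 < ρ by linarith) (show ρ < 2 * ρ by linarith))
  rw [eventually_nhdsWithin_iff, Metric.eventually_nhds_iff] at h3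
  obtain ⟨δ, hδ, h⟩ := h3
  refine ⟨ρ/2, 2*ρ, min δ 1, by positivity, by positivity, by positivity, min_le_right _ _, fun s hs hsd => ?_⟩
  have := h (y := s) (by rw [Real.dist_eq, abs_of_pos (by linarith)]; have := min_le_left δ 1; linarith) hs
  have hs' : 0 < s - 1 := by linarith
  rw [div_le_iff₀ hs', le_div_iff₀ hs']
  constructor <;> nlinarith [this.1, this.2]

variable {K}

open Classical in
/-- the completely multiplicative function `χ(I) N(I)^(-s)` -/
noncomputable def Lf (χ : ClassGroup (𝓞 K) →* ℂˣ) (s : ℝ) : Ideal (𝓞 K) →*₀ ℂ where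
  toFun I := if h : I = 0 then 0 else 
    (χ (ClassGroup.mk0 ⟨I, mem_nonZeroDivisors_of_ne_zero h⟩) : ℂ) * (((Ideal.absNorm I : ℝ) ^ (-s) : ℝ) : ℂ)
  map_zero' := by simp
  map_one' := by
    rw [dif_neg one_ne_zero, show (⟨1, _⟩ : (Ideal (𝓞 K))⁰) = 1 from rfl]
    simp
  map_mul' I J := by
    by_cases hI : I = 0
    · simp [hI]
    by_cases hJ : J = 0
    · simp [hJ]
    have : I * J ≠ 0 := mul_ne_zero hI hJ
    simp only [hI, hJ, this, dite_false]
    rw [show (⟨I * J, mem_nonZeroDivisors_of_ne_zero this⟩ : (Ideal (𝓞 K))⁰) = 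
      ⟨I, mem_nonZeroDivisors_of_ne_zero hI⟩ * ⟨J, mem_nonZeroDivisors_of_ne_zero hJ⟩ from rfl]
    rw [map_mul, map_mul, map_mul]
    push_cast
    rw [Real.mul_rpow (by positivity) (by positivity)]
    push_cast
    ring

theorem Lf_apply (χ : ClassGroup (𝓞 K) →* ℂˣ) (s : ℝ) (I : (Ideal (𝓞 K))⁰) :
    Lf χ s I = (χ (ClassGroup.mk0 I) : ℂ) * (((Ideal.absNorm (I : Ideal (𝓞 K)) : ℝ) ^ (-s) : ℝ) : ℂ) := by
  have : (I : Ideal (𝓞 K)) ≠ 0 := nonZeroDivisors.ne_zero I.2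
  exact dif_neg this

theorem norm_chi (χ : ClassGroup (𝓞 K) →* ℂˣ) (x : ClassGroup (𝓞 K)) : ‖(χ x : ℂ)‖ = 1 := by
  have h : (χ x : ℂ) ^ (Fintype.card (ClassGroup (𝓞 K))) = 1 := by
    rw [← Units.val_pow_eq_pow_val, ← map_pow, pow_card_eq_one, map_one, Units.val_one]
  exact Complex.norm_eq_one_of_pow_eq_one h Fintype.card_ne_zero

theorem norm_Lf (χ : ClassGroup (𝓞 K) →* ℂˣ) (s : ℝ) (hs : 1 < s) (I : Ideal (𝓞 K)) :
    ‖Lf χ s I‖ = (Ideal.absNorm I : ℝ) ^ (-s) := by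
  by_cases h : I = 0
  · subst h; rw [map_zero, map_zero]; simp [Real.zero_rpow (by linarith : -s ≠ 0)]
  · rw [show Lf χ s I = _ from Lf_apply χ s ⟨I, mem_nonZeroDivisors_of_ne_zero h⟩]
    rw [norm_mul, norm_chi, one_mul, Complex.norm_real, Real.norm_of_nonneg (by positivity)]

/-- the nonzero ideal of a prime -/
noncomputable def pz (P : HeightOneSpectrum (𝓞 K)) : (Ideal (𝓞 K))⁰ :=
  ⟨P.asIdeal, mem_nonZeroDivisors_of_ne_zero P.ne_bot⟩

theorem two_le_norm (P : HeightOneSpectrum (𝓞 K)) : (2 : ℝ) ≤ Ideal.absNorm P.asIdeal := by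
  have h0 : Ideal.absNorm P.asIdeal ≠ 0 := by
    rw [Ne, Ideal.absNorm_eq_zero_iff]; exact P.ne_bot
  have h1 : Ideal.absNorm P.asIdeal ≠ 1 := by
    rw [Ne, Ideal.absNorm_eq_one_iff]; exact P.isPrime.ne_top
  have : 2 ≤ Ideal.absNorm P.asIdeal := by omega
  exact_mod_cast this

theorem summable_primes (s : ℝ) (hs : 1 < s) :
    Summable fun P : HeightOneSpectrum (𝓞 K) => (Ideal.absNorm P.asIdeal : ℝ) ^ (-s) := by
  have hinj : Function.Injective (fun P : HeightOneSpectrum (𝓞 K) => P.asIdeal) := by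
    intro P Q h; exact HeightOneSpectrum.ext h
  exact (zeta_hasSum K s hs).1.comp_injective hinj

theorem L_bounds (K : Type*) [Field K] [NumberField K] : ∃ C : ℝ, ∀ (χ : ClassGroup (𝓞 K) →* ℂˣ) (s : ℝ), 1 < s →
    0 < ‖∑' I, Lf χ s I‖ ∧
    |Real.log ‖∑' I, Lf χ s I‖ - ∑' P : HeightOneSpectrum (𝓞 K), 
      (χ (ClassGroup.mk0 (pz P)) : ℂ).re * (Ideal.absNorm P.asIdeal : ℝ) ^ (-s)| ≤ C := by
  refine ⟨∑' P : HeightOneSpectrum (𝓞 K), (Ideal.absNorm P.asIdeal : ℝ) ^ (-2 : ℝ), fun χ s hs => ?_⟩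
  have h := euler_bounds (Lf χ s) (by simpa only [norm_Lf χ s hs] using (zeta_hasSum K s hs).1) (fun P => by
    rw [norm_Lf χ s hs]
    have h2 := two_le_norm P
    calc (Ideal.absNorm P.asIdeal : ℝ) ^ (-s) ≤ (Ideal.absNorm P.asIdeal : ℝ) ^ (-1 : ℝ) :=
          Real.rpow_le_rpow_of_exponent_le (by linarith) (by linarith)
      _ = (Ideal.absNorm P.asIdeal : ℝ)⁻¹ := Real.rpow_neg_one _
      _ ≤ 1/2 := by rw [one_div]; exact inv_anti₀ (by norm_num) h2)
  have hre : ∀ P : HeightOneSpectrum (𝓞 K), (Lf χ s P.asIdeal).re = (χ (ClassGroup.mk0 (pz P)) : ℂ).re * (Ideal.absNorm P.asIdeal : ℝ) ^ (-s) := by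
    intro P
    rw [show Lf χ s P.asIdeal = _ from Lf_apply χ s (pz P), Complex.re_mul_ofReal]; rfl
  have hsq : ∀ P : HeightOneSpectrum (𝓞 K), ‖Lf χ s P.asIdeal‖^2 ≤ (Ideal.absNorm P.asIdeal : ℝ) ^ (-2 : ℝ) := by
    intro P
    rw [norm_Lf χ s hs, ← Real.rpow_natCast, ← Real.rpow_mul (by positivity)]
    have h2 := two_le_norm P
    exact Real.rpow_le_rpow_of_exponent_le (by linarith) (by push_cast; linarith)
  have hs2 := summable_primes (K := K) 2 (by norm_num)
  have hle : ∑' P : HeightOneSpectrum (𝓞 K), ‖Lf χ s P.asIdeal‖^2 ≤ ∑' P : HeightOneSpectrum (𝓞 K), (Ideal.absNorm P.asIdeal : ℝ) ^ (-2 : ℝ) :=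
    (Summable.of_nonneg_of_le (fun P => by positivity) hsq hs2).tsum_le_tsum hsq hs2
  rw [tsum_congr hre] at h
  refine ⟨h.2.2, abs_le.2 ⟨?_, ?_⟩⟩ <;> linarith [h.1, h.2.1]

theorem prime_sum_log (K : Type*) [Field K] [NumberField K] : ∃ C δ : ℝ, 0 < δ ∧ δ ≤ 1 ∧ ∀ s : ℝ, 1 < s → s < 1 + δ → 
    |∑' P : HeightOneSpectrum (𝓞 K), (Ideal.absNorm P.asIdeal : ℝ) ^ (-s) - Real.log (1 / (s - 1))| ≤ C := by
  obtain ⟨C, hC⟩ := L_bounds K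
  obtain ⟨c₁, c₂, δ, h1, h2, hδ, hδ1, h⟩ := zeta_bounds K
  refine ⟨C + |Real.log c₁| + |Real.log c₂|, δ, hδ, hδ1, fun s hs hsd => ?_⟩
  have hZ : ‖∑' I, Lf (1 : ClassGroup (𝓞 K) →* ℂˣ) s I‖ = ∑' I : Ideal (𝓞 K), (Ideal.absNorm I : ℝ) ^ (-s) := by
    have : ∀ I : Ideal (𝓞 K), Lf (1 : ClassGroup (𝓞 K) →* ℂˣ) s I = (((Ideal.absNorm I : ℝ) ^ (-s) : ℝ) : ℂ) := by
      intro I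
      by_cases h : I = 0
      · subst h; rw [map_zero, map_zero]; simp [Real.zero_rpow (by linarith : -s ≠ 0)]
      · rw [show Lf _ s I = _ from Lf_apply _ s ⟨I, mem_nonZeroDivisors_of_ne_zero h⟩]
        simp
    rw [tsum_congr this, ← Complex.ofReal_tsum, Complex.norm_real, Real.norm_of_nonneg]
    exact tsum_nonneg fun I => by positivity
  obtain ⟨hp, hb⟩ := hC 1 s hs
  rw [hZ] at hp hb
  simp only [MonoidHom.one_apply, Units.val_one, Complex.one_re, one_mul] at hb
  obtain ⟨ha, hbb⟩ := h s hs hsd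
  have hs' : 0 < s - 1 := by linarith
  have l1 := Real.log_le_log (by positivity) ha
  have l2 := Real.log_le_log hp hbb
  rw [div_eq_mul_one_div, Real.log_mul h1.ne' (by positivity)] at l1
  rw [div_eq_mul_one_div, Real.log_mul h2.ne' (by positivity)] at l2
  rw [abs_le] at hb ⊢
  have := neg_abs_le (Real.log c₁)
  have := le_abs_self (Real.log c₁)
  have := neg_abs_le (Real.log c₂)
  have := le_abs_self (Real.log c₂)
  constructor <;> linarith [hb.1, hb.2]

theorem exists_prime_mem (P : HeightOneSpectrum (𝓞 K)) : ∃ p : ℕ, p.Prime ∧ (p : 𝓞 K) ∈ P.asIdeal ∧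
    ∃ k : ℕ, 1 ≤ k ∧ Ideal.absNorm P.asIdeal = p ^ k := by
  have h2 : 2 ≤ Ideal.absNorm P.asIdeal := by exact_mod_cast two_le_norm P
  have hm : ((Ideal.absNorm P.asIdeal : ℕ) : 𝓞 K) ∈ P.asIdeal := Ideal.absNorm_mem _
  obtain ⟨p, hp, hpm⟩ : ∃ p : ℕ, p.Prime ∧ (p : 𝓞 K) ∈ P.asIdeal := by
    rw [← Nat.prod_primeFactorsList (n := Ideal.absNorm P.asIdeal) (by omega)] at hm
    push_cast at hm
    have := P.isPrime
    rw [← Multiset.prod_coe, Ideal.IsPrime.multiset_prod_mem_iff_exists_mem P.isPrime] at hm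
    obtain ⟨x, hx, hxP⟩ := hm
    simp only [Multiset.mem_coe, List.mem_map] at hx
    obtain ⟨q, hq, rfl⟩ := hx
    exact ⟨q, Nat.prime_of_mem_primeFactorsList hq, hxP⟩
  refine ⟨p, hp, hpm, ?_⟩
  have hd : Ideal.absNorm P.asIdeal ∣ p ^ (Module.finrank ℤ (𝓞 K)) := by
    have h1 : P.asIdeal ∣ Ideal.span {(p : 𝓞 K)} := by
      rw [Ideal.dvd_span_singleton]; exact hpm
    have h3 := map_dvd Ideal.absNorm h1
    rw [Ideal.absNorm_span_singleton, show ((p : 𝓞 K)) = algebraMap ℤ (𝓞 K) (p : ℤ) by simp, Algebra.norm_algebraMap] at h3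
    simpa [Int.natAbs_pow] using h3
  obtain ⟨k, _, hk⟩ := (Nat.dvd_prime_pow hp).1 hd
  refine ⟨k, ?_, hk⟩
  by_contra hc
  have : k = 0 := by omega
  rw [this, pow_zero] at hk; omega

theorem card_over_le (p : ℕ) (hp : p.Prime) (T : Finset (HeightOneSpectrum (𝓞 K)))
    (hT : ∀ P ∈ T, (p : 𝓞 K) ∈ P.asIdeal ∧ p ≤ Ideal.absNorm P.asIdeal) : T.card ≤ Module.finrank ℤ (𝓞 K) := by
  have h1 : ∏ P ∈ T, P.asIdeal ∣ Ideal.span {(p : 𝓞 K)} := by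
    refine Finset.prod_dvd_of_coprime ?_ ?_
    · intro P _ Q _ hPQ
      rw [Function.onFun, Ideal.isCoprime_iff_sup_eq]
      exact Ideal.IsMaximal.coprime_of_ne P.isMaximal Q.isMaximal (fun h => hPQ (HeightOneSpectrum.ext h))
    · intro P hP
      rw [Ideal.dvd_span_singleton]; exact (hT P hP).1
  have h3 := map_dvd Ideal.absNorm h1
  rw [Ideal.absNorm_span_singleton, show ((p : 𝓞 K)) = algebraMap ℤ (𝓞 K) (p : ℤ) by simp, Algebra.norm_algebraMap, map_prod,
    Int.natAbs_pow, Int.natAbs_natCast] at h3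
  have h4 := Nat.le_of_dvd (pow_pos hp.pos _) h3
  have h5 : p ^ T.card ≤ ∏ P ∈ T, Ideal.absNorm P.asIdeal := by
    rw [← Finset.prod_const]
    exact Finset.prod_le_prod' fun P hP => (hT P hP).2
  exact (Nat.pow_le_pow_iff_right hp.one_lt).1 (h5.trans h4)

/-- primes whose norm is not a prime number contribute a bounded amount -/
theorem nondeg_bounded (K : Type*) [Field K] [NumberField K] : ∃ C : ℝ, ∀ s : ℝ, 1 < s →
    ∀ T : Set (HeightOneSpectrum (𝓞 K)), (∀ P ∈ T, ¬ (Ideal.absNorm P.asIdeal).Prime) →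
    ∑' P : HeightOneSpectrum (𝓞 K), T.indicator (fun P => (Ideal.absNorm P.asIdeal : ℝ) ^ (-s)) P ≤ C := by
  classical
  choose p hp hpm k hk hN using exists_prime_mem (K := K)
  have hsum : Summable (fun m : ℕ => ((m : ℝ)^2)⁻¹) := by
    exact Real.summable_nat_pow_inv.2 (by norm_num)
  refine ⟨Module.finrank ℤ (𝓞 K) * ∑' m : ℕ, ((m : ℝ)^2)⁻¹, fun s hs T hT => ?_⟩
  refine Real.tsum_le_of_sum_le (fun P => Set.indicator_nonneg (fun _ _ => by positivity) _) fun F => ?_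
  have h1 : ∀ P ∈ F, T.indicator (fun P => (Ideal.absNorm P.asIdeal : ℝ) ^ (-s)) P ≤ ((p P : ℝ)^2)⁻¹ := by
    intro P _
    by_cases hPT : P ∈ T
    · rw [Set.indicator_of_mem hPT]
      have h2 := two_le_norm P
      have hp0 : (1:ℝ) ≤ p P := by exact_mod_cast (hp P).one_lt.le
      calc (Ideal.absNorm P.asIdeal : ℝ) ^ (-s) ≤ (Ideal.absNorm P.asIdeal : ℝ) ^ (-1 : ℝ) :=
          Real.rpow_le_rpow_of_exponent_le (by linarith) (by linarith)
        _ = (Ideal.absNorm P.asIdeal : ℝ)⁻¹ := Real.rpow_neg_one _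
        _ ≤ _ := by
          refine inv_anti₀ (by positivity) ?_
          rw [hN P]; push_cast
          refine pow_le_pow_right₀ hp0 ?_
          by_contra hc
          have : k P = 1 := by have := hk P; omega
          apply hT P hPT
          rw [hN P, this, pow_one]; exact hp P
    · rw [Set.indicator_of_notMem hPT]; positivity
  refine (Finset.sum_le_sum h1).trans ?_
  rw [← Finset.sum_fiberwise_of_maps_to (t := F.image p) (g := p) (fun P hP => Finset.mem_image_of_mem _ hP)]
  calc _ ≤ ∑ m ∈ F.image p, (Module.finrank ℤ (𝓞 K) : ℝ) * ((m : ℝ)^2)⁻¹ := by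
        refine Finset.sum_le_sum fun m hm => ?_
        obtain ⟨P₀, _, hP₀⟩ := Finset.mem_image.1 hm
        rw [Finset.sum_congr rfl (g := fun _ => ((m:ℝ)^2)⁻¹) (fun P hP => by rw [(Finset.mem_filter.1 hP).2]),
          Finset.sum_const, nsmul_eq_mul]
        gcongr
        refine card_over_le m (hP₀ ▸ hp P₀) _ fun P hP => ?_
        have := (Finset.mem_filter.1 hP).2
        refine ⟨this ▸ hpm P, ?_⟩
        rw [hN P, this]
        exact Nat.le_self_pow (by have := hk P; omega) m
    _ = Module.finrank ℤ (𝓞 K) * ∑ m ∈ F.image p, ((m : ℝ)^2)⁻¹ := by rw [Finset.mul_sum]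
    _ ≤ _ := by
      gcongr
      exact hsum.sum_le_tsum _ (fun _ _ => by positivity)

end Zeta
end ModA2
end OmegaSq


namespace OmegaSq
section ModB1
open NumberField IsDedekindDomain Filter Topology
open scoped nonZeroDivisors
section Units
open NumberField.Units NumberField.Units.dirichletUnitTheorem NumberField.mixedEmbedding

noncomputable def tri (x : ℝ) : ℝ := max 0 (1 - |x|)

theorem tri_nonneg (x : ℝ) : 0 ≤ tri x := le_max_left _ _
theorem tri_le_one (x : ℝ) : tri x ≤ 1 := by
  unfold tri; have := abs_nonneg x; exact max_le (by norm_num) (by linarith)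
theorem tri_ne_zero {x : ℝ} (h : tri x ≠ 0) : |x| < 1 := by
  by_contra hc; apply h; unfold tri; exact max_eq_left (by linarith)
theorem tri_lip (x y : ℝ) : |tri x - tri y| ≤ |x - y| := by
  unfold tri
  have h1 := abs_max_sub_max_le_max 0 (1-|x|) 0 (1-|y|)
  have h2 : |1 - |x| - (1 - |y|)| ≤ |x - y| := by
    rw [show 1 - |x| - (1 - |y|) = -(|x| - |y|) by ring, abs_neg]
    exact abs_abs_sub_abs_le_abs_sub x y
  simp at h1
  calc _ ≤ _ := h1
    _ = |1 - |x| - (1 - |y|)| := by congr 1; ring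
    _ ≤ _ := h2

theorem tri_sum (c : ℝ) : ∑ m ∈ ({⌊-c⌋, ⌊-c⌋+1} : Finset ℤ), tri (c + m) = 1 := by
  rw [Finset.sum_pair (by omega)]
  have h1 := Int.floor_le (-c)
  have h2 := Int.lt_floor_add_one (-c)
  unfold tri
  push_cast
  rw [abs_of_nonpos (by linarith), abs_of_nonneg (by linarith), max_eq_right (by linarith), max_eq_right (by linarith)]
  ring

theorem tri_supp (c : ℝ) (m : ℤ) (hm : m ∉ ({⌊-c⌋, ⌊-c⌋+1} : Finset ℤ)) : tri (c + m) = 0 := by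
  by_contra h
  have h := abs_lt.1 (tri_ne_zero h)
  apply hm
  have h1 := Int.floor_le (-c)
  have h2 := Int.lt_floor_add_one (-c)
  have h3 : ⌊-c⌋ < m + 1 := by
    have : ((⌊-c⌋ : ℤ) : ℝ) < ((m + 1 : ℤ) : ℝ) := by push_cast; linarith
    exact_mod_cast this
  have h4 : m < ⌊-c⌋ + 2 := by
    have : ((m : ℤ) : ℝ) < ((⌊-c⌋ + 2 : ℤ) : ℝ) := by push_cast; linarith
    exact_mod_cast this
  simp only [Finset.mem_insert, Finset.mem_singleton]
  omega

theorem prod_tri_hasSum {ι : Type*} [Fintype ι] [DecidableEq ι] (c : ι → ℝ) :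
    HasSum (fun m : ι → ℤ => ∏ i, tri (c i + m i)) 1 := by
  have h := Finset.prod_univ_sum (fun i => ({⌊-c i⌋, ⌊-c i⌋+1} : Finset ℤ)) (fun i m => tri (c i + (m : ℤ)))
  simp only [tri_sum, Finset.prod_const_one] at h
  rw [h]
  apply hasSum_sum_of_ne_finset_zero
  intro m hm
  rw [Fintype.mem_piFinset] at hm
  push Not at hm
  obtain ⟨i, hi⟩ := hm
  exact Finset.prod_eq_zero (Finset.mem_univ i) (tri_supp _ _ hi)

open scoped Classical
variable (K : Type*) [Field K] [NumberField K]

noncomputable def bL : Module.Basis (Fin (rank K)) ℝ (logSpace K) :=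
  (basisUnitLattice K).ofZLatticeBasis ℝ (unitLattice K)

variable {K}
noncomputable def Phi (v : logSpace K) : ℝ := ∏ i, tri ((bL K).repr v i)

theorem bL_unit (ζ : torsion K) (e : Fin (rank K) → ℤ) (i : Fin (rank K)) :
    (bL K).repr (logEmbedding K (Additive.ofMul ((ζ : (𝓞 K)ˣ) * ∏ i, fundSystem K i ^ e i))) i = e i := by
  have h0 : logEmbedding K (Additive.ofMul (ζ : (𝓞 K)ˣ)) = 0 :=
    logEmbedding_eq_zero_iff.2 ζ.2
  have : logEmbedding K (Additive.ofMul ((ζ : (𝓞 K)ˣ) * ∏ i, fundSystem K i ^ e i)) = 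
      ∑ i, (e i : ℝ) • bL K i := by
    rw [ofMul_mul, map_add, h0, zero_add, ofMul_prod, map_sum]
    refine Finset.sum_congr rfl fun i _ => ?_
    rw [ofMul_zpow, map_zsmul, logEmbedding_fundSystem, bL, Module.Basis.ofZLatticeBasis_apply]
    exact (Int.cast_smul_eq_zsmul ℝ _ _).symm
  rw [this, Module.Basis.repr_sum_self]

theorem hasSum_one_card {G : Type*} [Finite G] : HasSum (fun _ : G => (1:ℝ)) (Nat.card G) := by
  have : Fintype G := Fintype.ofFinite _
  have := hasSum_fintype (fun _ : G => (1:ℝ))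
  simpa [Nat.card_eq_fintype_card] using this

theorem hasSum_mul_aux {α β : Type*} {f : α → ℝ} {g : β → ℝ} {a b : ℝ} (hf : HasSum f a) (hg : HasSum g b) 
    (hf0 : ∀ x, 0 ≤ f x) (hg0 : ∀ x, 0 ≤ g x) : HasSum (fun p : α × β => f p.1 * g p.2) (a * b) :=
  hf.mul hg (hf.summable.mul_of_nonneg hg.summable hf0 hg0)

noncomputable def unitE (K : Type*) [Field K] [NumberField K] : torsion K × (Fin (rank K) → ℤ) ≃ (𝓞 K)ˣ :=
  Equiv.ofBijective (fun p => (p.1 : (𝓞 K)ˣ) * ∏ i, fundSystem K i ^ p.2 i) (by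
    rw [Function.bijective_iff_existsUnique]
    intro x
    obtain ⟨p, hp, hu⟩ := exist_unique_eq_mul_prod K x
    exact ⟨p, hp.symm, fun q hq => hu q hq.symm⟩)

theorem Phi_unitE (v : logSpace K) (p : torsion K × (Fin (rank K) → ℤ)) : 
    Phi (logEmbedding K (Additive.ofMul (unitE K p)) + v) = 
      (1:ℝ) * ∏ i, tri ((bL K).repr v i + p.2 i) := by
  rw [one_mul, Phi]
  refine Finset.prod_congr rfl fun i _ => ?_
  rw [map_add, Finsupp.add_apply, add_comm]
  congr 2
  exact bL_unit p.1 p.2 i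

theorem Phi_hasSum (v : logSpace K) :
    HasSum (fun u : (𝓞 K)ˣ => Phi (logEmbedding K (Additive.ofMul u) + v)) (torsionOrder K) := by
  rw [← (unitE K).hasSum_iff]
  have h0 : ((fun u : (𝓞 K)ˣ => Phi (logEmbedding K (Additive.ofMul u) + v)) ∘ (unitE K)) = 
     fun p : torsion K × (Fin (rank K) → ℤ) => (1:ℝ) * ∏ i, tri ((bL K).repr v i + p.2 i) := 
    funext fun p => Phi_unitE v p
  rw [h0]
  have h1 : HasSum (fun _ : torsion K => (1:ℝ)) (torsionOrder K) := hasSum_one_card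
  have h2 := prod_tri_hasSum (fun i => (bL K).repr v i)
  have h5 := hasSum_mul_aux h1 h2 (fun _ => zero_le_one) (fun m => Finset.prod_nonneg fun i _ => tri_nonneg _)
  rw [mul_one] at h5
  exact h5

theorem Phi_nonneg (v : logSpace K) : 0 ≤ Phi v := Finset.prod_nonneg fun i _ => tri_nonneg _
theorem Phi_le_one (v : logSpace K) : Phi v ≤ 1 := Finset.prod_le_one (fun i _ => tri_nonneg _) fun i _ => tri_le_one _

theorem repr_bound : ∃ C : ℝ, 0 < C ∧ ∀ v : logSpace K, ∀ i, |(bL K).repr v i| ≤ C * ‖v‖ := by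
  let T : logSpace K →L[ℝ] (Fin (rank K) → ℝ) := (bL K).equivFun.toLinearMap.toContinuousLinearMap
  refine ⟨‖T‖ + 1, by positivity, fun v i => ?_⟩
  have h1 : ‖T v i‖ ≤ ‖T v‖ := norm_le_pi_norm (T v) i
  have h2 := T.le_opNorm v
  have h3 : T v i = (bL K).repr v i := rfl
  rw [h3, Real.norm_eq_abs] at h1
  nlinarith [norm_nonneg v]

theorem prod_lip {ι : Type*} (s : Finset ι) (a b : ι → ℝ) (ha : ∀ i, |a i| ≤ 1) (hb : ∀ i, |b i| ≤ 1) :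
    |∏ i ∈ s, a i - ∏ i ∈ s, b i| ≤ ∑ i ∈ s, |a i - b i| := by
  classical
  induction s using Finset.induction_on with
  | empty => simp
  | insert j s hj ih =>
    rw [Finset.prod_insert hj, Finset.prod_insert hj, Finset.sum_insert hj]
    have h1 : |∏ i ∈ s, b i| ≤ 1 := by
      rw [Finset.abs_prod]; exact Finset.prod_le_one (fun _ _ => abs_nonneg _) fun i _ => hb i
    calc _ = |a j * (∏ i ∈ s, a i - ∏ i ∈ s, b i) + (a j - b j) * ∏ i ∈ s, b i| := by ring_nf
      _ ≤ |a j| * |∏ i ∈ s, a i - ∏ i ∈ s, b i| + |a j - b j| * |∏ i ∈ s, b i| := by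
        rw [← abs_mul, ← abs_mul]; exact abs_add_le _ _
      _ ≤ 1 * ∑ i ∈ s, |a i - b i| + |a j - b j| * 1 := by gcongr; exact ha j
      _ = _ := by ring

theorem Phi_lip : ∃ C : ℝ, 0 < C ∧ ∀ v v' : logSpace K, |Phi v - Phi v'| ≤ C * ‖v - v'‖ := by
  obtain ⟨C, hC, h⟩ := repr_bound (K := K)
  refine ⟨rank K * C + 1, by positivity, fun v v' => ?_⟩
  have hab : ∀ x, |tri x| ≤ 1 := fun x => by rw [abs_of_nonneg (tri_nonneg x)]; exact tri_le_one x
  calc _ ≤ ∑ i, |tri ((bL K).repr v i) - tri ((bL K).repr v' i)| :=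
        prod_lip _ _ _ (fun i => hab _) (fun i => hab _)
    _ ≤ ∑ i : Fin (rank K), C * ‖v - v'‖ := by
      refine Finset.sum_le_sum fun i _ => (tri_lip _ _).trans ?_
      have := h (v - v') i
      simpa using this
    _ = rank K * C * ‖v - v'‖ := by simp; ring
    _ ≤ _ := by nlinarith [norm_nonneg (v - v')]

theorem Phi_supp : ∃ C : ℝ, 0 < C ∧ ∀ v : logSpace K, Phi v ≠ 0 → ∀ w, |v w| ≤ C := by
  refine ⟨∑ i, ‖bL K i‖ + 1, by positivity, fun v hv w => ?_⟩
  have h1 : ∀ i, |(bL K).repr v i| < 1 := fun i => by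
    apply tri_ne_zero
    intro h0
    exact hv (Finset.prod_eq_zero (Finset.mem_univ i) h0)
  have h2 : ‖v‖ ≤ ∑ i, ‖bL K i‖ := by
    conv_lhs => rw [← (bL K).sum_repr v]
    refine (norm_sum_le _ _).trans (Finset.sum_le_sum fun i _ => ?_)
    rw [_root_.norm_smul, Real.norm_eq_abs]
    nlinarith [h1 i, norm_nonneg (bL K i)]
  have h3 := norm_le_pi_norm v w
  rw [Real.norm_eq_abs] at h3
  linarith
end Units
end ModB1
end OmegaSq


namespace OmegaSq
section ModB2
open NumberField IsDedekindDomain Filter Topology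
open scoped nonZeroDivisors
section Est
open NumberField.Units NumberField.Units.dirichletUnitTheorem NumberField.mixedEmbedding
open scoped Classical
variable {K : Type*} [Field K] [NumberField K]


noncomputable def FF (s : ℝ) (x : mixedSpace K) : ℝ := Phi (logMap x) * (mixedEmbedding.norm x) ^ (-s)

theorem sum_mult_log (x : mixedSpace K) (hx : mixedEmbedding.norm x ≠ 0) :
    ∑ w : InfinitePlace K, (w.mult : ℝ) * Real.log (normAtPlace w x) = Real.log (mixedEmbedding.norm x) := by
  rw [mixedEmbedding.norm_apply, Real.log_prod (fun w _ => pow_ne_zero _ (mixedEmbedding.norm_ne_zero_iff.1 hx w))]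
  simp

theorem nap_le (w : InfinitePlace K) (x : mixedSpace K) : normAtPlace w x ≤ ‖x‖ := by
  rw [norm_eq_sup'_normAtPlace]; exact Finset.le_sup' (fun w => normAtPlace w x) (Finset.mem_univ w)

theorem one_le_mult (w : InfinitePlace K) : (1:ℝ) ≤ w.mult := by
  exact_mod_cast InfinitePlace.mult_pos

theorem mult_le_two (w : InfinitePlace K) : (w.mult:ℝ) ≤ 2 := by
  unfold InfinitePlace.mult; split_ifs <;> norm_num

theorem supp_comparable : ∃ c : ℝ, 0 < c ∧ c ≤ 1 ∧ ∀ x : mixedSpace K, mixedEmbedding.norm x ≠ 0 → 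
    Phi (logMap x) ≠ 0 → ∀ w, c * ‖x‖ ≤ normAtPlace w x := by
  obtain ⟨C, hC, h⟩ := Phi_supp (K := K)
  set C' : ℝ := (Fintype.card (InfinitePlace K) + 1) * C with hC'
  have hCC : C ≤ C' := by
    rw [hC']; have : (0:ℝ) ≤ Fintype.card (InfinitePlace K) := by positivity
    nlinarith
  refine ⟨Real.exp (-(2*C')), Real.exp_pos _, Real.exp_le_one_iff.2 (by linarith), fun x hx hP => ?_⟩
  have hpos : ∀ w, 0 < normAtPlace w x := fun w => 
    lt_of_le_of_ne (normAtPlace_nonneg w x) (Ne.symm (mixedEmbedding.norm_ne_zero_iff.1 hx w))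
  set ℓ : InfinitePlace K → ℝ := fun w => Real.log (normAtPlace w x) - Real.log (mixedEmbedding.norm x) * (Module.finrank ℚ K : ℝ)⁻¹ with hℓ
  have h1 : ∀ w, w ≠ w₀ → |(w.mult : ℝ) * ℓ w| ≤ C := fun w hw => h _ hP ⟨w, hw⟩
  have hn : (Module.finrank ℚ K : ℝ) ≠ 0 := Nat.cast_ne_zero.mpr Module.finrank_pos.ne'
  have h2 : ∑ w, (w.mult : ℝ) * ℓ w = 0 := by
    simp only [hℓ, mul_sub, Finset.sum_sub_distrib, sum_mult_log x hx]
    rw [← Finset.sum_mul, ← Nat.cast_sum, InfinitePlace.sum_mult_eq]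
    field_simp; ring
  have h3 : ∀ w, |(w.mult : ℝ) * ℓ w| ≤ C' := by
    intro w
    by_cases hw : w = w₀
    · subst hw
      rw [← Finset.add_sum_erase _ _ (Finset.mem_univ w₀)] at h2
      rw [eq_neg_of_add_eq_zero_left h2, abs_neg]
      refine (Finset.abs_sum_le_sum_abs _ _).trans ?_
      refine (Finset.sum_le_card_nsmul _ _ C (fun w hw => h1 w (Finset.ne_of_mem_erase hw))).trans ?_
      rw [nsmul_eq_mul, hC']
      gcongr
      have : (Finset.univ.erase (w₀ : InfinitePlace K)).card ≤ Fintype.card (InfinitePlace K) := Finset.card_le_univ _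
      have : ((Finset.univ.erase (w₀ : InfinitePlace K)).card : ℝ) ≤ Fintype.card (InfinitePlace K) := by exact_mod_cast this
      linarith
    · exact (h1 w hw).trans hCC
  have h4 : ∀ w, |ℓ w| ≤ C' := fun w => by
    have := h3 w
    rw [abs_mul, abs_of_pos (lt_of_lt_of_le one_pos (one_le_mult w))] at this
    nlinarith [one_le_mult w, abs_nonneg (ℓ w)]
  intro w
  obtain ⟨w', _, hw'⟩ := Finset.exists_mem_eq_sup' (Finset.univ_nonempty (α := InfinitePlace K)) (fun w => normAtPlace w x)
  rw [norm_eq_sup'_normAtPlace, hw', ← Real.log_le_log_iff (mul_pos (Real.exp_pos _) (hpos w')) (hpos w), Real.log_mul (Real.exp_pos _).ne' (hpos w').ne', Real.log_exp]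
  have a := abs_le.1 (h4 w); have b := abs_le.1 (h4 w')
  simp only [hℓ] at a b
  linarith

theorem log_lip {a b A T : ℝ} (hA : 0 < A) (ha : A ≤ a) (hb : A ≤ b) (hT : |a - b| ≤ T) :
    |Real.log a - Real.log b| ≤ T / A := by
  have key : ∀ a b : ℝ, A ≤ a → A ≤ b → |a - b| ≤ T → Real.log a - Real.log b ≤ T / A := by
    intro a b ha hb hT
    have ha' := hA.trans_le ha
    have hb' := hA.trans_le hb
    rw [← Real.log_div ha'.ne' hb'.ne']
    have := Real.log_le_sub_one_of_pos (div_pos ha' hb')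
    have h2 : a / b - 1 = (a - b) / b := by field_simp
    rw [h2] at this
    refine this.trans (div_le_div₀ ((abs_nonneg _).trans hT) ((le_abs_self _).trans hT) hA hb)
  rw [abs_le]
  constructor
  · have := key b a hb ha (by rwa [abs_sub_comm]); linarith
  · exact key a b ha hb hT

theorem rpow_lip {a b m s D : ℝ} (hm : 1 ≤ m) (ha : m ≤ a) (hb : m ≤ b) (hs : 1 ≤ s) (hs2 : s ≤ 2)
    (hD : |Real.log a - Real.log b| ≤ D) : |a ^ (-s) - b ^ (-s)| ≤ 2 * D * m⁻¹ := by
  have hm0 : 0 < m := by linarith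
  have key : ∀ a b : ℝ, m ≤ a → m ≤ b → |Real.log a - Real.log b| ≤ D → a ^ (-s) - b ^ (-s) ≤ 2 * D * m⁻¹ := by
    intro a b ha hb hD
    have hD0 := (abs_nonneg _).trans hD
    have ha' := hm0.trans_le ha
    have hb' := hm0.trans_le hb
    have h1 : b ^ (-s) = a ^ (-s) * Real.exp (s * (Real.log a - Real.log b)) := by
      rw [Real.rpow_def_of_pos hb', Real.rpow_def_of_pos ha', ← Real.exp_add]; congr 1; ring
    have h2 := Real.add_one_le_exp (s * (Real.log a - Real.log b))
    have h3 : a ^ (-s) ≤ m⁻¹ := by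
      rw [← Real.rpow_neg_one]
      calc a ^ (-s) ≤ m ^ (-s) := Real.rpow_le_rpow_of_nonpos hm0 ha (by linarith)
        _ ≤ m ^ (-1:ℝ) := Real.rpow_le_rpow_of_exponent_le hm (by linarith)
    have h4 : 0 < a ^ (-s) := Real.rpow_pos_of_pos ha' _
    rw [h1]
    have h5 : - (s * (Real.log a - Real.log b)) ≤ 2 * D := by
      have := (abs_le.1 hD).1
      nlinarith
    calc _ = a ^ (-s) * (1 - Real.exp (s * (Real.log a - Real.log b))) := by ring
      _ ≤ a ^ (-s) * (2 * D) := by gcongr; linarith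
      _ ≤ m⁻¹ * (2 * D) := by gcongr
      _ = _ := by ring
  rw [abs_le]
  constructor
  · have := key b a hb ha (by rwa [abs_sub_comm]); linarith
  · exact key a b ha hb hD

theorem norm_ge_pow {x : mixedSpace K} {A : ℝ} (hA : 0 ≤ A) (h : ∀ w, A ≤ normAtPlace w x) :
    A ^ (Module.finrank ℚ K) ≤ mixedEmbedding.norm x := by
  rw [mixedEmbedding.norm_apply, ← InfinitePlace.sum_mult_eq, ← Finset.prod_pow_eq_pow_sum]
  exact Finset.prod_le_prod (fun w _ => by positivity) fun w _ => pow_le_pow_left₀ hA (h w) _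

theorem nap_sub (w : InfinitePlace K) (x y : mixedSpace K) : |normAtPlace w x - normAtPlace w y| ≤ ‖x - y‖ := by
  have h1 := normAtPlace_add_le w (x - y) y
  have h2 := normAtPlace_add_le w (y - x) x
  have h3 := nap_le w (x - y)
  have h4 := nap_le w (y - x)
  rw [norm_sub_rev] at h4
  simp only [sub_add_cancel] at h1 h2
  rw [abs_le]; constructor <;> linarith

theorem FF_est (T : ℝ) (hT : 0 ≤ T) : ∃ C R : ℝ, 0 < C ∧ 1 ≤ R ∧ ∀ s : ℝ, 1 ≤ s → s ≤ 2 → ∀ x y : mixedSpace K,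
    mixedEmbedding.norm x ≠ 0 → Phi (logMap x) ≠ 0 → R ≤ ‖x‖ → ‖x - y‖ ≤ T → 
    |FF s x - FF s y| ≤ C * (‖x‖⁻¹) ^ ((Module.finrank ℚ K) + 1) := by
  obtain ⟨c, hc, hc1, h⟩ := supp_comparable (K := K)
  obtain ⟨B, hB, hlip⟩ := Phi_lip (K := K)
  have hn : (0:ℝ) < (Module.finrank ℚ K) := Nat.cast_pos.mpr Module.finrank_pos
  have hn1 : (1:ℝ) ≤ (Module.finrank ℚ K) := by exact_mod_cast (Module.finrank_pos : 0 < (Module.finrank ℚ K))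
  refine ⟨(4 * B + 2 * (Module.finrank ℚ K)) * (2 * T / c) * ((c / 2) ^ (Module.finrank ℚ K))⁻¹ + 1, 2 / c + 2 * T / c + 1, by positivity, by
    have : 0 ≤ 2 / c + 2 * T / c := by positivity
    linarith, fun s hs hs2 x y hx hP hR hxy => ?_⟩
  have hx0 : 0 < ‖x‖ := by
    have : 0 ≤ 2 / c + 2 * T / c := by positivity
    linarith
  have hcx : 2 ≤ c * ‖x‖ := by
    have : 2 / c ≤ ‖x‖ := by
      have : 0 ≤ 2 * T / c := by positivity
      linarith
    rw [div_le_iff₀ hc] at this; linarith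
  have hcx2 : 2 * T ≤ c * ‖x‖ := by
    have : 2 * T / c ≤ ‖x‖ := by
      have : 0 ≤ 2 / c := by positivity
      linarith
    rw [div_le_iff₀ hc] at this; linarith
  set A := c * ‖x‖ / 2 with hA
  have hA1 : 1 ≤ A := by rw [hA]; linarith
  have hA0 : 0 < A := by linarith
  have hxA : ∀ w, A ≤ normAtPlace w x := fun w => by have := h x hx hP w; rw [hA]; linarith
  have hyA : ∀ w, A ≤ normAtPlace w y := fun w => by
    have h1 := h x hx hP w
    have h2 := (abs_le.1 ((nap_sub w x y).trans hxy)).2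
    rw [hA]; linarith
  have hy : mixedEmbedding.norm y ≠ 0 := mixedEmbedding.norm_ne_zero_iff.2 fun w => (hA0.trans_le (hyA w)).ne'
  set δ := T / A with hδ
  have hδ0 : 0 ≤ δ := by positivity
  have hl : ∀ w, |Real.log (normAtPlace w x) - Real.log (normAtPlace w y)| ≤ δ := fun w =>
    log_lip hA0 (hxA w) (hyA w) ((nap_sub w x y).trans hxy)
  have hN : |Real.log (mixedEmbedding.norm x) - Real.log (mixedEmbedding.norm y)| ≤ (Module.finrank ℚ K) * δ := by
    rw [← sum_mult_log x hx, ← sum_mult_log y hy, ← Finset.sum_sub_distrib, ← InfinitePlace.sum_mult_eq, Nat.cast_sum, Finset.sum_mul]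
    refine (Finset.abs_sum_le_sum_abs _ _).trans (Finset.sum_le_sum fun w _ => ?_)
    rw [← mul_sub, abs_mul, Nat.abs_cast]
    gcongr
    exact hl w
  have hLM : ‖logMap x - logMap y‖ ≤ 4 * δ := by
    rw [pi_norm_le_iff_of_nonneg (by positivity)]
    intro w
    rw [Pi.sub_apply, logMap_apply, logMap_apply, ← mul_sub, Real.norm_eq_abs, abs_mul, Nat.abs_cast]
    have h1 : |Real.log (normAtPlace w.1 x) - Real.log (mixedEmbedding.norm x) * (Module.finrank ℚ K:ℝ)⁻¹ - (Real.log (normAtPlace w.1 y) - Real.log (mixedEmbedding.norm y) * (Module.finrank ℚ K:ℝ)⁻¹)| ≤ 2 * δ := by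
      have h2 : |(Real.log (mixedEmbedding.norm x) - Real.log (mixedEmbedding.norm y)) * (Module.finrank ℚ K:ℝ)⁻¹| ≤ δ := by
        rw [abs_mul, abs_inv, Nat.abs_cast, ← div_eq_mul_inv, div_le_iff₀ hn, mul_comm δ]; exact hN
      have h3 := hl w.1
      rw [abs_le] at h2 h3 ⊢
      constructor <;> nlinarith
    have := mult_le_two w.1
    have := one_le_mult w.1
    calc _ ≤ 2 * (2 * δ) := by gcongr
      _ = _ := by ring
  set m := A ^ (Module.finrank ℚ K) with hm
  have hm1 : 1 ≤ m := one_le_pow₀ hA1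
  have hxm : m ≤ mixedEmbedding.norm x := norm_ge_pow hA0.le hxA
  have hym : m ≤ mixedEmbedding.norm y := norm_ge_pow hA0.le hyA
  have hm0 : 0 < m := by linarith
  have e1 := rpow_lip hm1 hxm hym hs hs2 hN
  have e2 := (hlip (logMap x) (logMap y)).trans (mul_le_mul_of_nonneg_left hLM hB.le)
  have e3 : (mixedEmbedding.norm x) ^ (-s) ≤ m⁻¹ := by
    rw [← Real.rpow_neg_one]
    calc _ ≤ m ^ (-s) := Real.rpow_le_rpow_of_nonpos hm0 hxm (by linarith)
      _ ≤ m ^ (-1:ℝ) := Real.rpow_le_rpow_of_exponent_le hm1 (by linarith)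
  have e4 : 0 ≤ (mixedEmbedding.norm x) ^ (-s) := Real.rpow_nonneg (mixedEmbedding.norm_nonneg _) _
  have e5 : |Phi (logMap y)| ≤ 1 := by rw [abs_of_nonneg (Phi_nonneg _)]; exact Phi_le_one _
  calc |FF s x - FF s y| = |(Phi (logMap x) - Phi (logMap y)) * (mixedEmbedding.norm x) ^ (-s) + Phi (logMap y) * ((mixedEmbedding.norm x) ^ (-s) - (mixedEmbedding.norm y) ^ (-s))| := by
        unfold FF; ring_nf
    _ ≤ |Phi (logMap x) - Phi (logMap y)| * (mixedEmbedding.norm x) ^ (-s) + |Phi (logMap y)| * |(mixedEmbedding.norm x) ^ (-s) - (mixedEmbedding.norm y) ^ (-s)| := by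
        refine (abs_add_le _ _).trans ?_
        rw [abs_mul, abs_mul, abs_of_nonneg e4]
    _ ≤ B * (4 * δ) * m⁻¹ + 1 * (2 * ((Module.finrank ℚ K) * δ) * m⁻¹) := by gcongr
    _ = (4 * B + 2 * (Module.finrank ℚ K)) * (2 * T / c) * ((c / 2) ^ (Module.finrank ℚ K))⁻¹ * (‖x‖⁻¹) ^ ((Module.finrank ℚ K) + 1) := by
        have : m = (c/2) ^ (Module.finrank ℚ K) * ‖x‖ ^ (Module.finrank ℚ K) := by rw [hm, hA, ← mul_pow]; ring
        rw [this, hδ, hA, inv_pow]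
        field_simp
        ring
    _ ≤ _ := by
        gcongr
        linarith

theorem FF_abs_le {s : ℝ} (hs : 1 ≤ s) {x : mixedSpace K} (hx : x = 0 ∨ 1 ≤ mixedEmbedding.norm x) : 
    0 ≤ FF s x ∧ FF s x ≤ 1 := by
  have h0 : 0 ≤ (mixedEmbedding.norm x) ^ (-s) := Real.rpow_nonneg (mixedEmbedding.norm_nonneg _) _
  refine ⟨mul_nonneg (Phi_nonneg _) h0, ?_⟩
  have h1 : (mixedEmbedding.norm x) ^ (-s) ≤ 1 := by
    rcases hx with rfl | hx
    · rw [map_zero, Real.zero_rpow (by linarith)]; norm_num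
    · exact Real.rpow_le_one_of_one_le_of_nonpos hx (by linarith)
  exact mul_le_one₀ (Phi_le_one _) h0 h1

theorem FF_est' (T : ℝ) (hT : 0 ≤ T) : ∃ C : ℝ, 0 < C ∧ ∀ s : ℝ, 1 ≤ s → s ≤ 2 → ∀ x y : mixedSpace K,
    x ≠ 0 → (x = 0 ∨ 1 ≤ mixedEmbedding.norm x) → (y = 0 ∨ 1 ≤ mixedEmbedding.norm y) → ‖x - y‖ ≤ T → 
    |FF s x - FF s y| ≤ C * (‖x‖⁻¹) ^ ((Module.finrank ℚ K) + 1) := by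
  obtain ⟨C, R, hC, hR, h⟩ := FF_est (K := K) T hT
  set R' := R + 2 * T with hR'
  have hR'0 : 0 < R' := by linarith
  refine ⟨C * 2 ^ ((Module.finrank ℚ K) + 1) + R' ^ ((Module.finrank ℚ K) + 1), by positivity, fun s hs hs2 x y hx0 hx hy hxy => ?_⟩
  have hxp : 0 < ‖x‖ := norm_pos_iff.2 hx0
  have hxn : mixedEmbedding.norm x ≠ 0 := by
    rcases hx with h | h
    · exact absurd h hx0
    · linarith
  have hI : 0 ≤ (‖x‖⁻¹) ^ ((Module.finrank ℚ K) + 1) := by positivity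
  by_cases hsm : ‖x‖ ≤ R'
  · have h1 := FF_abs_le hs hx
    have h2 := FF_abs_le hs hy
    have h3 : |FF s x - FF s y| ≤ 1 := by rw [abs_le]; constructor <;> linarith
    have h4 : 1 ≤ R' ^ ((Module.finrank ℚ K) + 1) * (‖x‖⁻¹) ^ ((Module.finrank ℚ K) + 1) := by
      rw [← mul_pow]; apply one_le_pow₀
      rw [← div_eq_mul_inv, le_div_iff₀ hxp]; linarith
    have h5 : 0 ≤ C * 2 ^ ((Module.finrank ℚ K) + 1) * (‖x‖⁻¹) ^ ((Module.finrank ℚ K) + 1) := by positivity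
    nlinarith
  · push Not at hsm
    have h1 : ‖x‖ - T ≤ ‖y‖ := by
      have := norm_sub_norm_le x y; linarith
    have h2 : ‖x‖ / 2 ≤ ‖y‖ := by linarith
    have hyp : 0 < ‖y‖ := by linarith
    have hE : 0 ≤ R' ^ ((Module.finrank ℚ K) + 1) * (‖x‖⁻¹) ^ ((Module.finrank ℚ K) + 1) := by positivity
    by_cases hPx : Phi (logMap x) = 0
    · by_cases hPy : Phi (logMap y) = 0
      · rw [FF, FF, hPx, hPy]; simp; positivity
      · have hyn : mixedEmbedding.norm y ≠ 0 := by
          rcases hy with h | h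
          · exact absurd h (norm_pos_iff.1 hyp)
          · linarith
        have := h s hs hs2 y x hyn hPy (by linarith) (by rwa [norm_sub_rev])
        rw [abs_sub_comm]
        refine this.trans ?_
        have h6 : (‖y‖⁻¹) ^ ((Module.finrank ℚ K) + 1) ≤ 2 ^ ((Module.finrank ℚ K) + 1) * (‖x‖⁻¹) ^ ((Module.finrank ℚ K) + 1) := by
          rw [← mul_pow]; gcongr
          rw [← div_eq_mul_inv, le_div_iff₀ hxp, inv_mul_le_iff₀ hyp]; linarith
        nlinarith
    · have := h s hs hs2 x y hxn hPx (by linarith) hxy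
      refine this.trans ?_
      have h7 : (1:ℝ) ≤ 2 ^ ((Module.finrank ℚ K) + 1) := one_le_pow₀ (by norm_num)
      have h8 : C * (‖x‖⁻¹) ^ ((Module.finrank ℚ K) + 1) ≤ C * 2 ^ ((Module.finrank ℚ K) + 1) * (‖x‖⁻¹) ^ ((Module.finrank ℚ K) + 1) := by
        have := mul_nonneg hC.le hI
        nlinarith
      nlinarith

theorem FF_upper (s : ℝ) (hs : 1 < s) : ∃ C : ℝ, ∀ x : mixedSpace K, (x = 0 ∨ 1 ≤ mixedEmbedding.norm x) → 
    FF s x ≤ C * ‖x‖ ^ (-((Module.finrank ℚ K) * s)) := by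
  obtain ⟨c, hc, hc1, h⟩ := supp_comparable (K := K)
  refine ⟨(c ^ (Module.finrank ℚ K)) ^ (-s), fun x hx => ?_⟩
  by_cases hx0 : x = 0
  · subst hx0
    rw [FF, map_zero, Real.zero_rpow (by linarith), mul_zero]; positivity
  have hx1 := hx.resolve_left hx0
  by_cases hP : Phi (logMap x) = 0
  · rw [FF, hP, zero_mul]; positivity
  have hxp : 0 < ‖x‖ := norm_pos_iff.2 hx0
  have h1 := norm_ge_pow (by positivity) (h x (by linarith) hP)
  have h2 : (mixedEmbedding.norm x) ^ (-s) ≤ ((c * ‖x‖) ^ (Module.finrank ℚ K)) ^ (-s) :=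
    Real.rpow_le_rpow_of_nonpos (by positivity) h1 (by linarith)
  have h3 : ((c * ‖x‖) ^ (Module.finrank ℚ K)) ^ (-s) = (c ^ (Module.finrank ℚ K)) ^ (-s) * ‖x‖ ^ (-((Module.finrank ℚ K) * s)) := by
    rw [mul_pow, Real.mul_rpow (by positivity) (by positivity), ← mul_neg, Real.rpow_mul hxp.le, Real.rpow_natCast]
  rw [← h3]
  have h0 : 0 ≤ (mixedEmbedding.norm x) ^ (-s) := Real.rpow_nonneg (mixedEmbedding.norm_nonneg _) _
  calc FF s x ≤ 1 * (mixedEmbedding.norm x) ^ (-s) := mul_le_mul_of_nonneg_right (Phi_le_one _) h0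
    _ ≤ _ := by rw [one_mul]; exact h2
end Est
end ModB2
end OmegaSq


namespace OmegaSq
section ModB3
open NumberField IsDedekindDomain Filter Topology
open scoped nonZeroDivisors
section Sums
open NumberField.Units NumberField.Units.dirichletUnitTheorem NumberField.mixedEmbedding
open scoped Classical
variable {K : Type*} [Field K] [NumberField K]

noncomputable def emb (x : 𝓞 K) : mixedSpace K := mixedEmbedding K (x : K)

theorem emb_sub (x y : 𝓞 K) : emb (x - y) = emb x - emb y := by simp [emb]
theorem emb_inj : Function.Injective (emb : 𝓞 K → mixedSpace K) := fun x y h =>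
  RingOfIntegers.ext (mixedEmbedding_injective K h)
theorem emb_eq_zero {x : 𝓞 K} : emb x = 0 ↔ x = 0 := by
  constructor
  · intro h; apply emb_inj; rw [h]; simp [emb]
  · rintro rfl; simp [emb]

theorem norm_emb (x : 𝓞 K) : mixedEmbedding.norm (emb x) = (Ideal.absNorm (Ideal.span {x}) : ℝ) := by
  rw [emb, norm_eq_norm, Ideal.absNorm_span_singleton, Nat.cast_natAbs, Int.cast_abs]
  have : (Algebra.norm ℚ (x : K)) = (Algebra.norm ℤ x : ℚ) := by
    exact (Algebra.coe_norm_int x).symm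
  rw [this]
  simp

theorem emb_dich (x : 𝓞 K) : emb x = 0 ∨ 1 ≤ mixedEmbedding.norm (emb x) := by
  by_cases h : x = 0
  · left; exact emb_eq_zero.2 h
  · right
    rw [norm_emb]
    have : Ideal.absNorm (Ideal.span {x}) ≠ 0 := by
      rw [Ne, Ideal.absNorm_eq_zero_iff, Ideal.span_singleton_eq_bot]; exact h
    exact_mod_cast Nat.one_le_iff_ne_zero.2 this

theorem summable_pull {α β : Type*} {f : β → ℝ} (h : Summable f) (i : α → β) (hi : Function.Injective i) 
    (g : α → ℝ) (hg : ∀ x, g x = f (i x)) : Summable g := by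
  have := h.comp_injective hi
  rwa [show g = f ∘ i from funext hg]

theorem summable_emb (r : ℝ) (hr : r < -(Module.finrank ℚ K : ℝ)) : Summable (fun x : 𝓞 K => ‖emb x‖ ^ r) := by
  have h := ZLattice.summable_norm_rpow (mixedEmbedding.integerLattice K) r (by
    rw [ZLattice.rank ℝ, mixedEmbedding.finrank]; exact hr)
  exact summable_pull h (fun x : 𝓞 K => ⟨emb x, x, rfl⟩) (fun x y hxy => emb_inj (congrArg Subtype.val hxy)) _ (fun x => rfl)

noncomputable def g (s : ℝ) (x : 𝓞 K) : ℝ := FF s (emb x)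

theorem g_nonneg {s : ℝ} (hs : 1 ≤ s) (x : 𝓞 K) : 0 ≤ g s x := (FF_abs_le hs (emb_dich x)).1

theorem summable_g (s : ℝ) (hs : 1 < s) : Summable (fun x : 𝓞 K => g s x) := by
  obtain ⟨C, hC⟩ := FF_upper (K := K) s hs
  refine Summable.of_nonneg_of_le (g_nonneg hs.le) (fun x => hC _ (emb_dich x)) ((summable_emb _ ?_).mul_left C)
  have hn : (0:ℝ) < Module.finrank ℚ K := Nat.cast_pos.mpr Module.finrank_pos
  nlinarith

theorem out_bij (a : Ideal (𝓞 K)) : Function.Bijective (fun p : (𝓞 K ⧸ a) × a => (Quotient.out p.1 + (p.2 : 𝓞 K) : 𝓞 K)) := by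
  have hout : ∀ q : 𝓞 K ⧸ a, Ideal.Quotient.mk a (Quotient.out q) = q := fun q => Quotient.out_eq q
  constructor
  · rintro ⟨q, b⟩ ⟨q', b'⟩ h
    have h1 := congrArg (Ideal.Quotient.mk a) h
    simp only [map_add, hout, Ideal.Quotient.eq_zero_iff_mem.2 b.2, Ideal.Quotient.eq_zero_iff_mem.2 b'.2, add_zero] at h1
    subst h1
    simp only [add_right_inj] at h
    rw [Subtype.ext h]
  · intro x
    refine ⟨(Ideal.Quotient.mk a x, ⟨x - Quotient.out (Ideal.Quotient.mk a x), ?_⟩), by simp⟩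
    rw [← Ideal.Quotient.eq_zero_iff_mem, map_sub, hout, sub_self]

theorem coset_est (a : Ideal (𝓞 K)) (ha : a ≠ ⊥) : ∃ C : ℝ, ∀ s : ℝ, 1 < s → s ≤ 2 → 
    |∑' x : 𝓞 K, g s x - Ideal.absNorm a * ∑' b : a, g s (b : 𝓞 K)| ≤ C := by
  have : Finite (𝓞 K ⧸ a) := Ideal.finiteQuotientOfFreeOfNeBot a ha
  have := Fintype.ofFinite (𝓞 K ⧸ a)
  have hcard : Ideal.absNorm a = Fintype.card (𝓞 K ⧸ a) := by
    rw [Ideal.absNorm_apply, Submodule.cardQuot_apply, Nat.card_eq_fintype_card]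
  set T : ℝ := ∑ q : 𝓞 K ⧸ a, ‖emb (Quotient.out q)‖ with hT
  obtain ⟨C, hC, hest⟩ := FF_est' (K := K) T (by positivity)
  let bd : 𝓞 K → ℝ := fun b => C * ‖emb b‖ ^ (-((Module.finrank ℚ K + 1 : ℕ) : ℝ)) + Set.indicator {0} (fun _ => (1:ℝ)) b
  have hbd : Summable bd := by
    refine Summable.add ((summable_emb _ (by push_cast; linarith)).mul_left C) ?_
    exact summable_of_hasFiniteSupport ((Set.finite_singleton (0 : 𝓞 K)).subset Set.support_indicator_subset)
  have hbda : Summable (fun b : a => bd b) := hbd.comp_injective Subtype.val_injective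
  refine ⟨∑ q : 𝓞 K ⧸ a, ∑' b : a, bd b, fun s hs hs2 => ?_⟩
  have hterm : ∀ (q : 𝓞 K ⧸ a) (b : 𝓞 K), |g s (Quotient.out q + b) - g s b| ≤ bd b := by
    intro q b
    by_cases hb : b = 0
    · subst hb
      have h1 := FF_abs_le hs.le (emb_dich (Quotient.out q + 0))
      have h2 := FF_abs_le hs.le (emb_dich (0 : 𝓞 K))
      have h3 : (1:ℝ) ≤ bd 0 := by
        simp only [bd, Set.indicator_of_mem (Set.mem_singleton (0 : 𝓞 K))]
        have : 0 ≤ C * ‖emb (0 : 𝓞 K)‖ ^ (-((Module.finrank ℚ K + 1 : ℕ) : ℝ)) := by positivity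
        linarith
      refine le_trans ?_ h3
      rw [abs_le]; constructor <;> (unfold g; linarith)
    · have h1 := hest s hs.le hs2 (emb b) (emb (Quotient.out q + b)) (fun h => hb (emb_eq_zero.1 h)) (emb_dich _) (emb_dich _) (by
        rw [norm_sub_rev, ← emb_sub, add_sub_cancel_right, hT]
        exact Finset.single_le_sum (f := fun q : 𝓞 K ⧸ a => ‖emb (Quotient.out q)‖) (fun _ _ => norm_nonneg _) (Finset.mem_univ q))
      rw [abs_sub_comm]
      refine h1.trans ?_
      simp only [bd]
      rw [Real.rpow_neg (norm_nonneg _), Real.rpow_natCast, inv_pow]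
      have : 0 ≤ Set.indicator {(0 : 𝓞 K)} (fun _ => (1:ℝ)) b := Set.indicator_nonneg (fun _ _ => zero_le_one) _
      linarith
  have hsg := summable_g (K := K) s hs
  have hsa : Summable (fun b : a => g s (b : 𝓞 K)) := hsg.comp_injective Subtype.val_injective
  have hsq : ∀ q : 𝓞 K ⧸ a, Summable (fun b : a => g s (Quotient.out q + (b : 𝓞 K))) := fun q =>
    hsg.comp_injective (i := fun b : a => Quotient.out q + (b : 𝓞 K)) (fun b b' h => Subtype.ext (add_left_cancel h))
  have h1 : ∑' x : 𝓞 K, g s x = ∑ q : 𝓞 K ⧸ a, ∑' b : a, g s (Quotient.out q + (b : 𝓞 K)) := by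
    rw [← (Equiv.ofBijective _ (out_bij a)).tsum_eq, ← tsum_fintype (L := .unconditional _)]
    exact (((Equiv.ofBijective _ (out_bij a)).summable_iff).2 hsg).tsum_prod' (fun q => hsq q)
  have h2 : Ideal.absNorm a * ∑' b : a, g s (b : 𝓞 K) = ∑ q : 𝓞 K ⧸ a, ∑' b : a, g s (b : 𝓞 K) := by
    rw [Finset.sum_const, Finset.card_univ, ← hcard, nsmul_eq_mul]
  rw [h1, h2, ← Finset.sum_sub_distrib]
  refine (Finset.abs_sum_le_sum_abs _ _).trans (Finset.sum_le_sum fun q _ => ?_)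
  rw [← (hsq q).tsum_sub hsa]
  have hn : Summable (fun b : a => ‖g s (Quotient.out q + (b : 𝓞 K)) - g s (b : 𝓞 K)‖) := 
    Summable.of_nonneg_of_le (fun _ => norm_nonneg _) (fun b => hterm q b) hbda
  refine (norm_tsum_le_tsum_norm hn).trans ?_
  exact hn.tsum_le_tsum (fun b => hterm q b) hbda

noncomputable def zc (c : ClassGroup (𝓞 K)) (s : ℝ) : ℝ := 
  ∑' I : {I : (Ideal (𝓞 K))⁰ // ClassGroup.mk0 I = c}, (Ideal.absNorm (I.1 : Ideal (𝓞 K)) : ℝ) ^ (-s)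

theorem gen_exists (a : (Ideal (𝓞 K))⁰) (I : {I : (Ideal (𝓞 K))⁰ // ClassGroup.mk0 I = (ClassGroup.mk0 a)⁻¹}) :
    ∃ x : 𝓞 K, (a : Ideal (𝓞 K)) * (I.1 : Ideal (𝓞 K)) = Ideal.span {x} := by
  have h : ClassGroup.mk0 (a * I.1) = 1 := by rw [map_mul, I.2, mul_inv_cancel]
  obtain ⟨x, hx⟩ := ((ClassGroup.mk0_eq_one_iff (a * I.1).2).1 h).principal
  exact ⟨x, hx⟩

noncomputable def gen (a : (Ideal (𝓞 K))⁰) (I : {I : (Ideal (𝓞 K))⁰ // ClassGroup.mk0 I = (ClassGroup.mk0 a)⁻¹}) : 𝓞 K :=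
  (gen_exists a I).choose

theorem gen_spec (a : (Ideal (𝓞 K))⁰) (I : {I : (Ideal (𝓞 K))⁰ // ClassGroup.mk0 I = (ClassGroup.mk0 a)⁻¹}) :
    (a : Ideal (𝓞 K)) * (I.1 : Ideal (𝓞 K)) = Ideal.span {gen a I} := (gen_exists a I).choose_spec

theorem ideal_ne (I : (Ideal (𝓞 K))⁰) : (I : Ideal (𝓞 K)) ≠ 0 := nonZeroDivisors.coe_ne_zero I

theorem gen_mem (a : (Ideal (𝓞 K))⁰) (I : {I : (Ideal (𝓞 K))⁰ // ClassGroup.mk0 I = (ClassGroup.mk0 a)⁻¹}) : gen a I ∈ (a : Ideal (𝓞 K)) := by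
  have h1 : Ideal.span {gen a I} ≤ (a : Ideal (𝓞 K)) := by
    rw [← gen_spec]; exact (Ideal.mul_le_left : (a : Ideal (𝓞 K)) * (I.1 : Ideal (𝓞 K)) ≤ a)
  exact h1 (Ideal.mem_span_singleton_self _)

theorem gen_ne (a : (Ideal (𝓞 K))⁰) (I : {I : (Ideal (𝓞 K))⁰ // ClassGroup.mk0 I = (ClassGroup.mk0 a)⁻¹}) : gen a I ≠ 0 := by
  intro h
  have := gen_spec a I
  rw [h, Ideal.span_singleton_eq_bot.2 rfl] at this
  exact mul_ne_zero (ideal_ne a) (ideal_ne I.1) this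

abbrev ClsI (a : (Ideal (𝓞 K))⁰) := {I : (Ideal (𝓞 K))⁰ // ClassGroup.mk0 I = (ClassGroup.mk0 a)⁻¹}

noncomputable def genMap (a : (Ideal (𝓞 K))⁰) (p : ClsI a × (𝓞 K)ˣ) : 𝓞 K := (p.2 : 𝓞 K) * gen a p.1

theorem genMap_mem (a : (Ideal (𝓞 K))⁰) (p : ClsI a × (𝓞 K)ˣ) : genMap a p ∈ (a : Ideal (𝓞 K)) := by
  rw [genMap]
  exact Ideal.mul_mem_left _ _ (gen_mem a p.1)

theorem genMap_inj (a : (Ideal (𝓞 K))⁰) : Function.Injective (genMap a) := by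
  rintro ⟨I, u⟩ ⟨I', u'⟩ h
  have h : (u : 𝓞 K) * gen a I = u' * gen a I' := h
  have h1 : Ideal.span {gen a I} = Ideal.span {gen a I'} := by
    rw [← Ideal.span_singleton_mul_left_unit u.isUnit, h, Ideal.span_singleton_mul_left_unit u'.isUnit]
  rw [← gen_spec, ← gen_spec] at h1
  have h2 := mul_left_cancel₀ (ideal_ne a) h1
  have h3 : I = I' := Subtype.ext (Subtype.ext h2)
  subst h3
  have := mul_right_cancel₀ (gen_ne a I) h
  rw [Units.ext this]

theorem genMap_surj (a : (Ideal (𝓞 K))⁰) (x : 𝓞 K) (hx : x ∈ (a : Ideal (𝓞 K))) (hx0' : x ≠ 0) : x ∈ Set.range (genMap a) := by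
  have h1 : Ideal.span {x} ≤ (a : Ideal (𝓞 K)) := (Ideal.span_singleton_le_iff_mem _).2 hx
  obtain ⟨J, hJ⟩ := Ideal.dvd_iff_le.2 h1
  have hJ0 : J ≠ 0 := by
    rintro rfl
    rw [mul_zero] at hJ
    exact hx0' (Ideal.span_singleton_eq_bot.1 hJ)
  obtain ⟨J', rfl⟩ : ∃ J' : (Ideal (𝓞 K))⁰, J = J' := ⟨⟨J, mem_nonZeroDivisors_of_ne_zero hJ0⟩, rfl⟩
  have hJc : ClassGroup.mk0 J' = (ClassGroup.mk0 a)⁻¹ := by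
    rw [eq_inv_iff_mul_eq_one, mul_comm, ← map_mul]
    refine (ClassGroup.mk0_eq_one_iff (a * J' : (Ideal (𝓞 K))⁰).2).2 ⟨x, ?_⟩
    exact hJ.symm
  have h2 : Ideal.span {gen a ⟨J', hJc⟩} = Ideal.span {x} := by rw [← gen_spec, hJ]
  obtain ⟨u, hu⟩ := Ideal.span_singleton_eq_span_singleton.1 h2
  refine ⟨(⟨J', hJc⟩, u), ?_⟩
  rw [← hu, genMap, mul_comm]

theorem g_unit_mul (s : ℝ) (u : (𝓞 K)ˣ) {x : 𝓞 K} (hx : x ≠ 0) : 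
    g s ((u : 𝓞 K) * x) = Phi (logEmbedding K (Additive.ofMul u) + logMap (emb x)) * (Ideal.absNorm (Ideal.span {x}) : ℝ) ^ (-s) := by
  have h0 : mixedEmbedding.norm (emb x) ≠ 0 := by
    rcases emb_dich x with h | h
    · exact absurd (emb_eq_zero.1 h) hx
    · linarith
  have h1 : emb ((u : 𝓞 K) * x) = u • emb x := by
    rw [unitSMul_smul, emb, emb, ← map_mul]; rfl
  rw [g, FF, norm_emb, Ideal.span_singleton_mul_left_unit u.isUnit, h1, logMap_unit_smul u h0]

theorem tsum_ideal (a : (Ideal (𝓞 K))⁰) (s : ℝ) (hs : 1 < s) : 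
    ∑' b : (a : Ideal (𝓞 K)), g s (b : 𝓞 K) = torsionOrder K * (Ideal.absNorm (a : Ideal (𝓞 K)) : ℝ) ^ (-s) * zc (ClassGroup.mk0 a)⁻¹ s := by
  have hsg := summable_g (K := K) s hs
  have h0 : ∑' b : (a : Ideal (𝓞 K)), g s (b : 𝓞 K) = ∑' x : 𝓞 K, ((a : Ideal (𝓞 K)) : Set (𝓞 K)).indicator (g s) x := 
    tsum_subtype ((a : Ideal (𝓞 K)) : Set (𝓞 K)) (g s)
  have h1 : ∑' p : ClsI a × (𝓞 K)ˣ, ((a : Ideal (𝓞 K)) : Set (𝓞 K)).indicator (g s) (genMap a p) = ∑' x : 𝓞 K, ((a : Ideal (𝓞 K)) : Set (𝓞 K)).indicator (g s) x := by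
    refine (genMap_inj a).tsum_eq ?_
    intro x hx
    rw [Function.mem_support, Set.indicator_apply_ne_zero] at hx
    refine genMap_surj a x hx.1 ?_
    rintro rfl
    apply hx.2
    have : emb (0 : 𝓞 K) = 0 := emb_eq_zero.2 rfl
    rw [g, this, FF, map_zero, Real.zero_rpow (by linarith), mul_zero]
  have h2 : ∀ p : ClsI a × (𝓞 K)ˣ, ((a : Ideal (𝓞 K)) : Set (𝓞 K)).indicator (g s) (genMap a p) = g s ((p.2 : 𝓞 K) * gen a p.1) := 
    fun p => Set.indicator_of_mem (genMap_mem a p) _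
  have hs2 : Summable (fun p : ClsI a × (𝓞 K)ˣ => g s ((p.2 : 𝓞 K) * gen a p.1)) := 
    summable_pull hsg (genMap a) (genMap_inj a) _ (fun p => rfl)
  have hu : ∀ I : ClsI a, 
      HasSum (fun u : (𝓞 K)ˣ => g s ((u : 𝓞 K) * gen a I)) (torsionOrder K * (Ideal.absNorm (a : Ideal (𝓞 K)) : ℝ) ^ (-s) * (Ideal.absNorm (I.1 : Ideal (𝓞 K)) : ℝ) ^ (-s)) := by
    intro I
    have h1 := (Phi_hasSum (logMap (emb (gen a I)))).mul_right ((Ideal.absNorm (Ideal.span {gen a I}) : ℝ) ^ (-s))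
    have h2 : (fun u : (𝓞 K)ˣ => g s ((u : 𝓞 K) * gen a I)) = fun u => Phi (logEmbedding K (Additive.ofMul u) + logMap (emb (gen a I))) * (Ideal.absNorm (Ideal.span {gen a I}) : ℝ) ^ (-s) :=
      funext fun u => g_unit_mul s u (gen_ne a I)
    rw [h2]
    rw [mul_assoc, ← Real.mul_rpow (by positivity) (by positivity), ← Nat.cast_mul, ← map_mul, gen_spec]
    exact h1
  rw [h0, ← h1, tsum_congr h2, hs2.tsum_prod' (fun I => (hu I).summable), zc, ← tsum_mul_left]
  exact tsum_congr fun I => (hu I).tsum_eq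

end Sums
end ModB3
end OmegaSq


namespace OmegaSq
section ModB4
open NumberField IsDedekindDomain Filter Topology
open scoped nonZeroDivisors
section Bound
open scoped Classical
variable {K : Type*} [Field K] [NumberField K]

theorem summable_cls (s : ℝ) (hs : 1 < s) (c : ClassGroup (𝓞 K)) :
    Summable (fun I : {I : (Ideal (𝓞 K))⁰ // ClassGroup.mk0 I = c} => (Ideal.absNorm (I.1 : Ideal (𝓞 K)) : ℝ) ^ (-s)) := by
  have hi : Function.Injective (fun I : {I : (Ideal (𝓞 K))⁰ // ClassGroup.mk0 I = c} => (I.1 : Ideal (𝓞 K))) := by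
    intro I J h
    exact Subtype.ext (Subtype.ext h)
  have h := (zeta_hasSum K s hs).1.comp_injective hi
  exact h

theorem zc_nonneg (c : ClassGroup (𝓞 K)) (s : ℝ) : 0 ≤ zc c s := tsum_nonneg fun _ => by positivity

theorem zc_le (c : ClassGroup (𝓞 K)) (s : ℝ) (hs : 1 < s) : zc c s ≤ ∑' I : Ideal (𝓞 K), (Ideal.absNorm I : ℝ) ^ (-s) := by
  rw [zc]
  exact (summable_cls s hs c).tsum_le_tsum_of_inj (fun I => (I.1 : Ideal (𝓞 K))) 
    (fun I J h => Subtype.ext (Subtype.ext h)) (fun _ _ => by positivity) (fun _ => le_rfl) (zeta_hasSum K s hs).1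

theorem zc_diff (c : ClassGroup (𝓞 K)) : ∃ C δ : ℝ, 0 < δ ∧ δ ≤ 1 ∧ ∀ s, 1 < s → s < 1 + δ → |zc (1 : ClassGroup (𝓞 K)) s - zc c s| ≤ C := by
  obtain ⟨a, ha⟩ := ClassGroup.mk0_surjective c⁻¹
  obtain ⟨C, hC⟩ := coset_est (a : Ideal (𝓞 K)) (ideal_ne a)
  obtain ⟨c₁, c₂, δ, h1, h2, hδ, hδ1, hz⟩ := zeta_bounds K
  set w : ℝ := ((NumberField.Units.torsionOrder K : ℕ) : ℝ) with hw
  have hw1 : (1:ℝ) ≤ w := by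
    rw [hw]; exact_mod_cast (NumberField.Units.torsionOrder_pos K)
  set N : ℝ := ((Ideal.absNorm (a : Ideal (𝓞 K)) : ℕ) : ℝ) with hN
  have hN1 : 1 ≤ N := by
    rw [hN]
    have : Ideal.absNorm (a : Ideal (𝓞 K)) ≠ 0 := by
      rw [Ne, Ideal.absNorm_eq_zero_iff]; exact ideal_ne a
    exact_mod_cast Nat.one_le_iff_ne_zero.2 this
  have hN0 : 0 < N := by linarith
  refine ⟨C + Real.log N * c₂, δ, hδ, hδ1, fun s hs hsd => ?_⟩
  have e := hC s hs (by linarith)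
  rw [tsum_ideal a s hs, ha, inv_inv] at e
  have e1 : ∑' x : 𝓞 K, g s x = w * zc (1 : ClassGroup (𝓞 K)) s := by
    have := tsum_ideal (1 : (Ideal (𝓞 K))⁰) s hs
    rw [map_one, inv_one] at this
    simp only [OneMemClass.coe_one, map_one, Nat.cast_one, Real.one_rpow, mul_one] at this
    rw [← this, Ideal.one_eq_top]
    symm
    exact tsum_univ (g s)
  rw [e1] at e
  have e2 : N * (w * N ^ (-s) * zc c s) = w * (N ^ (1 - s) * zc c s) := by
    rw [sub_eq_add_neg, Real.rpow_add hN0, Real.rpow_one]; ring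
  rw [← hN, ← hw, e2, ← mul_sub, abs_mul, abs_of_pos (by linarith)] at e
  have e3 : |zc (1 : ClassGroup (𝓞 K)) s - N ^ (1 - s) * zc c s| ≤ C := by
    refine le_trans ?_ e
    nlinarith [abs_nonneg (zc (1 : ClassGroup (𝓞 K)) s - N ^ (1 - s) * zc c s)]
  have e4 : |N ^ (1 - s) * zc c s - zc c s| ≤ Real.log N * c₂ := by
    have z0 := zc_nonneg c s
    have z1 := (zc_le c s hs).trans (hz s hs hsd).2
    have l0 := Real.log_nonneg hN1
    have u1 : N ^ (1 - s) ≤ 1 := Real.rpow_le_one_of_one_le_of_nonpos hN1 (by linarith)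
    have u2 : 1 - (s - 1) * Real.log N ≤ N ^ (1 - s) := by
      rw [Real.rpow_def_of_pos hN0]
      have := Real.add_one_le_exp (Real.log N * (1 - s))
      linarith
    rw [show N ^ (1 - s) * zc c s - zc c s = - ((1 - N ^ (1 - s)) * zc c s) by ring, abs_neg, abs_of_nonneg (mul_nonneg (by linarith) z0)]
    calc _ ≤ ((s - 1) * Real.log N) * (c₂ / (s - 1)) := by
          apply mul_le_mul (by linarith) z1 z0
          exact mul_nonneg (by linarith) l0
      _ = _ := by
        have : s - 1 ≠ 0 := by linarith
        field_simp
  calc _ = |(zc (1 : ClassGroup (𝓞 K)) s - N ^ (1 - s) * zc c s) + (N ^ (1 - s) * zc c s - zc c s)| := by ring_nf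
    _ ≤ _ := abs_add_le _ _
    _ ≤ _ := add_le_add e3 e4

theorem L_eq (χ : ClassGroup (𝓞 K) →* ℂˣ) (s : ℝ) (hs : 1 < s) :
    ∑' I, Lf χ s I = ∑ c : ClassGroup (𝓞 K), (χ c : ℂ) * (zc c s : ℂ) := by
  have hsum : Summable (fun I : Ideal (𝓞 K) => Lf χ s I) := by
    apply Summable.of_norm
    simpa only [norm_Lf χ s hs] using (zeta_hasSum K s hs).1
  have h1 : ∑' I : (Ideal (𝓞 K))⁰, Lf χ s (I : Ideal (𝓞 K)) = ∑' I, Lf χ s I := by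
    refine Function.Injective.tsum_eq (g := fun I : (Ideal (𝓞 K))⁰ => (I : Ideal (𝓞 K))) Subtype.val_injective ?_
    intro I hI
    refine ⟨⟨I, mem_nonZeroDivisors_of_ne_zero ?_⟩, rfl⟩
    rintro rfl
    exact hI (map_zero _)
  have hsum' : Summable (fun I : (Ideal (𝓞 K))⁰ => Lf χ s (I : Ideal (𝓞 K))) := hsum.comp_injective Subtype.val_injective
  rw [← h1, ← (Equiv.sigmaFiberEquiv (fun I : (Ideal (𝓞 K))⁰ => ClassGroup.mk0 I)).tsum_eq]
  have hs3 := ((Equiv.sigmaFiberEquiv (fun I : (Ideal (𝓞 K))⁰ => ClassGroup.mk0 I)).summable_iff).2 hsum'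
  have h3 := hs3.tsum_sigma
  refine h3.trans ?_
  rw [tsum_fintype]
  refine Finset.sum_congr rfl fun c _ => ?_
  rw [zc, Complex.ofReal_tsum, ← tsum_mul_left]
  refine tsum_congr fun I => ?_
  have := Lf_apply χ s I.1
  rw [I.2] at this
  exact this

/-- Boundedness of the L-function of a nontrivial class group character near `1`. -/
theorem L_bounded (χ : ClassGroup (𝓞 K) →* ℂˣ) (hχ : χ ≠ 1) : ∃ C δ : ℝ, 0 < δ ∧ δ ≤ 1 ∧ ∀ s, 1 < s → s < 1 + δ → 
    ‖∑' I, Lf χ s I‖ ≤ C := by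
  choose C δ hδ hδ1 h using fun c : ClassGroup (𝓞 K) => zc_diff c
  have hne : (Finset.univ : Finset (ClassGroup (𝓞 K))).Nonempty := Finset.univ_nonempty
  refine ⟨∑ c, C c, Finset.univ.inf' hne δ, ?_, ?_, fun s hs hsd => ?_⟩
  · rw [Finset.lt_inf'_iff]; exact fun c _ => hδ c
  · exact (Finset.inf'_le _ (Finset.mem_univ 1)).trans (hδ1 1)
  have hsum : ∑ c : ClassGroup (𝓞 K), (χ c : ℂ) = 0 := by
    obtain ⟨c0, hc0⟩ : ∃ c0, χ c0 ≠ 1 := by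
      by_contra hc
      push Not at hc
      exact hχ (MonoidHom.ext hc)
    have e : (χ c0 : ℂ) * ∑ c : ClassGroup (𝓞 K), (χ c : ℂ) = ∑ c : ClassGroup (𝓞 K), (χ c : ℂ) := by
      rw [Finset.mul_sum]
      refine Fintype.sum_equiv (Equiv.mulLeft c0) _ _ fun c => ?_
      simp
    by_contra hne
    apply hc0
    have := mul_right_cancel₀ hne (e.trans (one_mul _).symm)
    exact Units.ext this
  have e : ∑' I, Lf χ s I = - ∑ c : ClassGroup (𝓞 K), (χ c : ℂ) * ((zc (1 : ClassGroup (𝓞 K)) s - zc c s : ℝ) : ℂ) := by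
    rw [L_eq χ s hs]
    push_cast
    simp only [mul_sub, Finset.sum_sub_distrib, ← Finset.sum_mul, hsum]
    ring
  rw [e, norm_neg]
  refine (norm_sum_le _ _).trans (Finset.sum_le_sum fun c _ => ?_)
  rw [norm_mul, norm_chi, one_mul, Complex.norm_real]
  refine h c s hs (hsd.trans_le ?_)
  have := Finset.inf'_le δ (Finset.mem_univ c)
  linarith
end Bound
end ModB4
end OmegaSq


namespace OmegaSq
section ModC
open NumberField Polynomial
section EtaSec

/-- exponent `≡ u⁻²` -/
def nn {r : ℕ} (u : (ZMod r)ˣ) : ℕ := ((((u⁻¹ : (ZMod r)ˣ) : ZMod r)) ^ 2).val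

theorem nn_cast {r : ℕ} [NeZero r] (u : (ZMod r)ˣ) : ((nn u : ℕ) : ZMod r) = ((u⁻¹ : (ZMod r)ˣ) : ZMod r) ^ 2 := by
  rw [nn, ZMod.natCast_zmod_val]

theorem nn_sum {r : ℕ} [Fact r.Prime] (hr : 5 ≤ r) : ((∑ u : (ZMod r)ˣ, nn u : ℕ) : ZMod r) = 0 := by
  push_cast
  simp only [nn_cast]
  rw [Fintype.sum_equiv (Equiv.inv (ZMod r)ˣ) (fun u => ((u⁻¹ : (ZMod r)ˣ) : ZMod r) ^ 2) (fun u => ((u : (ZMod r)ˣ) : ZMod r) ^ 2) (fun u => rfl)]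
  have := FiniteField.sum_pow_units (ZMod r) 2
  simp only [ZMod.card] at this
  push_cast at this
  rw [this, if_neg]
  intro h
  have := Nat.le_of_dvd (by norm_num) h
  omega

/-- logarithmic derivative data at `1` -/
def LD {F : Type*} [Field F] (p : F[X]) (a b : F) : Prop :=
  p.eval 1 ≠ 0 ∧ (derivative p).eval 1 = a * p.eval 1 ∧ (derivative (derivative p)).eval 1 = (b + a ^ 2) * p.eval 1

theorem LD.mul {F : Type*} [Field F] {p q : F[X]} {a b c d : F} (hp : LD p a b) (hq : LD q c d) : LD (p * q) (a + c) (b + d) := by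
  obtain ⟨h1, h2, h3⟩ := hp
  obtain ⟨k1, k2, k3⟩ := hq
  refine ⟨by rw [eval_mul]; exact mul_ne_zero h1 k1, ?_, ?_⟩
  · simp only [derivative_mul, eval_mul, eval_add, h2, k2]; ring
  · simp only [derivative_mul, derivative_add, eval_mul, eval_add, h2, k2, h3, k3]; ring

theorem LD.one {F : Type*} [Field F] : LD (1 : F[X]) 0 0 := by
  refine ⟨by simp, by simp, by simp⟩

theorem LD.pow {F : Type*} [Field F] {p : F[X]} {a b : F} (hp : LD p a b) (n : ℕ) : LD (p ^ n) (n * a) (n * b) := by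
  induction n with
  | zero => simpa using LD.one
  | succ n ih =>
    rw [pow_succ]
    convert ih.mul hp using 1 <;> push_cast <;> ring

theorem LD.prod {F ι : Type*} [Field F] (s : Finset ι) {p : ι → F[X]} {a b : ι → F} (hp : ∀ i ∈ s, LD (p i) (a i) (b i)) :
    LD (∏ i ∈ s, p i) (∑ i ∈ s, a i) (∑ i ∈ s, b i) := by
  classical
  induction s using Finset.induction_on with
  | empty => simpa using LD.one
  | insert i s hi ih =>
    rw [Finset.prod_insert hi, Finset.sum_insert hi, Finset.sum_insert hi]
    exact (hp i (Finset.mem_insert_self _ _)).mul (ih fun j hj => hp j (Finset.mem_insert_of_mem hj))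

/-- `1 + X + … + X^{t-1}` -/
noncomputable def UU (R : Type*) [CommRing R] (t : ℕ) : R[X] := ∑ i ∈ Finset.range t, X ^ i

theorem UU_succ (R : Type*) [CommRing R] (t : ℕ) : UU R (t + 1) = UU R t + X ^ t := Finset.sum_range_succ _ _

theorem UU_vals (R : Type*) [CommRing R] (t : ℕ) : (UU R t).eval 1 = t ∧ 2 * (derivative (UU R t)).eval 1 = t * (t - 1) ∧
    3 * (derivative (derivative (UU R t))).eval 1 = t * (t - 1) * (t - 2) := by
  induction t with
  | zero => simp [UU]
  | succ t ih =>
    obtain ⟨h1, h2, h3⟩ := ih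
    rw [UU_succ]
    refine ⟨by simp [h1], ?_, ?_⟩
    · simp only [derivative_add, eval_add, mul_add, h2, derivative_X_pow]
      simp; ring
    · simp only [derivative_add, eval_add, mul_add, h3, derivative_X_pow]
      cases t with
      | zero => simp
      | succ t => simp [derivative_X_pow]; ring

theorem UU_LD {r : ℕ} [Fact r.Prime] (hr : 5 ≤ r) (t : ℕ) (ht : (t : ZMod r) ≠ 0) :
    LD (UU (ZMod r) t) ((t - 1) / 2) ((t - 1) * (t - 5) / 12) := by
  obtain ⟨h1, h2, h3⟩ := UU_vals (ZMod r) t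
  have n2 : (2 : ZMod r) ≠ 0 := by
    have := (ZMod.natCast_eq_zero_iff 2 r).not.2 (fun h => by have := Nat.le_of_dvd (by norm_num) h; omega)
    simpa using this
  have n3 : (3 : ZMod r) ≠ 0 := by
    have := (ZMod.natCast_eq_zero_iff 3 r).not.2 (fun h => by have := Nat.le_of_dvd (by norm_num) h; omega)
    simpa using this
  have e12 : (12 : ZMod r) = 2 * 2 * 3 := by norm_num
  refine ⟨by rwa [h1], ?_, ?_⟩
  · apply mul_left_cancel₀ n2
    rw [h2, h1]; field_simp
  · apply mul_left_cancel₀ n3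
    rw [h3, h1, e12]; field_simp; ring

theorem poly_key {r : ℕ} [hp : Fact r.Prime] (hr : 5 ≤ r) (a : ZMod r) (q : (ZMod r)[X])
    (h : ∏ u : (ZMod r)ˣ, UU (ZMod r) (u : ZMod r).val ^ nn u = C a + (X - 1) ^ 3 * q) : False := by
  have hL := LD.prod Finset.univ (fun (u : (ZMod r)ˣ) _ => (UU_LD hr (u : ZMod r).val (by simp)).pow (nn u))
  rw [h] at hL
  obtain ⟨h1, h2, h3⟩ := hL
  have d1 : (derivative (C a + (X - 1) ^ 3 * q : (ZMod r)[X])).eval 1 = 0 := by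
    simp [derivative_mul, derivative_pow]
  have d2 : (derivative (derivative (C a + (X - 1) ^ 3 * q : (ZMod r)[X]))).eval 1 = 0 := by
    simp [derivative_mul, derivative_pow]
  rw [d1, eq_comm, mul_eq_zero, or_iff_left h1] at h2
  rw [d2, eq_comm, mul_eq_zero, or_iff_left h1, h2] at h3
  have n2 : (2 : ZMod r) ≠ 0 := by
    have := (ZMod.natCast_eq_zero_iff 2 r).not.2 (fun h => by have := Nat.le_of_dvd (by norm_num) h; omega)
    simpa using this
  have n3 : (3 : ZMod r) ≠ 0 := by
    have := (ZMod.natCast_eq_zero_iff 3 r).not.2 (fun h => by have := Nat.le_of_dvd (by norm_num) h; omega)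
    simpa using this
  have e12 : (12 : ZMod r) = 2 * 2 * 3 := by norm_num
  have n12 : (12 : ZMod r) ≠ 0 := by rw [e12]; exact mul_ne_zero (mul_ne_zero n2 n2) n3
  have key : ∑ u : (ZMod r)ˣ, ((nn u : ZMod r) * ((((u : ZMod r).val : ZMod r) - 1) / 2) + (nn u : ZMod r) * ((((u : ZMod r).val : ZMod r) - 1) * (((u : ZMod r).val : ZMod r) - 5) / 12))
      = 1 / 12 * (∑ u : (ZMod r)ˣ, (1 : ZMod r)) - 1 / 12 * ((∑ u : (ZMod r)ˣ, nn u : ℕ) : ZMod r) := by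
    push_cast
    rw [← mul_sub, ← Finset.sum_sub_distrib, Finset.mul_sum]
    refine Finset.sum_congr rfl fun u _ => ?_
    rw [nn_cast]
    have hu : ((u⁻¹ : (ZMod r)ˣ) : ZMod r) * u = 1 := Units.inv_mul u
    simp only [ZMod.natCast_zmod_val]
    generalize ((u⁻¹ : (ZMod r)ˣ) : ZMod r) = v at hu ⊢
    have : (1 : ZMod r) = v ^ 2 * (u : ZMod r) ^ 2 := by rw [← mul_pow, hu, one_pow]
    conv_rhs => enter [2, 1]; rw [this]
    rw [e12]; field_simp; ring
  rw [Finset.sum_add_distrib, h2, nn_sum hr] at key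
  simp only [zero_pow two_ne_zero, add_zero] at h3
  rw [h3] at key
  simp only [Finset.sum_const, Finset.card_univ, ZMod.card_units_eq_totient, Nat.totient_prime hp.out, nsmul_eq_mul, mul_one, mul_zero, sub_zero, zero_add] at key
  rw [Nat.cast_sub hp.out.one_le] at key
  simp at key
  exact n12 key

theorem cyclo_mod {r : ℕ} [hp : Fact r.Prime] : cyclotomic r (ZMod r) = (X - 1) ^ (r - 1) := by
  have h := cyclotomic_prime_mul_X_sub_one (ZMod r) r
  have h2 : (X ^ r - 1 : (ZMod r)[X]) = (X - 1) ^ r := by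
    rw [sub_pow_char, one_pow]
  rw [h2] at h
  have h3 : (X - 1 : (ZMod r)[X]) ^ r = (X - 1) ^ (r - 1) * (X - 1) := by
    rw [← pow_succ, Nat.sub_add_cancel hp.out.one_le]
  rw [h3] at h
  exact mul_right_cancel₀ (X_sub_C_ne_zero (1 : ZMod r)) h

/-- the cyclotomic number `η` -/
noncomputable def eta {R : Type*} [CommRing R] (r : ℕ) [NeZero r] (ζ : R) : R := ∏ u : (ZMod r)ˣ, (1 - ζ ^ (u : ZMod r).val) ^ nn u

theorem eta_not_pow {K : Type*} [Field K] [NumberField K] {r : ℕ} [hp : Fact r.Prime] [IsCyclotomicExtension {r} ℚ K] (hr : 5 ≤ r)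
    (ζ : K) (hζ : IsPrimitiveRoot ζ r) (x : K) (hx : x ^ r = eta r ζ) : False := by
  obtain ⟨m, hm⟩ := (ZMod.natCast_eq_zero_iff _ _).1 (nn_sum (r := r) hr)
  have hz1 : (1 - ζ) ≠ 0 := sub_ne_zero.2 (hζ.ne_one hp.out.one_lt).symm
  set p : ℤ[X] := ∏ u : (ZMod r)ˣ, UU ℤ (u : ZMod r).val ^ nn u with hpdef
  have h1 : eta r ζ = ((1 - ζ) ^ m) ^ r * aeval ζ p := by
    rw [eta, hpdef, map_prod, ← pow_mul, mul_comm m r, ← hm, ← Finset.prod_pow_eq_pow_sum, ← Finset.prod_mul_distrib]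
    refine Finset.prod_congr rfl fun u _ => ?_
    rw [map_pow, ← mul_pow, UU, map_sum]
    simp only [map_pow, aeval_X]
    rw [mul_neg_geom_sum]
  set y : K := x / (1 - ζ) ^ m with hy
  have h2 : y ^ r = aeval ζ p := by
    rw [hy, div_pow, hx, h1, mul_div_cancel_left₀]
    exact pow_ne_zero _ (pow_ne_zero _ hz1)
  have hint : IsIntegral ℤ ζ := hζ.isIntegral hp.out.pos
  have hyi : IsIntegral ℤ y := by
    apply IsIntegral.of_pow hp.out.pos
    rw [h2]
    exact IsIntegral.of_mem_of_fg (Algebra.adjoin ℤ {ζ}) hint.fg_adjoin_singleton _ (aeval_mem_adjoin_singleton ℤ ζ)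
  have hya : y ∈ Algebra.adjoin ℤ ({ζ} : Set K) := by
    have := (IsCyclotomicExtension.Rat.isIntegralClosure_adjoin_singleton_of_prime hζ)
    obtain ⟨z, hz⟩ := this.isIntegral_iff.1 hyi
    rw [← hz]; exact z.2
  rw [Algebra.adjoin_singleton_eq_range_aeval] at hya
  obtain ⟨q, hq⟩ := hya
  have h3 : aeval ζ (p - q ^ r) = 0 := by
    rw [map_sub, map_pow, ← h2, ← hq]; exact sub_self _
  have h4 := minpoly.isIntegrallyClosed_dvd hint h3
  rw [← cyclotomic_eq_minpoly hζ hp.out.pos] at h4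
  obtain ⟨d, hd⟩ := h4
  have h5 := congrArg (Polynomial.map (Int.castRingHom (ZMod r))) hd
  rw [Polynomial.map_sub, Polynomial.map_mul, Polynomial.map_pow, map_cyclotomic, cyclo_mod] at h5
  have h6 : p.map (Int.castRingHom (ZMod r)) = ∏ u : (ZMod r)ˣ, UU (ZMod r) (u : ZMod r).val ^ nn u := by
    rw [hpdef, Polynomial.map_prod]
    refine Finset.prod_congr rfl fun u _ => ?_
    rw [Polynomial.map_pow, UU, UU, Polynomial.map_sum]
    simp
  rw [h6, ← ZMod.expand_card] at h5
  set Q := q.map (Int.castRingHom (ZMod r))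
  have h7 : (X - 1 : (ZMod r)[X]) ^ 3 ∣ expand (ZMod r) r Q - C (Q.eval 1) := by
    have : (X - C 1 : (ZMod r)[X]) ∣ Q - C (Q.eval 1) := by
      rw [dvd_iff_isRoot]; simp
    obtain ⟨w, hw⟩ := this
    have e := congrArg (expand (ZMod r) r) hw
    rw [map_sub, map_mul, map_sub, expand_C, expand_C, expand_X, C_1] at e
    have h2 : (X ^ r - 1 : (ZMod r)[X]) = (X - 1) ^ r := by
      rw [sub_pow_char, one_pow]
    rw [e, h2]
    exact Dvd.dvd.mul_right (pow_dvd_pow _ (by omega)) _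
  obtain ⟨w, hw⟩ := h7
  obtain ⟨v, hv⟩ := pow_dvd_pow (X - 1 : (ZMod r)[X]) (show 3 ≤ r - 1 by omega)
  rw [hv] at h5
  refine poly_key hr (Q.eval 1) (w + v * d.map (Int.castRingHom (ZMod r))) ?_
  linear_combination h5 + hw
end EtaSec
end ModC
end OmegaSq


namespace OmegaSq
section ModD
open NumberField IsDedekindDomain Filter Topology
open scoped nonZeroDivisors
section Kummer
open scoped Pointwise

theorem r_mem_of {R : Type*} [CommRing R] [IsDomain R] {r : ℕ} (I : Ideal R) (ξ : R) (h : ξ ^ r = 1) (hne : ξ ≠ 1) (hm : ξ - 1 ∈ I) :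
    (r : R) ∈ I := by
  have h0 : ∑ i ∈ Finset.range r, ξ ^ i = 0 := by
    have := mul_geom_sum ξ r
    rw [h, sub_self, mul_eq_zero] at this
    exact this.resolve_left (sub_ne_zero.2 hne)
  have h1 : (r : R) = - ∑ i ∈ Finset.range r, (ξ ^ i - 1) := by
    rw [Finset.sum_sub_distrib, h0]; simp
  rw [h1]
  refine I.neg_mem (I.sum_mem fun i _ => ?_)
  have := sub_dvd_pow_sub_pow ξ 1 i
  rw [one_pow] at this
  exact I.mem_of_dvd this hm

variable {K M : Type*} [Field K] [Field M] [NumberField K] [NumberField M] [Algebra K M] 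

theorem split_prime [IsGalois K M] {r : ℕ} (hr : r.Prime) (ζ : 𝓞 K) (hζ : IsPrimitiveRoot ζ r) (η : 𝓞 K) (α : 𝓞 M)
    (hα : α ^ r = algebraMap (𝓞 K) (𝓞 M) η) (hgen : ∀ σ : Gal(M/K), σ • α = α → σ = 1) (P : HeightOneSpectrum (𝓞 K))
    (hη : η ∉ P.asIdeal) (hrP : (r : 𝓞 K) ∉ P.asIdeal) (y : 𝓞 K) (hy : η - y ^ r ∈ P.asIdeal) :
    ∃ Q : HeightOneSpectrum (𝓞 M), Q.asIdeal.LiesOver P.asIdeal ∧ Ideal.absNorm Q.asIdeal = Ideal.absNorm P.asIdeal ∧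
      ∀ σ : Gal(M/K), σ • Q.asIdeal = Q.asIdeal → σ = 1 := by
  have hnz : NeZero r := ⟨hr.ne_zero⟩
  have hPm : P.asIdeal.IsMaximal := P.isMaximal
  obtain ⟨Q, hQp, hQo⟩ := (inferInstance : Nonempty (P.asIdeal.primesOver (𝓞 M)))
  have hQb : Q ≠ ⊥ := Ideal.ne_bot_of_liesOver_of_ne_bot P.ne_bot Q
  have hmem : ∀ x : 𝓞 K, algebraMap (𝓞 K) (𝓞 M) x ∈ Q ↔ x ∈ P.asIdeal := fun x => (Ideal.mem_of_liesOver Q P.asIdeal x).symm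
  have hζM : IsPrimitiveRoot (algebraMap (𝓞 K) (𝓞 M) ζ) r := hζ.map_of_injective (FaithfulSMul.algebraMap_injective (𝓞 K) (𝓞 M))
  have hfix : ∀ (σ : Gal(M/K)) (x : 𝓞 K), σ • algebraMap (𝓞 K) (𝓞 M) x = algebraMap (𝓞 K) (𝓞 M) x := fun σ x => smul_algebraMap σ x
  have hαQ : α ∉ Q := by
    intro h
    apply hη
    rw [← hmem, ← hα]
    exact Q.pow_mem_of_mem h _ hr.pos
  have hst : ∀ σ : Gal(M/K), σ • Q = Q → σ = 1 := by
    intro σ hσ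
    apply hgen
    -- α ≡ w mod Q with w from K
    have h1 : α ^ r - (algebraMap (𝓞 K) (𝓞 M) y) ^ r ∈ Q := by
      rw [hα, ← map_pow, ← map_sub, hmem]; exact hy
    rw [hζM.pow_sub_pow_eq_prod_sub_mul _ _ hr.pos] at h1
    obtain ⟨ξ, hξ, h2⟩ := (hQp.prod_mem_iff).1 h1
    obtain ⟨i, -, hi⟩ := hζM.eq_pow_of_pow_eq_one ((Polynomial.mem_nthRootsFinset hr.pos _).1 hξ)
    have h3 : σ • (α - ξ * algebraMap (𝓞 K) (𝓞 M) y) ∈ Q := by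
      have h2b : σ • (α - ξ * algebraMap (𝓞 K) (𝓞 M) y) ∈ σ • Q := Ideal.smul_mem_pointwise_smul_iff.2 h2
      rwa [hσ] at h2b
    have h4 : σ • (α - ξ * algebraMap (𝓞 K) (𝓞 M) y) = σ • α - ξ * algebraMap (𝓞 K) (𝓞 M) y := by
      rw [smul_sub, ← hi, ← map_pow, ← map_mul, hfix]
    rw [h4] at h3
    have h5 : σ • α - α ∈ Q := by
      have := Q.sub_mem h3 h2
      rwa [sub_sub_sub_cancel_right] at this
    have hα0 : α ≠ 0 := fun h => hαQ (h ▸ Q.zero_mem)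
    have h6 : (σ • α) ^ r - α ^ r = 0 := by
      rw [← smul_pow', hα, hfix, sub_self]
    rw [hζM.pow_sub_pow_eq_prod_sub_mul _ _ hr.pos, Finset.prod_eq_zero_iff] at h6
    obtain ⟨ρ, hρ, h7⟩ := h6
    rw [sub_eq_zero] at h7
    by_cases hρ1 : ρ = 1
    · rw [h7, hρ1, one_mul]
    · exfalso
      have h8 : (ρ - 1) * α ∈ Q := by
        rwa [h7, ← sub_one_mul] at h5
      have h9 := (hQp.mem_or_mem h8).resolve_right hαQ
      have := r_mem_of Q ρ ((Polynomial.mem_nthRootsFinset hr.pos _).1 hρ) hρ1 h9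
      apply hrP
      rw [← hmem]; simpa using this
  refine ⟨⟨Q, hQp, hQb⟩, hQo, ?_, hst⟩
  have hQm : Q.IsMaximal := hQp.isMaximal hQb
  have hc := Ideal.card_stabilizer_eq (G := Gal(M/K)) P.asIdeal Q
  have hc1 : Nat.card (MulAction.stabilizer Gal(M/K) Q) = 1 := by
    rw [Nat.card_eq_one_iff_unique]
    refine ⟨⟨fun a b => ?_⟩, ⟨1⟩⟩
    apply Subtype.ext
    rw [hst a.1 a.2, hst b.1 b.2]
  rw [hc1] at hc
  have hf := Nat.eq_one_of_mul_eq_one_left hc.symm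
  rw [Ideal.inertiaDegIn_eq_inertiaDeg P.asIdeal Q Gal(M/K)] at hf
  have := Ideal.absNorm_eq_pow_inertiaDeg'_of_liesOver Q P.asIdeal P.isPrime P.ne_bot
  rw [Ideal.inertiaDeg'_eq_inertiaDeg, hf, pow_one] at this
  exact this

theorem kummer_sum [IsGalois K M] {r : ℕ} (hr : r.Prime) (ζ : 𝓞 K) (hζ : IsPrimitiveRoot ζ r) (η : 𝓞 K) (α : 𝓞 M)
    (hα : α ^ r = algebraMap (𝓞 K) (𝓞 M) η) (hgen : ∀ σ : Gal(M/K), σ • α = α → σ = 1) (hcard : Nat.card Gal(M/K) = r)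
    (s : ℝ) (hs : 1 < s) (T : Set (HeightOneSpectrum (𝓞 K)))
    (hT : ∀ P ∈ T, η ∉ P.asIdeal ∧ (r : 𝓞 K) ∉ P.asIdeal ∧ ∃ y, η - y ^ r ∈ P.asIdeal) :
    r * ∑' P, T.indicator (fun P : HeightOneSpectrum (𝓞 K) => (Ideal.absNorm P.asIdeal : ℝ) ^ (-s)) P ≤
      ∑' Q : HeightOneSpectrum (𝓞 M), (Ideal.absNorm Q.asIdeal : ℝ) ^ (-s) := by
  have hex : ∀ P : T, ∃ Q : HeightOneSpectrum (𝓞 M), Q.asIdeal.LiesOver P.1.asIdeal ∧ Ideal.absNorm Q.asIdeal = Ideal.absNorm P.1.asIdeal ∧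
      ∀ σ : Gal(M/K), σ • Q.asIdeal = Q.asIdeal → σ = 1 := by
    intro P
    obtain ⟨h1, h2, y, hy⟩ := hT P.1 P.2
    exact split_prime hr ζ hζ η α hα hgen P.1 h1 h2 y hy
  choose Q hQ1 hQ2 hQ3 using hex
  have hne : ∀ (σ : Gal(M/K)) (P : T), σ • (Q P).asIdeal ≠ ⊥ := by
    intro σ P h
    apply (Q P).ne_bot
    rw [eq_bot_iff]
    intro x hx
    have : σ • x ∈ σ • (Q P).asIdeal := Ideal.smul_mem_pointwise_smul_iff.2 hx
    rw [h, Ideal.mem_bot] at this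
    have := (smul_eq_zero_iff_eq σ).1 this
    rw [this]; exact zero_mem _
  have hpr : ∀ (σ : Gal(M/K)) (P : T), (σ • (Q P).asIdeal).IsPrime := fun σ P => by
    have := (Q P).isPrime
    infer_instance
  have hpr2 : ∀ (σ : Gal(M/K)) (P : T), (σ • (Q P).asIdeal).LiesOver P.1.asIdeal := fun σ P => by
    have := hQ1 P
    infer_instance
  have hN : ∀ (σ : Gal(M/K)) (P : T), Ideal.absNorm (σ • (Q P).asIdeal) = Ideal.absNorm P.1.asIdeal := by
    intro σ P
    rw [← Ideal.absNorm_relNorm (𝓞 K), Ideal.relNorm_smul, Ideal.absNorm_relNorm, hQ2]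
  set F : T × Gal(M/K) → HeightOneSpectrum (𝓞 M) := fun x => ⟨x.2 • (Q x.1).asIdeal, hpr x.2 x.1, hne x.2 x.1⟩ with hF
  have hinj : Function.Injective F := by
    rintro ⟨P, σ⟩ ⟨P', σ'⟩ h
    have h1 : σ • (Q P).asIdeal = σ' • (Q P').asIdeal := congrArg HeightOneSpectrum.asIdeal h
    have hP : P = P' := by
      apply Subtype.ext
      apply HeightOneSpectrum.ext
      have e1 := (hpr2 σ P).over
      have e2 := (hpr2 σ' P').over
      rw [e1, e2, h1]
    subst hP
    have : (σ'⁻¹ * σ) = 1 := by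
      apply hQ3 P
      rw [mul_smul, h1, inv_smul_smul]
    rw [inv_mul_eq_one] at this
    rw [this]
  have hS := summable_primes (K := M) s hs
  have hS2 := hS.comp_injective hinj
  have hfin : Finite Gal(M/K) := inferInstance
  have := Fintype.ofFinite Gal(M/K)
  have e1 : ∑' x : T × Gal(M/K), (Ideal.absNorm (F x).asIdeal : ℝ) ^ (-s) = r * ∑' P, T.indicator (fun P : HeightOneSpectrum (𝓞 K) => (Ideal.absNorm P.asIdeal : ℝ) ^ (-s)) P := by
    have e2 : ∀ x : T × Gal(M/K), (Ideal.absNorm (F x).asIdeal : ℝ) ^ (-s) = (Ideal.absNorm x.1.1.asIdeal : ℝ) ^ (-s) := by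
      intro x
      rw [hF]
      simp only [hN]
    rw [Summable.tsum_prod (f := fun x : T × Gal(M/K) => (Ideal.absNorm (F x).asIdeal : ℝ) ^ (-s)) hS2]
    simp only [e2]
    simp only [tsum_fintype, Finset.sum_const, Finset.card_univ, nsmul_eq_mul]
    rw [← Nat.card_eq_fintype_card, hcard, tsum_mul_left, tsum_subtype T (fun P : HeightOneSpectrum (𝓞 K) => (Ideal.absNorm P.asIdeal : ℝ) ^ (-s))]
  rw [← e1]
  exact Summable.tsum_le_tsum_of_inj (f := fun x : T × Gal(M/K) => (Ideal.absNorm (F x).asIdeal : ℝ) ^ (-s)) F hinj (fun _ _ => by positivity) (fun _ => le_rfl) hS2 hS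

end Kummer
section KummerFinal
variable (K : Type*) [Field K] [NumberField K]

theorem kummer_bound {r : ℕ} (hr : r.Prime) (ζ : 𝓞 K) (hζ : IsPrimitiveRoot ζ r) (η : 𝓞 K) (hη : ∀ x : K, x ^ r ≠ η) :
    ∃ C δ : ℝ, 0 < δ ∧ δ ≤ 1 ∧ ∀ s, 1 < s → s < 1 + δ → ∀ T : Set (HeightOneSpectrum (𝓞 K)),
    (∀ P ∈ T, η ∉ P.asIdeal ∧ (r : 𝓞 K) ∉ P.asIdeal ∧ ∃ y, η - y ^ r ∈ P.asIdeal) →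
    r * ∑' P, T.indicator (fun P : HeightOneSpectrum (𝓞 K) => (Ideal.absNorm P.asIdeal : ℝ) ^ (-s)) P ≤ Real.log (1 / (s - 1)) + C := by
  have hirr := X_pow_sub_C_irreducible_of_prime hr hη
  have hζK : IsPrimitiveRoot (ζ : K) r := hζ.map_of_injective (FaithfulSMul.algebraMap_injective (𝓞 K) K)
  have hroots : (primitiveRoots r K).Nonempty := ⟨ζ, (mem_primitiveRoots hr.pos).2 hζK⟩
  obtain ⟨M, fM, aM, hM⟩ : ∃ (M : Type _) (_ : Field M) (_ : Algebra K M), Polynomial.IsSplittingField K M (Polynomial.X ^ r - Polynomial.C (η : K)) :=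
    ⟨Polynomial.SplittingField (Polynomial.X ^ r - Polynomial.C (η : K)), inferInstance, inferInstance, inferInstance⟩
  have hG : IsGalois K M := isGalois_of_isSplittingField_X_pow_sub_C hroots hirr M
  have hfr : Module.finrank K M = r := finrank_of_isSplittingField_X_pow_sub_C hroots hirr M
  have hfd : FiniteDimensional K M := Polynomial.IsSplittingField.finiteDimensional M (Polynomial.X ^ r - Polynomial.C (η : K))
  have hc0 : CharZero M := charZero_of_injective_algebraMap (FaithfulSMul.algebraMap_injective K M)
  have hnf : NumberField M := by
    have : FiniteDimensional ℚ M := Module.Finite.trans K M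
    exact ⟨⟩
  have hcard : Nat.card Gal(M/K) = r := by rw [IsGalois.card_aut_eq_finrank, hfr]
  obtain ⟨a, ha⟩ : ∃ a : M, a ^ r = algebraMap K M η := by
    have : NeZero r := ⟨hr.ne_zero⟩
    exact ⟨_, rootOfSplitsXPowSubC_pow (η : K) M⟩
  have hai : IsIntegral ℤ a := by
    apply IsIntegral.of_pow hr.pos
    rw [ha]
    exact (RingOfIntegers.isIntegral_coe η).algebraMap
  have htop := Algebra.adjoin_root_eq_top_of_isSplittingField hroots hirr (L := M) ha
  obtain ⟨C, δ, h1, h2, h3⟩ := prime_sum_log M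
  refine ⟨C, δ, h1, h2, fun s hs hsd T hT => ?_⟩
  have := kummer_sum (M := M) hr ζ hζ η ⟨a, hai⟩ (by apply RingOfIntegers.ext; exact ha) ?_ hcard s hs T hT
  · have h4 := abs_le.1 (h3 s hs hsd)
    linarith
  · intro σ hσ
    have hσa : σ a = a := congrArg (fun x : 𝓞 M => (x : M)) hσ
    have h5 : (σ : M →ₐ[K] M) = AlgHom.id K M := by
      apply AlgHom.ext_of_adjoin_eq_top htop
      intro x hx
      rw [Set.mem_singleton_iff] at hx
      subst hx
      exact hσa
    ext x
    exact DFunLike.congr_fun h5 x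
end KummerFinal
end ModD
end OmegaSq


namespace OmegaSq
section ModF
section Char

theorem pow_eq_of_cast {G : Type*} [Monoid G] {r : ℕ} (x : G) (hx : x ^ r = 1) (m n : ℕ) (h : (m : ZMod r) = n) : x ^ m = x ^ n := by
  rw [ZMod.natCast_eq_natCast_iff'] at h
  rw [pow_eq_pow_mod m hx, h, ← pow_eq_pow_mod n hx]

theorem exists_char {C : Type*} [CommGroup C] [Finite C] {r : ℕ} [hp : Fact r.Prime] 
    (a : (ZMod r)ˣ → C →* C) (ha : ∀ s t x, a s (a t x) = a (s * t) x) (c : C) (hc : c ≠ 1) (hcr : c ^ r = 1)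
    (hac : ∀ s : (ZMod r)ˣ, a s c = c ^ (((s : ZMod r) ^ 2).val)) :
    ∃ χ : C →* ℂˣ, χ ≠ 1 ∧ (∀ x, χ x ^ r = 1) ∧ ∀ (s : (ZMod r)ˣ) x, χ (a s x) = χ x ^ (((s : ZMod r) ^ 2).val) := by
  classical
  have hex : ∃ k : ℕ, ¬ ∃ d : C, c = d ^ r ^ k := by
    obtain ⟨k, m, hm, hkm⟩ := Nat.exists_eq_pow_mul_and_not_dvd (Nat.card_pos (α := C)).ne' r hp.out.ne_one
    refine ⟨k, ?_⟩
    rintro ⟨d, hd⟩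
    have h1 : c ^ m = 1 := by
      rw [hd, ← pow_mul, ← hkm, pow_card_eq_one']
    apply hc
    have h2 := Nat.dvd_gcd (orderOf_dvd_of_pow_eq_one hcr) (orderOf_dvd_of_pow_eq_one h1)
    rw [(Nat.Prime.coprime_iff_not_dvd hp.out).2 hm, Nat.dvd_one, orderOf_eq_one_iff] at h2
    exact h2
  set k := Nat.find hex with hk
  have hk0 : k ≠ 0 := by
    intro h0
    have := Nat.find_spec hex
    rw [← hk, h0] at this
    exact this ⟨c, by simp⟩
  obtain ⟨j, hj⟩ := Nat.exists_eq_succ_of_ne_zero hk0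
  obtain ⟨d, hd⟩ : ∃ d : C, c = d ^ r ^ j := by
    by_contra h
    have := Nat.find_min' hex h
    omega
  have hno : ¬ ∃ e : C, c = e ^ r ^ (j + 1) := by
    have := Nat.find_spec hex
    rwa [← hk, hj] at this
  set π : C →* C := ∏ s : (ZMod r)ˣ, (a s) ^ nn s with hπ
  have hπa : ∀ x, π x = ∏ s : (ZMod r)ˣ, (a s x) ^ nn s := by
    intro x
    rw [hπ, MonoidHom.finsetProd_apply]; rfl
  have hπc : π c = c⁻¹ := by
    have h1 : ∀ s : (ZMod r)ˣ, (a s c) ^ nn s = c := by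
      intro s
      rw [hac, ← pow_mul]
      conv_rhs => rw [← pow_one c]
      apply pow_eq_of_cast c hcr
      push_cast
      rw [nn_cast, ZMod.natCast_zmod_val, ← mul_pow, Units.mul_inv, one_pow]
    rw [hπa, Finset.prod_congr rfl (fun s _ => h1 s), Finset.prod_const, Finset.card_univ, ZMod.card_units_eq_totient, Nat.totient_prime hp.out]
    rw [eq_inv_iff_mul_eq_one, ← pow_succ, Nat.sub_add_cancel hp.out.one_le, hcr]
  have hd' : π d ∉ (powMonoidHom r : C →* C).range := by
    rintro ⟨e, he⟩
    apply hno
    refine ⟨e⁻¹, ?_⟩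
    have he' : e ^ r = π d := he
    rw [inv_pow, pow_succ', pow_mul, he', ← map_pow, ← hd, hπc, inv_inv]
  set N := (powMonoidHom r : C →* C).range with hN
  have hne : (QuotientGroup.mk (π d) : C ⧸ N) ≠ 1 := by
    rwa [Ne, QuotientGroup.eq_one_iff]
  have hexp : NeZero (Monoid.exponent (C ⧸ N)) := ⟨Monoid.exponent_ne_zero_of_finite⟩
  obtain ⟨f, hf⟩ := CommGroup.exists_apply_ne_one_of_hasEnoughRootsOfUnity (C ⧸ N) ℂ hne
  have hfr : ∀ x, f x ^ r = 1 := by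
    intro x
    obtain ⟨y, rfl⟩ := QuotientGroup.mk_surjective x
    rw [← map_pow, ← QuotientGroup.mk_pow]
    have : (QuotientGroup.mk (y ^ r) : C ⧸ N) = 1 := (QuotientGroup.eq_one_iff _).2 ⟨y, rfl⟩
    rw [this, map_one]
  refine ⟨(f.comp (QuotientGroup.mk' N)).comp π, ?_, fun x => hfr _, ?_⟩
  · intro h
    exact hf (DFunLike.congr_fun h d)
  · intro t x
    show f (QuotientGroup.mk' N (π (a t x))) = f (QuotientGroup.mk' N (π x)) ^ _
    simp only [hπa, map_prod, map_pow, ha]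
    rw [← Finset.prod_pow]
    refine Fintype.prod_equiv (Equiv.mulRight t) _ _ fun s => ?_
    simp only [Equiv.coe_mulRight]
    rw [← pow_mul]
    apply pow_eq_of_cast _ (hfr _)
    push_cast
    rw [nn_cast, nn_cast, ZMod.natCast_zmod_val, ← mul_pow]
    congr 1
    rw [← Units.val_mul]
    congr 1
    rw [mul_inv, inv_mul_cancel_right]
end Char
end ModF
end OmegaSq


namespace OmegaSq
section ModE1
open NumberField IsDedekindDomain Filter Topology
open scoped nonZeroDivisors
section VV
open scoped Classical
open UniqueFactorizationMonoid

/-- exponent of the prime `Q` in the ideal `I` -/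
noncomputable def vv {A : Type*} [CommRing A] [IsDedekindDomain A] (Q I : Ideal A) : ℕ := (normalizedFactors I).count Q

variable {A : Type*} [CommRing A] [IsDedekindDomain A]

theorem vv_mul (Q : Ideal A) {I J : Ideal A} (hI : I ≠ ⊥) (hJ : J ≠ ⊥) : vv Q (I * J) = vv Q I + vv Q J := by
  rw [vv, normalizedFactors_mul hI hJ, Multiset.count_add]; rfl

theorem vv_pow (Q : Ideal A) (I : Ideal A) (n : ℕ) : vv Q (I ^ n) = n * vv Q I := by
  rw [vv, normalizedFactors_pow, Multiset.count_nsmul]; rfl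

theorem vv_eq_zero (Q : Ideal A) {I : Ideal A} (h : ¬ I ≤ Q) : vv Q I = 0 := by
  rw [vv, Multiset.count_eq_zero]
  intro hm
  exact h (Ideal.le_of_dvd (dvd_of_mem_normalizedFactors hm))

theorem vv_self (Q : Ideal A) [hQ : Q.IsPrime] (hb : Q ≠ ⊥) : vv Q Q = 1 := by
  have := (Ideal.prime_of_isPrime hb hQ).irreducible
  rw [vv, normalizedFactors_irreducible this, normalize_eq, Multiset.count_singleton_self]

theorem vv_pos (Q : Ideal A) [hQ : Q.IsPrime] {I : Ideal A} (hI : I ≠ ⊥) (h : I ≤ Q) : 0 < vv Q I := by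
  rw [vv, Multiset.count_pos, Ideal.mem_normalizedFactors_iff hI]
  exact ⟨hQ, h⟩

/-- splitting off the exact power -/
theorem vv_split (Q : Ideal A) [hQ : Q.IsPrime] (hb : Q ≠ ⊥) {I : Ideal A} (hI : I ≠ ⊥) : ∃ J : Ideal A, I = Q ^ vv Q I * J ∧ ¬ J ≤ Q := by
  have hirr := (Ideal.prime_of_isPrime hb hQ).irreducible
  have h1 := emultiplicity_eq_count_normalizedFactors hirr hI
  rw [normalize_eq] at h1
  change _ = ((vv Q I : ℕ) : ℕ∞) at h1
  obtain ⟨J, hJ⟩ := pow_dvd_of_le_emultiplicity h1.ge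
  refine ⟨J, hJ, fun hle => ?_⟩
  have : Q ^ (vv Q I + 1) ∣ I := by
    rw [pow_succ]
    exact (mul_dvd_mul_left _ (Ideal.dvd_iff_le.2 hle)).trans (dvd_of_eq hJ.symm)
  have := le_emultiplicity_of_pow_dvd this
  rw [h1] at this
  have := ENat.natCast_le_natCast.1 this
  omega

theorem vv_map {B : Type*} [CommRing B] [IsDedekindDomain B] [Algebra A B] [FaithfulSMul A B] [Module.IsTorsionFree A B]
    (q : Ideal A) (Q : Ideal B) [hq : q.IsPrime] [hQ : Q.IsPrime]
    [Q.LiesOver q] (hqb : q ≠ ⊥) (hQb : Q ≠ ⊥) (I : Ideal A) (hI : I ≠ ⊥) :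
    vv Q (I.map (algebraMap A B)) = Q.ramificationIdx A * vv q I := by
  have i1 := (Ideal.prime_of_isPrime hqb hq).irreducible
  have i2 := (Ideal.prime_of_isPrime hQb hQ).irreducible
  have h := Ideal.IsDedekindDomain.emultiplicity_map_eq_ramificationIdx'_mul hI i1 i2 hQb
  have hIm : I.map (algebraMap A B) ≠ ⊥ := Ideal.map_ne_bot_of_ne_bot hI
  rw [emultiplicity_eq_count_normalizedFactors i1 hI, emultiplicity_eq_count_normalizedFactors i2 hIm, normalize_eq, normalize_eq,
    Ideal.ramificationIdx'_eq_ramificationIdx q Q hqb] at h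
  exact_mod_cast h

theorem span_ne_bot {A : Type*} [CommRing A] {x : A} (hx : x ≠ 0) : Ideal.span ({x} : Set A) ≠ ⊥ := by
  rwa [Ne, Ideal.span_singleton_eq_bot]

theorem vv_span_mul (Q : Ideal A) {x y : A} (hx : x ≠ 0) (hy : y ≠ 0) : vv Q (Ideal.span {x * y}) = vv Q (Ideal.span {x}) + vv Q (Ideal.span {y}) := by
  rw [← Ideal.span_singleton_mul_span_singleton, vv_mul Q (span_ne_bot hx) (span_ne_bot hy)]

theorem vv_span_pow (Q : Ideal A) (x : A) (n : ℕ) : vv Q (Ideal.span {x ^ n}) = n * vv Q (Ideal.span {x}) := by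
  rw [← Ideal.span_singleton_pow, vv_pow]

/-- writing `α s = π^k w` with `s, w` prime to `Q` when `π` is a uniformizer. -/
theorem local_factor (Q : Ideal A) [hQ : Q.IsPrime] (hb : Q ≠ ⊥) {α π : A} (hα : α ≠ 0) (hπ : π ≠ 0) (hv : vv Q (Ideal.span {π}) = 1) :
    ∃ s w : A, s ∉ Q ∧ w ∉ Q ∧ α * s = π ^ vv Q (Ideal.span {α}) * w := by
  obtain ⟨J, hJ, hJQ⟩ := vv_split Q hb (span_ne_bot hα)
  obtain ⟨J', hJ', hJQ'⟩ := vv_split Q hb (span_ne_bot hπ)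
  rw [hv, pow_one] at hJ'
  generalize hk : vv Q (Ideal.span {α}) = k at *
  have h1 : ¬ J' ^ k ≤ Q := by
    intro h
    exact hJQ' (hQ.le_of_pow_le h)
  obtain ⟨s, hs, hsQ⟩ := SetLike.not_le_iff_exists.1 h1
  have h2 : α * s ∈ Ideal.span {π ^ k} := by
    have : α * s ∈ Ideal.span {α} * J' ^ k := Ideal.mul_mem_mul (Ideal.mem_span_singleton_self α) hs
    have e : Ideal.span {α} * J' ^ k = Ideal.span {π ^ k} * J := by
      rw [hJ, mul_right_comm, ← mul_pow, ← hJ', Ideal.span_singleton_pow]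
    have hle : Ideal.span {π ^ k} * J ≤ Ideal.span {π ^ k} := Ideal.le_of_dvd (dvd_mul_right _ _)
    exact hle (e ▸ this)
  obtain ⟨w, hw⟩ := Ideal.mem_span_singleton'.1 h2
  have hs0 : s ≠ 0 := fun h => hsQ (h ▸ Q.zero_mem)
  have hw0 : w ≠ 0 := by
    rintro rfl
    rw [zero_mul] at hw
    exact mul_ne_zero hα hs0 hw.symm
  refine ⟨s, w, hsQ, ?_, by rw [← hw, mul_comm]⟩
  intro hwQ
  have h3 : vv Q (Ideal.span {α * s}) = k + 0 := by
    rw [vv_span_mul Q hα hs0, hk, vv_eq_zero Q (I := Ideal.span {s})]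
    rwa [Ideal.span_singleton_le_iff_mem]
  rw [← hw, vv_span_mul Q hw0 (pow_ne_zero _ hπ), vv_span_pow, hv] at h3
  have := vv_pos Q (span_ne_bot hw0) ((Ideal.span_singleton_le_iff_mem _).2 hwQ)
  omega
end VV

section Deg1
open scoped Pointwise
variable {K : Type*} [Field K] [NumberField K]

theorem deg1_l_mem (q : Ideal (𝓞 K)) {l : ℕ} (hq : Ideal.absNorm q = l) : (l : 𝓞 K) ∈ q := by
  rw [← hq]; exact Ideal.absNorm_mem q

theorem deg1_int (q : Ideal (𝓞 K)) {l : ℕ} [hl : Fact l.Prime] (hq : Ideal.absNorm q = l) (x : 𝓞 K) : ∃ a : ℕ, x - a ∈ q := by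
  have hqm := deg1_l_mem q hq
  have hcard : Nat.card (𝓞 K ⧸ q) = l := by rw [← hq, Ideal.absNorm_apply]; rfl
  have hfin : Finite (𝓞 K ⧸ q) := Nat.finite_of_card_ne_zero (by rw [hcard]; exact hl.out.ne_zero)
  have := Fintype.ofFinite (𝓞 K ⧸ q)
  have hne : (1 : 𝓞 K ⧸ q) ≠ 0 := by
    intro h
    have : Subsingleton (𝓞 K ⧸ q) := subsingleton_of_zero_eq_one h.symm
    have h1 := Nat.card_of_subsingleton (1 : 𝓞 K ⧸ q)
    rw [hcard] at h1
    exact hl.out.ne_one h1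
  have h0 : (l : 𝓞 K ⧸ q) = 0 := by
    have := Ideal.Quotient.eq_zero_iff_mem.2 hqm
    simpa using this
  have hchar : CharP (𝓞 K ⧸ q) l := by
    have : Nontrivial (𝓞 K ⧸ q) := ⟨1, 0, hne⟩
    exact (CharP.charP_iff_prime_eq_zero hl.out).2 h0
  have hb := ZMod.castHom_bijective (𝓞 K ⧸ q) (n := l) (by rw [← Nat.card_eq_fintype_card, hcard])
  obtain ⟨z, hz⟩ := hb.2 (Ideal.Quotient.mk q x)
  refine ⟨z.val, ?_⟩
  rw [← Ideal.Quotient.eq_zero_iff_mem, map_sub, ← hz, map_natCast, sub_eq_zero]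
  conv_lhs => rw [← ZMod.natCast_zmod_val z]
  rw [map_natCast]

theorem deg1_r_notMem (q : Ideal (𝓞 K)) [hqp : q.IsPrime] {l r : ℕ} (hl : l.Prime) (hr : r.Prime) (hlr : l ≠ r) (hlq : (l : 𝓞 K) ∈ q) : (r : 𝓞 K) ∉ q := by
  intro h
  have hc := (Nat.coprime_primes hl hr).2 hlr
  have := (Nat.isCoprime_iff_coprime.2 hc)
  obtain ⟨a, b, hab⟩ := this
  apply hqp.ne_top
  rw [Ideal.eq_top_iff_one]
  have e : (1 : 𝓞 K) = (a : 𝓞 K) * l + b * r := by exact_mod_cast hab.symm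
  rw [e]
  exact q.add_mem (q.mul_mem_left _ hlq) (q.mul_mem_left _ h)

theorem deg1_dvd (q : Ideal (𝓞 K)) [hqp : q.IsPrime] {l r : ℕ} [hl : Fact l.Prime] (hr : r.Prime) (hlr : l ≠ r) (hq : Ideal.absNorm q = l)
    (ζ : 𝓞 K) (hζ : IsPrimitiveRoot ζ r) : r ∣ l - 1 := by
  have hlq := deg1_l_mem q hq
  have hrq := deg1_r_notMem q hl.out hr hlr hlq
  obtain ⟨a, ha⟩ := deg1_int q hq ζ
  have h1 : ζ ^ l - ζ ∈ q := by
    have e1 : ζ ^ l - (a : 𝓞 K) ^ l ∈ q := q.mem_of_dvd (sub_dvd_pow_sub_pow _ _ _) ha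
    have e2 : (a : 𝓞 K) ^ l - a ∈ q := by
      have : (l : ℤ) ∣ (a : ℤ) ^ l - a := by
        rw [← ZMod.intCast_zmod_eq_zero_iff_dvd]
        push_cast
        rw [ZMod.pow_card, sub_self]
      obtain ⟨b, hb⟩ := this
      have e : (a : 𝓞 K) ^ l - a = l * b := by exact_mod_cast congrArg (fun z : ℤ => (z : 𝓞 K)) hb
      rw [e]
      exact q.mul_mem_right _ hlq
    have := q.sub_mem (q.add_mem e1 e2) ha
    convert this using 1; ring
  have h2 : ζ * (ζ ^ (l - 1) - 1) ∈ q := by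
    rw [mul_sub, mul_one, ← pow_succ', Nat.sub_add_cancel hl.out.one_le]; exact h1
  have hζq : ζ ∉ q := by
    intro h
    apply hqp.ne_top
    rw [Ideal.eq_top_iff_one, ← hζ.pow_eq_one]
    exact q.pow_mem_of_mem h _ hr.pos
  have h3 := (hqp.mem_or_mem h2).resolve_left hζq
  rw [← hζ.pow_eq_one_iff_dvd]
  by_contra hne
  exact hrq (r_mem_of q _ (by rw [← pow_mul, mul_comm, pow_mul, hζ.pow_eq_one, one_pow]) hne h3)

theorem deg1_stab (q : Ideal (𝓞 K)) [hqp : q.IsPrime] {l r : ℕ} [hl : Fact l.Prime] (hr : r.Prime) (hlr : l ≠ r) (hq : Ideal.absNorm q = l)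
    (ζ : 𝓞 K) (hζ : IsPrimitiveRoot ζ r) (σ : Gal(K/ℚ)) (hσ : σ • q = q) : σ • ζ = ζ := by
  have hlq := deg1_l_mem q hq
  have hrq := deg1_r_notMem q hl.out hr hlr hlq
  obtain ⟨a, ha⟩ := deg1_int q hq ζ
  have h1 : σ • (ζ - (a : 𝓞 K)) ∈ q := by
    have : σ • (ζ - (a : 𝓞 K)) ∈ σ • q := Ideal.smul_mem_pointwise_smul_iff.2 ha
    rwa [hσ] at this
  have h2 : σ • (a : 𝓞 K) = a := map_natCast (MulSemiringAction.toRingHom Gal(K/ℚ) (𝓞 K) σ) a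
  rw [smul_sub, h2] at h1
  have h3 : σ • ζ - ζ ∈ q := by
    have := q.sub_mem h1 ha
    rwa [sub_sub_sub_cancel_right] at this
  have hnz : NeZero r := ⟨hr.ne_zero⟩
  obtain ⟨i, -, hi⟩ := hζ.eq_pow_of_pow_eq_one (ξ := σ • ζ) (by rw [← smul_pow', hζ.pow_eq_one, smul_one])
  by_contra hne
  have hi0 : i ≠ 0 := by
    rintro rfl
    rw [pow_zero] at hi
    have : ζ = 1 := by
      have := congrArg (fun x => σ⁻¹ • x) hi
      simpa using this.symm
    exact hζ.ne_one hr.one_lt this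
  have h4 : ζ * (ζ ^ (i - 1) - 1) ∈ q := by
    rw [mul_sub, mul_one, ← pow_succ', Nat.sub_add_cancel (by omega), hi]; exact h3
  have hζq : ζ ∉ q := by
    intro h
    apply hqp.ne_top
    rw [Ideal.eq_top_iff_one, ← hζ.pow_eq_one]
    exact q.pow_mem_of_mem h _ hr.pos
  have h5 := (hqp.mem_or_mem h4).resolve_left hζq
  have h6 : ζ ^ (i - 1) ≠ 1 := by
    intro h
    apply hne
    rw [← hi, ← Nat.sub_add_cancel (show 1 ≤ i by omega), pow_succ, h, one_mul]
  exact hrq (r_mem_of q _ (by rw [← pow_mul, mul_comm, pow_mul, hζ.pow_eq_one, one_pow]) h6 h5)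

theorem deg1_vv [IsGalois ℚ K] (q : Ideal (𝓞 K)) [hqp : q.IsPrime] {l r : ℕ} [hl : Fact l.Prime] (hr : r.Prime) (hlr : l ≠ r) (hq : Ideal.absNorm q = l)
    (ζ : 𝓞 K) (hζ : IsPrimitiveRoot ζ r) (hgen : ∀ σ : Gal(K/ℚ), σ • ζ = ζ → σ = 1) : vv q (Ideal.span {(l : 𝓞 K)}) = 1 := by
  have hlq := deg1_l_mem q hq
  have hqb : q ≠ ⊥ := by
    intro h
    rw [h, Ideal.absNorm_bot] at hq
    exact hl.out.ne_zero hq.symm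
  have hlp : Prime (l : ℤ) := Nat.prime_iff_prime_int.1 hl.out
  have hlb : Ideal.span {(l : ℤ)} ≠ ⊥ := span_ne_bot (by exact_mod_cast hl.out.ne_zero)
  have hI : (Ideal.span {(l : ℤ)}).IsPrime := (Ideal.span_singleton_prime (by exact_mod_cast hl.out.ne_zero)).2 hlp
  have hM : (Ideal.span {(l : ℤ)}).IsMaximal := hI.isMaximal hlb
  have hlo : q.LiesOver (Ideal.span {(l : ℤ)}) := by
    constructor
    apply hM.eq_of_le (Ideal.IsPrime.ne_top inferInstance)
    rw [Ideal.span_singleton_le_iff_mem, Ideal.mem_comap]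
    simpa using hlq
  have hc := Ideal.card_stabilizer_eq (G := Gal(K/ℚ)) (Ideal.span {(l : ℤ)}) q
  have hc1 : Nat.card (MulAction.stabilizer Gal(K/ℚ) q) = 1 := by
    rw [Nat.card_eq_one_iff_unique]
    refine ⟨⟨fun a b => ?_⟩, ⟨1⟩⟩
    apply Subtype.ext
    rw [hgen _ (deg1_stab q hr hlr hq ζ hζ a.1 a.2), hgen _ (deg1_stab q hr hlr hq ζ hζ b.1 b.2)]
  rw [hc1] at hc
  have he := Nat.eq_one_of_mul_eq_one_right hc.symm
  rw [Ideal.ramificationIdxIn_eq_ramificationIdx (Ideal.span {(l : ℤ)}) q Gal(K/ℚ)] at he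
  have := vv_map (Ideal.span {(l : ℤ)}) q hlb hqb (Ideal.span {(l : ℤ)}) hlb
  rw [he, vv_self _ hlb, Ideal.map_span, Set.image_singleton] at this
  simpa using this
end Deg1
end ModE1
end OmegaSq


namespace OmegaSq
section ModE2
open NumberField IsDedekindDomain Filter Topology
open scoped nonZeroDivisors
section Cyc
open Polynomial

theorem cyc_irr {K : Type*} [Field K] [NumberField K] {r l : ℕ} [hr : Fact r.Prime] [hl : Fact l.Prime] (hlr : l ≠ r)
    [IsCyclotomicExtension {r} ℚ K] : Irreducible (cyclotomic l K) := by
  have : NeZero r := ⟨hr.out.ne_zero⟩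
  have : NeZero l := ⟨hl.out.ne_zero⟩
  let L := CyclotomicField l K
  have : NumberField L := IsCyclotomicExtension.numberField {l} K L
  have hz := IsCyclotomicExtension.zeta_spec l K L
  have hx := (IsCyclotomicExtension.zeta_spec r ℚ K).map_of_injective (algebraMap K L).injective
  have hc : Nat.Coprime l r := (Nat.coprime_primes hl.out hr.out).2 hlr
  have h1 := hz.lcm_totient_le_finrank (K := ℚ) hx (cyclotomic.irreducible_rat (Nat.lcm_pos hl.out.pos hr.out.pos))
  rw [hc.lcm_eq_mul, Nat.totient_mul hc, ← Module.finrank_mul_finrank ℚ K L,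
    IsCyclotomicExtension.finrank K (cyclotomic.irreducible_rat hr.out.pos), mul_comm] at h1
  have h2 : l.totient ≤ Module.finrank K L := Nat.le_of_mul_le_mul_left h1 (Nat.totient_pos.2 hr.out.pos)
  have hint : IsIntegral K (IsCyclotomicExtension.zeta l K L) := Algebra.IsIntegral.isIntegral _
  have h3 : (minpoly K (IsCyclotomicExtension.zeta l K L)).natDegree = Module.finrank K L := by
    have := (hz.powerBasis K).natDegree_minpoly
    rw [hz.powerBasis_gen K] at this
    rw [(hz.powerBasis K).finrank]
    exact this
  have h4 : minpoly K (IsCyclotomicExtension.zeta l K L) ∣ cyclotomic l K := by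
    apply minpoly.dvd
    rw [aeval_def, ← eval_map, map_cyclotomic]
    exact hz.isRoot_cyclotomic hl.out.pos
  have h5 : cyclotomic l K = minpoly K (IsCyclotomicExtension.zeta l K L) :=
    eq_of_monic_of_dvd_of_natDegree_le (minpoly.monic hint) (cyclotomic.monic l K) h4 (by
      rw [natDegree_cyclotomic, h3]; exact h2)
  rw [h5]
  exact minpoly.irreducible hint

theorem cyc_norm {K L : Type*} [Field K] [Field L] [NumberField K] [Algebra K L] {l : ℕ} [hl : Fact l.Prime] (hl2 : 2 < l)
    [IsCyclotomicExtension {l} K L] (hirr : Irreducible (cyclotomic l K)) (z : L) (hz : IsPrimitiveRoot z l)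
    (a : K) (ha : a ^ l = a) (ha1 : a ≠ 1) : Algebra.norm K (z - algebraMap K L a) = 1 := by
  have : NeZero l := ⟨hl.out.ne_zero⟩
  let E := AlgebraicClosure L
  obtain ⟨w, hw⟩ := IsAlgClosed.exists_root _ (degree_cyclotomic_pos l E (NeZero.pos _)).ne.symm
  apply (algebraMap K E).injective
  let := IsCyclotomicExtension.finiteDimensional {l} K L
  let := IsCyclotomicExtension.isGalois {l} K L
  rw [Algebra.norm_eq_prod_embeddings]
  conv_lhs =>
    congr
    rfl
    ext
    rw [← neg_sub, map_neg, map_sub, AlgHom.commutes, neg_eq_neg_one_mul]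
  rw [Finset.prod_mul_distrib, Finset.prod_const, Finset.card_univ, AlgHom.card,
    IsCyclotomicExtension.finrank L hirr, (Nat.totient_even hl2).neg_one_pow, one_mul]
  have Hprod : (Finset.univ.prod fun σ : L →ₐ[K] E => algebraMap K E a - σ z) = eval (algebraMap K E a) (cyclotomic' l E) := by
    rw [cyclotomic', eval_prod, ← @Finset.prod_attach E E, ← Finset.univ_eq_attach]
    refine Fintype.prod_equiv (hz.embeddingsEquivPrimitiveRoots E hirr) _ _ fun σ => ?_
    simp
  have : NeZero (l : E) := NeZero.of_faithfulSMul K _ l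
  rw [Hprod, cyclotomic', ← cyclotomic_eq_prod_X_sub_primitiveRoots (isRoot_cyclotomic_iff.1 hw)]
  have h := congrArg (eval (algebraMap K E a)) (cyclotomic_prime_mul_X_sub_one E l)
  rw [eval_mul, eval_sub, eval_sub, eval_pow, eval_X, eval_one, ← map_pow, ha] at h
  have hne : algebraMap K E a - 1 ≠ 0 := by
    rw [sub_ne_zero, ← map_one (algebraMap K E)]
    exact fun h => ha1 ((algebraMap K E).injective h)
  rw [map_one]
  exact mul_right_cancel₀ hne (by rw [h, one_mul])

theorem exists_tau {K L : Type*} [Field K] [Field L] [NumberField K] [NumberField L] [Algebra K L] {l : ℕ} [hl : Fact l.Prime]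
    [IsCyclotomicExtension {l} K L] (hirr : Irreducible (cyclotomic l K)) :
    ∃ (g : ℕ) (τ : Gal(L/K)) (z : 𝓞 L), IsPrimitiveRoot z l ∧ τ • z = z ^ g ∧ (∀ x, x ∈ Subgroup.zpowers τ) ∧
      (∀ σ : Gal(L/K), σ • z = z → σ = 1) ∧ (∀ k : ℕ, l ∣ g ^ k - 1 → l - 1 ∣ k) ∧ ¬ l ∣ g := by
  have : NeZero l := ⟨hl.out.ne_zero⟩
  have hz := IsCyclotomicExtension.zeta_spec l K L
  obtain ⟨u, hu⟩ := IsCyclic.exists_generator (α := (ZMod l)ˣ)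
  let e := IsCyclotomicExtension.autEquivPow L hirr
  have hsp : ∀ σ : Gal(L/K), σ (IsCyclotomicExtension.zeta l K L) = IsCyclotomicExtension.zeta l K L ^ (e σ : ZMod l).val := by
    intro σ
    exact (hz.autToPow_spec K σ).symm
  refine ⟨(u : ZMod l).val, e.symm u, hz.toInteger, hz.toInteger_isPrimitiveRoot, ?_, ?_, ?_, ?_, ?_⟩
  · apply RingOfIntegers.ext
    have := hsp (e.symm u)
    rw [e.apply_symm_apply] at this
    exact this
  · intro x
    obtain ⟨n, hn⟩ := Subgroup.mem_zpowers_iff.1 (hu (e x))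
    refine Subgroup.mem_zpowers_iff.2 ⟨n, ?_⟩
    rw [← map_zpow, hn, e.symm_apply_apply]
  · intro σ hσ
    have h1 : σ (IsCyclotomicExtension.zeta l K L) = IsCyclotomicExtension.zeta l K L := congrArg (fun x : 𝓞 L => (x : L)) hσ
    have h2 := hsp σ
    rw [h1] at h2
    have h3 : (e σ : ZMod l).val = 1 := by
      have := hz.pow_inj (i := 1) (j := (e σ : ZMod l).val) hl.out.one_lt (ZMod.val_lt _) (by rw [pow_one]; exact h2)
      exact this.symm
    have h4 : (e σ : ZMod l) = 1 := by
      rw [← ZMod.natCast_zmod_val (e σ : ZMod l), h3, Nat.cast_one]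
    apply e.injective
    rw [map_one]
    exact Units.ext h4
  · intro k hk
    have h1 : 1 ≤ (u : ZMod l).val ^ k := Nat.one_le_pow _ _ (Nat.pos_of_ne_zero (by
      rw [ZMod.val_ne_zero]; exact u.ne_zero))
    have h2 : ((((u : ZMod l).val ^ k - 1 : ℕ)) : ZMod l) = 0 := (ZMod.natCast_eq_zero_iff _ _).2 hk
    rw [Nat.cast_sub h1, Nat.cast_pow, ZMod.natCast_zmod_val, Nat.cast_one, sub_eq_zero] at h2
    have h3 : u ^ k = 1 := Units.ext (by simpa using h2)
    have h4 := orderOf_dvd_of_pow_eq_one h3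
    rwa [orderOf_eq_card_of_forall_mem_zpowers hu, Nat.card_eq_fintype_card, ZMod.card_units] at h4
  · rw [← ZMod.natCast_eq_zero_iff, ZMod.natCast_zmod_val]
    exact u.ne_zero

end Cyc
end ModE2
end OmegaSq


namespace OmegaSq
section ModE3
open NumberField IsDedekindDomain Filter Topology
open scoped nonZeroDivisors
section Alpha
open Polynomial

theorem exists_alpha {K L : Type} [Field K] [Field L] [NumberField K] [NumberField L] [Algebra K L] {l r : ℕ} [hl : Fact l.Prime] [hr : Fact r.Prime]
    [IsCyclotomicExtension {l} K L] (hirr : Irreducible (cyclotomic l K)) (hl2 : 2 < l) (hd : r ∣ l - 1)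
    (ζ : 𝓞 K) (hζ : IsPrimitiveRoot ζ r) (z : 𝓞 L) (hz : IsPrimitiveRoot z l) (τ : Gal(L/K)) (hτ : ∀ x, x ∈ Subgroup.zpowers τ) :
    ∃ α : 𝓞 L, α ≠ 0 ∧ (∏ u : (ZMod r)ˣ, (z - algebraMap (𝓞 K) (𝓞 L) (ζ ^ (u : ZMod r).val)) ^ nn u) * τ • α = α := by
  have : NeZero l := ⟨hl.out.ne_zero⟩
  have : IsGalois K L := IsCyclotomicExtension.isGalois {l} K L
  have hn : Algebra.norm K (algebraMap (𝓞 L) L (∏ u : (ZMod r)ˣ, (z - algebraMap (𝓞 K) (𝓞 L) (ζ ^ (u : ZMod r).val)) ^ nn u)) = 1 := by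
    rw [map_prod, map_prod]
    apply Finset.prod_eq_one
    intro u _
    rw [map_pow, map_pow, map_sub]
    have hζK : IsPrimitiveRoot (algebraMap (𝓞 K) K ζ) r := hζ.map_of_injective (FaithfulSMul.algebraMap_injective (𝓞 K) K)
    have hzL : IsPrimitiveRoot (algebraMap (𝓞 L) L z) l := hz.map_of_injective (FaithfulSMul.algebraMap_injective (𝓞 L) L)
    have h1 := cyc_norm (K := K) (L := L) hl2 hirr (algebraMap (𝓞 L) L z) hzL (algebraMap (𝓞 K) K ζ ^ (u : ZMod r).val)
      (by
        obtain ⟨m, hm⟩ := hd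
        have : l = r * m + 1 := by have := hl.out.pos; omega
        rw [this, pow_succ, pow_mul, ← pow_mul _ _ r, mul_comm _ r, pow_mul, hζK.pow_eq_one]
        simp)
      (by
        intro h
        rw [hζK.pow_eq_one_iff_dvd] at h
        have h0 : (u : ZMod r).val ≠ 0 := by rw [ZMod.val_ne_zero]; exact u.ne_zero
        exact absurd (Nat.le_of_dvd (Nat.pos_of_ne_zero h0) h) (not_le.2 (ZMod.val_lt _)))
    have h2 : algebraMap (𝓞 L) L (algebraMap (𝓞 K) (𝓞 L) (ζ ^ (u : ZMod r).val)) = algebraMap K L (algebraMap (𝓞 K) K ζ ^ (u : ZMod r).val) := by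
      rw [← map_pow (algebraMap (𝓞 K) K)]
      rfl
    rw [h2, h1, one_pow]
  have : IsCyclic Gal(L/K) := ⟨⟨τ, hτ⟩⟩
  obtain ⟨α, hα0, hα⟩ := groupCohomology.exists_mul_galRestrict_of_norm_eq_one (A := 𝓞 K) (B := 𝓞 L) hτ hn
  refine ⟨α, hα0, ?_⟩
  have h3 : galRestrict (𝓞 K) K L (𝓞 L) τ α = τ • α := by
    apply RingOfIntegers.ext
    exact algebraMap_galRestrict_apply (𝓞 K) τ α
  rwa [h3] at hα

theorem exists_beta {K L : Type*} [Field K] [Field L] [NumberField K] [NumberField L] [Algebra K L] [IsGalois K L]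
    (τ : Gal(L/K)) (hτ : ∀ x, x ∈ Subgroup.zpowers τ) (α ε : 𝓞 L) (hα0 : α ≠ 0) (hα : ε * τ • α = α) :
    ∃ β : 𝓞 K, β ≠ 0 ∧ (Ideal.span {β}).map (algebraMap (𝓞 K) (𝓞 L)) = Ideal.span {α} ^ (Nat.card Gal(L/K)) := by
  have h1 : ∀ n : ℕ, (τ ^ n) • α ∣ α := by
    intro n
    induction n with
    | zero => simp
    | succ n ih =>
      rw [pow_succ', mul_smul]
      have : τ • (τ ^ n • α) ∣ τ • α := by
        obtain ⟨y, hy⟩ := ih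
        refine ⟨τ • y, ?_⟩
        rw [← smul_mul', ← hy]
      exact this.trans ⟨ε, by rw [mul_comm, hα]⟩
  have h2 : ∀ σ : Gal(L/K), σ • α ∣ α := by
    intro σ
    obtain ⟨n, rfl⟩ := (mem_powers_iff_mem_zpowers (x := τ) (y := σ)).2 (hτ σ)
    exact h1 n
  have h3 : ∀ σ : Gal(L/K), α ∣ σ • α := by
    intro σ
    obtain ⟨y, hy⟩ := h2 σ⁻¹
    refine ⟨σ • y, ?_⟩
    have := congrArg (fun x => σ • x) hy
    simpa [smul_mul'] using this
  refine ⟨RingOfIntegers.norm K α, ?_, ?_⟩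
  · intro h
    have h4 : Algebra.norm K (α : L) = 0 := by
      rw [← RingOfIntegers.coe_norm, h]; rfl
    rw [Algebra.norm_eq_zero_iff] at h4
    exact hα0 (RingOfIntegers.ext h4)
  · have e : algebraMap (𝓞 K) (𝓞 L) (RingOfIntegers.norm K α) = ∏ σ : Gal(L/K), σ • α := by
      apply RingOfIntegers.ext
      rw [RingOfIntegers.coe_algebraMap_norm, Algebra.norm_eq_prod_automorphisms]
      exact (map_prod (algebraMap (𝓞 L) L) (fun σ : Gal(L/K) => σ • α) Finset.univ).symm
    rw [Ideal.map_span, Set.image_singleton, e, ← Ideal.prod_span_singleton]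
    rw [Finset.prod_congr rfl (fun σ _ => Ideal.span_singleton_eq_span_singleton.2 (associated_of_dvd_dvd (h2 σ) (h3 σ)))]
    rw [Finset.prod_const, Finset.card_univ, Nat.card_eq_fintype_card]
end Alpha
end ModE3
end OmegaSq


namespace OmegaSq
section ModE4
open NumberField IsDedekindDomain Filter Topology
open scoped nonZeroDivisors
section Local
open scoped Pointwise
variable {K L : Type*} [Field K] [Field L] [NumberField K] [NumberField L] [Algebra K L] [IsGalois K L]

theorem ram_card (q : Ideal (𝓞 K)) [q.IsMaximal] (Q : Ideal (𝓞 L)) [Q.IsPrime] [Q.LiesOver q] :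
    Nat.card (Q.inertia Gal(L/K)) = Q.ramificationIdx (𝓞 K) := by
  rw [Ideal.card_inertia_eq_ramificationIdxIn (G := Gal(L/K)) q Q, Ideal.ramificationIdxIn_eq_ramificationIdx q Q Gal(L/K)]

theorem away_dvd (q : Ideal (𝓞 K)) [hqp : q.IsPrime] (hqb : q ≠ ⊥) {l : ℕ} (hl : l.Prime) (hlq : (l : 𝓞 K) ∉ q)
    (z : 𝓞 L) (hz : IsPrimitiveRoot z l) (hfix : ∀ σ : Gal(L/K), σ • z = z → σ = 1)
    (β : 𝓞 K) (hβ : β ≠ 0) (α : 𝓞 L) (n : ℕ) (h : (Ideal.span {β}).map (algebraMap (𝓞 K) (𝓞 L)) = Ideal.span {α} ^ n) :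
    n ∣ vv q (Ideal.span {β}) := by
  have hqm : q.IsMaximal := hqp.isMaximal hqb
  obtain ⟨Q, hQm, hQ⟩ := Ideal.exists_maximal_ideal_liesOver_of_isIntegral (S := 𝓞 L) q
  have hQb : Q ≠ ⊥ := Ideal.ne_bot_of_liesOver_of_ne_bot hqb Q
  have h1 := vv_map q Q hqb hQb (Ideal.span {β}) (span_ne_bot hβ)
  rw [h, vv_pow] at h1
  have hlQ : (l : 𝓞 L) ∉ Q := by
    rw [Ideal.mem_of_liesOver Q q] at hlq
    simpa using hlq
  have hin : Nat.card (Q.inertia Gal(L/K)) = 1 := by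
    have key : ∀ σ ∈ Q.inertia Gal(L/K), σ = 1 := by
      intro σ hσ
      apply hfix
      have h2 : σ • z - z ∈ Q := hσ z
      have hnz : NeZero l := ⟨hl.ne_zero⟩
      obtain ⟨i, -, hi⟩ := hz.eq_pow_of_pow_eq_one (ξ := σ • z) (by rw [← smul_pow', hz.pow_eq_one, smul_one])
      by_contra hne
      have hi0 : i ≠ 0 := by
        rintro rfl
        rw [pow_zero] at hi
        have : z = 1 := by
          have := congrArg (fun x => σ⁻¹ • x) hi
          simpa using this.symm
        exact hz.ne_one hl.one_lt this
      have h4 : z * (z ^ (i - 1) - 1) ∈ Q := by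
        rw [mul_sub, mul_one, ← pow_succ', Nat.sub_add_cancel (by omega), hi]; exact h2
      have hzq : z ∉ Q := by
        intro h
        apply hQm.ne_top
        rw [Ideal.eq_top_iff_one, ← hz.pow_eq_one]
        exact Q.pow_mem_of_mem h _ hl.pos
      have h5 := (hQm.isPrime.mem_or_mem h4).resolve_left hzq
      have h6 : z ^ (i - 1) ≠ 1 := by
        intro h
        apply hne
        rw [← hi, ← Nat.sub_add_cancel (show 1 ≤ i by omega), pow_succ, h, one_mul]
      exact hlQ (r_mem_of Q _ (by rw [← pow_mul, mul_comm, pow_mul, hz.pow_eq_one, one_pow]) h6 h5)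
    rw [Nat.card_eq_one_iff_unique]
    refine ⟨⟨fun a b => ?_⟩, ⟨1⟩⟩
    apply Subtype.ext
    rw [key _ a.2, key _ b.2]
  rw [ram_card q Q] at hin
  rw [hin, one_mul] at h1
  exact ⟨_, h1.symm⟩

theorem pi_pow {A : Type*} [CommRing A] [IsDomain A] {l : ℕ} (hl : l.Prime) (z : A) (hz : IsPrimitiveRoot z l) :
    Ideal.span {(l : A)} = Ideal.span {z - 1} ^ (l - 1) := by
  obtain ⟨m, rfl⟩ : ∃ m, l = m + 1 := ⟨l - 1, (Nat.sub_add_cancel hl.one_le).symm⟩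
  have h := hz.prod_one_sub_pow_eq_order
  rw [Nat.cast_add, Nat.cast_one, ← h, ← Ideal.prod_span_singleton, Nat.add_sub_cancel]
  rw [Finset.prod_congr rfl (g := fun _ => Ideal.span {z - 1}), Finset.prod_const, Finset.card_range]
  intro i hi
  rw [Ideal.span_singleton_eq_span_singleton, ← neg_sub (z ^ (i + 1)) 1]
  refine (Associated.neg_left (hz.associated_sub_one_pow_sub_one_of_coprime ?_).symm)
  rw [Nat.coprime_comm, hl.coprime_iff_not_dvd]
  intro hd
  have := Nat.le_of_dvd (by omega) hd
  have := Finset.mem_range.1 hi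
  omega

theorem at_l (q : Ideal (𝓞 K)) [hqp : q.IsPrime] (hqb : q ≠ ⊥) {l r : ℕ} [NeZero r] (hl : l.Prime) (hlq : vv q (Ideal.span {(l : 𝓞 K)}) = 1) (hlq' : (l : 𝓞 K) ∈ q)
    (z : 𝓞 L) (hz : IsPrimitiveRoot z l) (hcard : Nat.card Gal(L/K) = l - 1) (τ : Gal(L/K)) (g : ℕ) (hτ : τ • z = z ^ g)
    (β : 𝓞 K) (hβ : β ≠ 0) (α : 𝓞 L) (hα : α ≠ 0) (h : (Ideal.span {β}).map (algebraMap (𝓞 K) (𝓞 L)) = Ideal.span {α} ^ (l - 1))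
    (ζ : 𝓞 K) (hε : (∏ u : (ZMod r)ˣ, (z - algebraMap (𝓞 K) (𝓞 L) (ζ ^ (u : ZMod r).val)) ^ nn u) * τ • α = α) :
    eta r ζ * (g : 𝓞 K) ^ vv q (Ideal.span {β}) - 1 ∈ q := by
  have hqm : q.IsMaximal := hqp.isMaximal hqb
  obtain ⟨Q, hQm, hQ⟩ := Ideal.exists_maximal_ideal_liesOver_of_isIntegral (S := 𝓞 L) q
  have hQb : Q ≠ ⊥ := Ideal.ne_bot_of_liesOver_of_ne_bot hqb Q
  have hlpos : 0 < l - 1 := by have := hl.two_le; omega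
  have hl0 : (l : 𝓞 K) ≠ 0 := by exact_mod_cast hl.ne_zero
  have hπ : z - 1 ≠ 0 := sub_ne_zero.2 (hz.ne_one hl.one_lt)
  have hzQ : z - 1 ∈ Q := by
    have h0 : (l : 𝓞 L) ∈ Q := by
      rw [Ideal.mem_of_liesOver Q q] at hlq'
      simpa using hlq'
    have h1 := (Ideal.span_singleton_le_iff_mem _).2 h0
    rw [pi_pow hl z hz] at h1
    exact (Ideal.span_singleton_le_iff_mem _).1 (hQm.isPrime.le_of_pow_le h1)
  have h1 := vv_map q Q hqb hQb (Ideal.span {(l : 𝓞 K)}) (span_ne_bot hl0)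
  rw [Ideal.map_span, Set.image_singleton, map_natCast, pi_pow hl z hz, vv_pow, hlq, mul_one] at h1
  have hvp := vv_pos Q (span_ne_bot hπ) ((Ideal.span_singleton_le_iff_mem _).2 hzQ)
  have hin := ram_card q Q
  have hle : Nat.card (Q.inertia Gal(L/K)) ≤ l - 1 := by
    rw [← hcard]; exact Subgroup.card_le_card_group _
  have hv1 : vv Q (Ideal.span {z - 1}) = 1 := by
    rw [hin, ← h1] at hle
    have : vv Q (Ideal.span {z - 1}) ≤ 1 := by
      by_contra hc
      have := Nat.mul_le_mul_left (l - 1) (not_le.1 hc)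
      omega
    omega
  have he : Q.ramificationIdx (𝓞 K) = l - 1 := by rw [← h1, hv1, mul_one]
  have htop : Q.inertia Gal(L/K) = ⊤ := by
    apply Subgroup.eq_top_of_card_eq
    rw [hin, he, hcard]
  have hτQ : ∀ x : 𝓞 L, τ • x - x ∈ Q := by
    have : τ ∈ Q.inertia Gal(L/K) := by rw [htop]; trivial
    exact this
  have h2 := vv_map q Q hqb hQb (Ideal.span {β}) (span_ne_bot hβ)
  rw [h, vv_pow, he] at h2
  have h3 := Nat.eq_of_mul_eq_mul_left hlpos h2
  obtain ⟨s, w, hs, hw, hsw⟩ := local_factor Q hQb hα hπ hv1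
  rw [h3] at hsw
  generalize vv q (Ideal.span {β}) = k at hsw
  have hτπ : τ • (z - 1) = (z - 1) * ∑ i ∈ Finset.range g, z ^ i := by
    rw [smul_sub, smul_one, hτ, mul_geom_sum]
  set c := ∑ i ∈ Finset.range g, z ^ i with hc
  set ε := (∏ u : (ZMod r)ˣ, (z - algebraMap (𝓞 K) (𝓞 L) (ζ ^ (u : ZMod r).val)) ^ nn u) with hεd
  have h4 : τ • α * τ • s = (z - 1) ^ k * (c ^ k * τ • w) := by
    rw [← smul_mul', hsw, smul_mul', smul_pow', hτπ, mul_pow, mul_assoc]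
  have h5 : ε * c ^ k * τ • w * s = w * τ • s := by
    apply mul_left_cancel₀ (pow_ne_zero k hπ)
    calc (z - 1) ^ k * (ε * c ^ k * τ • w * s) = ε * s * ((z - 1) ^ k * (c ^ k * τ • w)) := by ring
      _ = (ε * τ • α) * s * τ • s := by rw [← h4]; ring
      _ = (z - 1) ^ k * (w * τ • s) := by rw [hε, hsw]; ring
  have hq1 : Ideal.Quotient.mk Q z = 1 := by
    rw [← map_one (Ideal.Quotient.mk Q), Ideal.Quotient.eq]; exact hzQ
  have hqτ : ∀ x, Ideal.Quotient.mk Q (τ • x) = Ideal.Quotient.mk Q x := fun x => Ideal.Quotient.eq.2 (hτQ x)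
  have hcq : Ideal.Quotient.mk Q c = g := by
    rw [hc, map_sum]
    simp [hq1]
  have hεq : Ideal.Quotient.mk Q ε = Ideal.Quotient.mk Q (algebraMap (𝓞 K) (𝓞 L) (eta r ζ)) := by
    rw [hεd, eta, map_prod, map_prod, map_prod]
    refine Finset.prod_congr rfl fun u _ => ?_
    simp only [map_pow, map_sub, map_one, hq1]
  have h6 := congrArg (Ideal.Quotient.mk Q) h5
  rw [map_mul, map_mul, map_mul, map_mul, map_pow, hqτ, hqτ, hcq, hεq] at h6
  have hs' : Ideal.Quotient.mk Q s ≠ 0 := by rwa [Ne, Ideal.Quotient.eq_zero_iff_mem]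
  have hw' : Ideal.Quotient.mk Q w ≠ 0 := by rwa [Ne, Ideal.Quotient.eq_zero_iff_mem]
  have h7 : Ideal.Quotient.mk Q (algebraMap (𝓞 K) (𝓞 L) (eta r ζ)) * g ^ k = 1 := by
    apply mul_right_cancel₀ (mul_ne_zero hw' hs')
    rw [one_mul, ← mul_assoc, h6]
  rw [Ideal.mem_of_liesOver Q q, ← Ideal.Quotient.eq_zero_iff_mem, map_sub, map_sub, map_mul, map_mul, map_pow, map_pow, map_natCast, map_natCast, h7, map_one, map_one, sub_self]
end Local
end ModE4
end OmegaSq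


namespace OmegaSq
section ModE5
open NumberField IsDedekindDomain Filter Topology
open scoped nonZeroDivisors
section Thaine
open scoped Pointwise

theorem absNorm_smul' {K : Type*} [Field K] [NumberField K] (σ : Gal(K/ℚ)) (P : Ideal (𝓞 K)) : Ideal.absNorm (σ • P) = Ideal.absNorm P := by
  rw [Ideal.absNorm_apply, Ideal.absNorm_apply]
  exact (Nat.card_congr (Ideal.quotientEquiv P (σ • P) (MulSemiringAction.toRingEquiv Gal(K/ℚ) (𝓞 K) σ) rfl).toEquiv).symm

theorem resid {F : Type*} [CommRing F] {r : ℕ} [hr : Fact r.Prime] (m : ℕ) (a : (ZMod r)ˣ → F) (ha : ∀ u, a u ^ (m * r) = 1) (t : (ZMod r)ˣ) :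
    (∏ u, a (t * u) ^ nn u) ^ m = ((∏ u, a u ^ nn u) ^ m) ^ ((t : ZMod r) ^ 2).val := by
  rw [Fintype.prod_equiv (Equiv.mulLeft t) (fun u => a (t * u) ^ nn u) (fun v => a v ^ nn (t⁻¹ * v)) (fun u => by simp)]
  rw [← Finset.prod_pow, ← Finset.prod_pow, ← Finset.prod_pow]
  refine Finset.prod_congr rfl fun v _ => ?_
  rw [← pow_mul, ← pow_mul, ← pow_mul, mul_comm _ m, show nn v * (m * ((t : ZMod r) ^ 2).val) = m * (nn v * ((t : ZMod r) ^ 2).val) by ring, pow_mul, pow_mul (a v) m]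
  apply pow_eq_of_cast (r := r)
  · rw [← pow_mul, ha]
  · push_cast
    rw [nn_cast, nn_cast, ZMod.natCast_zmod_val]
    simp only [mul_inv_rev, inv_inv, Units.val_mul]
    ring

theorem smul_eta {K : Type*} [Field K] [NumberField K] {r : ℕ} [hr : Fact r.Prime] (ζ : 𝓞 K) (hζ : ζ ^ r = 1) (σ : Gal(K/ℚ)) (t : (ZMod r)ˣ) (h : σ • ζ = ζ ^ (t : ZMod r).val) :
    σ • eta r ζ = ∏ u : (ZMod r)ˣ, (1 - ζ ^ ((t * u : (ZMod r)ˣ) : ZMod r).val) ^ nn u := by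
  rw [eta, Finset.smul_prod']
  refine Finset.prod_congr rfl fun u _ => ?_
  rw [smul_pow', smul_sub, smul_one, smul_pow', h, ← pow_mul]
  congr 2
  apply pow_eq_of_cast _ hζ
  push_cast
  rw [ZMod.natCast_zmod_val, ZMod.natCast_zmod_val, ZMod.natCast_zmod_val]

/-- the exponents at the various primes above `l` -/
theorem expo {K : Type*} [Field K] [NumberField K] {r l : ℕ} [hr : Fact r.Prime] [hl : Fact l.Prime] (hlr : l ≠ r)
    (ζ : 𝓞 K) (hζ : IsPrimitiveRoot ζ r) (σ : (ZMod r)ˣ ≃* Gal(K/ℚ)) (hσ : ∀ s : (ZMod r)ˣ, σ s • ζ = ζ ^ (s : ZMod r).val)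
    (P : Ideal (𝓞 K)) [hP : P.IsPrime] (hPl : Ideal.absNorm P = l) (g : ℕ) (hgl : ¬ l ∣ g) (hg : ∀ k : ℕ, l ∣ g ^ k - 1 → l - 1 ∣ k)
    (k : (ZMod r)ˣ → ℕ) (hk : ∀ s, eta r ζ * (g : 𝓞 K) ^ k s - 1 ∈ σ s • P) (s : (ZMod r)ˣ) :
    (k s : ZMod r) * (s : ZMod r) ^ 2 = k 1 := by
  obtain ⟨m, hm⟩ := deg1_dvd P hr.out hlr hPl ζ hζ
  have hlP := deg1_l_mem P hPl
  have hrP := deg1_r_notMem P hl.out hr.out hlr hlP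
  have hm0 : m ≠ 0 := by
    rintro rfl
    have := hl.out.two_le
    omega
  have hg1 : 1 ≤ g := Nat.pos_of_ne_zero (by rintro rfl; simp at hgl)
  set φ := Ideal.Quotient.mk P with hφ
  have hcard : Nat.card (𝓞 K ⧸ P) = l := by rw [← hPl, Ideal.absNorm_apply]; rfl
  -- Fermat
  have hfer : ∀ x : 𝓞 K, x ∉ P → φ x ^ (l - 1) = 1 := by
    intro x hx
    obtain ⟨a, ha⟩ := deg1_int P hPl x
    have e : φ x = a := by rw [← map_natCast φ]; exact Ideal.Quotient.eq.2 ha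
    have hal : ¬ l ∣ a := by
      rintro ⟨b, rfl⟩
      apply hx
      rw [← Ideal.Quotient.eq_zero_iff_mem, ← hφ, e, ← map_natCast φ, hφ, Ideal.Quotient.eq_zero_iff_mem, Nat.cast_mul]
      exact P.mul_mem_right _ hlP
    have h1 : (a : ZMod l) ^ (l - 1) = 1 := ZMod.pow_card_sub_one_eq_one (by rwa [Ne, ZMod.natCast_eq_zero_iff])
    have h2 : (l : ℤ) ∣ (a : ℤ) ^ (l - 1) - 1 := by
      rw [← ZMod.intCast_zmod_eq_zero_iff_dvd]
      push_cast
      rw [h1, sub_self]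
    obtain ⟨b, hb⟩ := h2
    have h3 : (a : 𝓞 K) ^ (l - 1) - 1 = l * b := by exact_mod_cast congrArg (fun z : ℤ => (z : 𝓞 K)) hb
    rw [e, ← map_natCast φ, ← map_pow, ← map_one φ]
    apply Ideal.Quotient.eq.2
    rw [h3]
    exact P.mul_mem_right _ hlP
  have hdvd : ∀ a : ℤ, φ (a : 𝓞 K) = 0 → (l : ℤ) ∣ a := by
    intro a ha
    by_contra hc
    have hcop : IsCoprime (l : ℤ) a := (Nat.prime_iff_prime_int.1 hl.out).coprime_iff_not_dvd.2 hc
    obtain ⟨u, v, huv⟩ := hcop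
    rw [Ideal.Quotient.eq_zero_iff_mem] at ha
    apply hP.ne_top
    rw [Ideal.eq_top_iff_one]
    have e : (1 : 𝓞 K) = (u : 𝓞 K) * l + v * a := by exact_mod_cast huv.symm
    rw [e]
    exact P.add_mem (P.mul_mem_left _ hlP) (P.mul_mem_left _ ha)
  have hprim : ∀ j, φ (g : 𝓞 K) ^ j = 1 → l - 1 ∣ j := by
    intro j hj
    apply hg
    have h1 : 1 ≤ g ^ j := Nat.one_le_pow _ _ hg1
    have := hdvd ((g ^ j - 1 : ℕ) : ℤ) (by
      rw [Int.cast_natCast, Nat.cast_sub h1, map_sub, Nat.cast_pow, map_pow, hj, Nat.cast_one, map_one, sub_self])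
    exact_mod_cast this
  have hgP : (g : 𝓞 K) ∉ P := by
    intro h
    have h1 : φ (g : 𝓞 K) = 0 := Ideal.Quotient.eq_zero_iff_mem.2 h
    have h2 := hdvd (g : ℤ) (by simpa using h1)
    exact hgl (by exact_mod_cast h2)
  have hγ : IsPrimitiveRoot (φ (g : 𝓞 K) ^ m) r := by
    refine ⟨?_, ?_⟩
    · rw [← pow_mul, mul_comm, ← hm]
      exact hfer _ hgP
    · intro j hj
      rw [← pow_mul] at hj
      have := hprim _ hj
      rw [hm, mul_comm] at this
      exact Nat.dvd_of_mul_dvd_mul_left (Nat.pos_of_ne_zero hm0) this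
  have haP : ∀ u : (ZMod r)ˣ, 1 - ζ ^ (u : ZMod r).val ∉ P := by
    intro u h
    refine hrP (r_mem_of P (ζ ^ (u : ZMod r).val) (by rw [← pow_mul, mul_comm, pow_mul, hζ.pow_eq_one, one_pow]) ?_ (by rw [← neg_sub]; exact P.neg_mem h))
    intro h
    rw [hζ.pow_eq_one_iff_dvd] at h
    have h0 : (u : ZMod r).val ≠ 0 := by rw [ZMod.val_ne_zero]; exact u.ne_zero
    exact absurd (Nat.le_of_dvd (Nat.pos_of_ne_zero h0) h) (not_le.2 (ZMod.val_lt _))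
  set H := φ (eta r ζ) ^ m with hH
  have key : ∀ s : (ZMod r)ˣ, H ^ (((s⁻¹ : (ZMod r)ˣ) : ZMod r) ^ 2).val * (φ (g : 𝓞 K) ^ m) ^ k s = 1 := by
    intro s
    have h1 := (Ideal.smul_mem_pointwise_smul_iff (a := (σ s)⁻¹)).2 (hk s)
    rw [inv_smul_smul, ← map_inv, smul_sub, smul_one, smul_mul', smul_pow', smul_eta ζ hζ.pow_eq_one _ s⁻¹ (hσ s⁻¹)] at h1
    have h2 : σ s⁻¹ • (g : 𝓞 K) = g := map_natCast (MulSemiringAction.toRingHom Gal(K/ℚ) (𝓞 K) (σ s⁻¹)) g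
    rw [h2] at h1
    have h3 := Ideal.Quotient.eq.2 h1
    rw [← hφ, map_mul, map_one, map_prod] at h3
    have h4 := resid m (fun u : (ZMod r)ˣ => φ (1 - ζ ^ (u : ZMod r).val)) (fun u => by
      rw [mul_comm, ← hm]; exact hfer _ (haP u)) s⁻¹
    have h5 : (∏ u : (ZMod r)ˣ, φ (1 - ζ ^ (u : ZMod r).val) ^ nn u) = φ (eta r ζ) := by
      rw [eta, map_prod]
      simp only [map_pow]
    rw [h5, ← hH] at h4
    rw [← h4, pow_right_comm, ← mul_pow]
    simp only [map_pow] at h3 ⊢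
    rw [h3, one_pow]
  have k1 := key 1
  have hone : (((1⁻¹ : (ZMod r)ˣ) : ZMod r) ^ 2).val = 1 := by
    have : Fact (1 < r) := ⟨hr.out.one_lt⟩
    rw [inv_one, Units.val_one, one_pow, ZMod.val_one]
  rw [hone, pow_one] at k1
  set n := (((s⁻¹ : (ZMod r)ˣ) : ZMod r) ^ 2).val with hn
  have e1 := congrArg (fun x => x ^ n) k1
  simp only [mul_pow, one_pow, ← pow_mul _ (k 1)] at e1
  have e2 := key s
  rw [← hn] at e2
  have hH0 : H ^ n ≠ 0 := by
    intro h
    rw [h, zero_mul] at e2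
    exact zero_ne_one e2
  have e3 := mul_left_cancel₀ hH0 (e2.trans e1.symm)
  have e4 : k s % r = (k 1 * n) % r := hγ.pow_inj (Nat.mod_lt _ hr.out.pos) (Nat.mod_lt _ hr.out.pos) (by
    rw [← pow_eq_pow_mod _ hγ.pow_eq_one, ← pow_eq_pow_mod _ hγ.pow_eq_one]; exact e3)
  rw [← ZMod.natCast_eq_natCast_iff', Nat.cast_mul, hn, ZMod.natCast_zmod_val] at e4
  rw [e4, mul_assoc, ← mul_pow, ← Units.val_mul, inv_mul_cancel, Units.val_one, one_pow, mul_one]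
end Thaine
end ModE5
end OmegaSq


namespace OmegaSq
section ModE6
open NumberField IsDedekindDomain Filter Topology
open scoped nonZeroDivisors
section Thaine2
open scoped Pointwise Classical
open UniqueFactorizationMonoid

theorem X_prod {A : Type*} [CommRing A] [IsDedekindDomain A] (X : Ideal A →*₀ ℂ) (I : Ideal A) (hI : I ≠ ⊥) (S : Finset (Ideal A))
    (hS : ∀ q : Ideal A, q.IsPrime → q ≠ ⊥ → q ∉ S → X q ^ vv q I = 1) : X I = ∏ q ∈ S, X q ^ vv q I := by
  have h1 : X I = ∏ q ∈ (normalizedFactors I).toFinset, X q ^ vv q I := by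
    conv_lhs => rw [← Ideal.prod_normalizedFactors_eq_self hI]
    rw [map_multiset_prod, Finset.prod_multiset_map_count]
    rfl
  rw [h1, Finset.prod_subset (Finset.subset_union_left (s₂ := S)), ← Finset.prod_subset (Finset.subset_union_right (s₁ := (normalizedFactors I).toFinset))]
  · intro q hq hqS
    have hq' := (Finset.mem_union.1 hq).resolve_right hqS
    rw [Multiset.mem_toFinset] at hq'
    have := prime_of_normalized_factor q hq'
    exact hS q (Ideal.isPrime_of_prime this) this.ne_zero hqS
  · intro q _ hq
    rw [Multiset.mem_toFinset] at hq
    rw [vv, Multiset.count_eq_zero.2 hq, pow_zero]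

theorem thaine {K : Type} [Field K] [NumberField K] {r l : ℕ} [hr : Fact r.Prime] [hl : Fact l.Prime] (hr5 : 5 ≤ r) (hlr : l ≠ r) [IsCyclotomicExtension {r} ℚ K]
    (ζ : 𝓞 K) (hζ : IsPrimitiveRoot ζ r) (σ : (ZMod r)ˣ ≃* Gal(K/ℚ)) (hσ : ∀ s : (ZMod r)ˣ, σ s • ζ = ζ ^ (s : ZMod r).val)
    (X : Ideal (𝓞 K) →*₀ ℂ) (hXr : ∀ I : Ideal (𝓞 K), I ≠ ⊥ → X I ^ r = 1) (hXp : ∀ x : 𝓞 K, x ≠ 0 → X (Ideal.span {x}) = 1)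
    (hXσ : ∀ (s : (ZMod r)ˣ) (I : Ideal (𝓞 K)), I ≠ ⊥ → X (σ s • I) = X I ^ ((s : ZMod r) ^ 2).val)
    (P : Ideal (𝓞 K)) [hP : P.IsPrime] (hPl : Ideal.absNorm P = l) : X P = 1 ∨ ∃ y, eta r ζ - y ^ r ∈ P := by
  have hnl : NeZero l := ⟨hl.out.ne_zero⟩
  have hnr : NeZero r := ⟨hr.out.ne_zero⟩
  have hd := deg1_dvd P hr.out hlr hPl ζ hζ
  have hl2 : 2 < l := by
    have := Nat.le_of_dvd (by have := hl.out.two_le; omega) hd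
    omega
  have hlP := deg1_l_mem P hPl
  have hPb : P ≠ ⊥ := by
    rintro rfl
    rw [Ideal.absNorm_bot] at hPl
    exact hl.out.ne_zero hPl.symm
  have hgalK : IsGalois ℚ K := IsCyclotomicExtension.isGalois {r} ℚ K
  have hirr : Irreducible (Polynomial.cyclotomic l K) := cyc_irr hlr
  let L := CyclotomicField l K
  have hLn : NumberField L := IsCyclotomicExtension.numberField {l} K L
  have hgalL : IsGalois K L := IsCyclotomicExtension.isGalois {l} K L
  obtain ⟨g, τ, z, hz, hτz, hτ, hfix, hg, hgl⟩ := exists_tau (K := K) (L := L) hirr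
  obtain ⟨α, hα0, hα⟩ := exists_alpha hirr hl2 hd ζ hζ z hz τ hτ
  obtain ⟨β, hβ0, hβ⟩ := exists_beta τ hτ α _ hα0 hα
  have hcard : Nat.card Gal(L/K) = l - 1 := by
    rw [Nat.card_congr (IsCyclotomicExtension.autEquivPow L hirr).toEquiv, Nat.card_eq_fintype_card, ZMod.card_units]
  rw [hcard] at hβ
  have hinjζ : ∀ s t : (ZMod r)ˣ, σ s • ζ = σ t • ζ → s = t := by
    intro s t h
    rw [hσ, hσ] at h
    exact Units.ext (ZMod.val_injective _ (hζ.pow_inj (ZMod.val_lt _) (ZMod.val_lt _) h))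
  have hgen : ∀ ρ : Gal(K/ℚ), ρ • ζ = ζ → ρ = 1 := by
    intro ρ hρ
    obtain ⟨s, rfl⟩ := σ.surjective ρ
    rw [hinjζ s 1 (by rw [map_one, one_smul]; exact hρ), map_one]
  have hPs : ∀ s, (σ s • P).IsPrime := fun s => inferInstance
  have hPsl : ∀ s, Ideal.absNorm (σ s • P) = l := fun s => by rw [absNorm_smul', hPl]
  have hbot : ∀ q : Ideal (𝓞 K), Ideal.absNorm q = l → q ≠ ⊥ := by
    rintro q hq rfl
    rw [Ideal.absNorm_bot] at hq
    exact hl.out.ne_zero hq.symm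
  set k : (ZMod r)ˣ → ℕ := fun s => vv (σ s • P) (Ideal.span {β}) with hk
  have hkq : ∀ s, eta r ζ * (g : 𝓞 K) ^ k s - 1 ∈ σ s • P := by
    intro s
    have := hPs s
    exact at_l (σ s • P) (hbot _ (hPsl s)) hl.out (deg1_vv (σ s • P) hr.out hlr (hPsl s) ζ hζ hgen) (deg1_l_mem _ (hPsl s)) z hz hcard τ g hτz β hβ0 α hα0 hβ ζ hα
  have hexp := expo hlr ζ hζ σ hσ P hPl g hgl hg k hkq
  have hinj : Function.Injective (fun s => σ s • P) := by
    intro s t hst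
    simp only at hst
    have h1 : σ (t⁻¹ * s) • P = P := by
      rw [map_mul, mul_smul, hst, map_inv, inv_smul_smul]
    have h2 := hgen _ (deg1_stab P hr.out hlr hPl ζ hζ _ h1)
    rw [← map_one σ] at h2
    have h3 := σ.injective h2
    exact (inv_mul_eq_one.1 h3).symm
  have hprod := X_prod X (Ideal.span {β}) (span_ne_bot hβ0) (Finset.univ.image (fun s => σ s • P)) (by
    intro q hq hqb hqS
    have hlq : (l : 𝓞 K) ∉ q := by
      intro hlq
      have hlI : (Ideal.span {(l : ℤ)}).IsPrime := (Ideal.span_singleton_prime (by exact_mod_cast hl.out.ne_zero)).2 (Nat.prime_iff_prime_int.1 hl.out)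
      have hlM : (Ideal.span {(l : ℤ)}).IsMaximal := hlI.isMaximal (span_ne_bot (by exact_mod_cast hl.out.ne_zero))
      have ho : ∀ Q : Ideal (𝓞 K), Q.IsPrime → (l : 𝓞 K) ∈ Q → Q.LiesOver (Ideal.span {(l : ℤ)}) := by
        intro Q hQ hlQ
        constructor
        apply hlM.eq_of_le (Ideal.IsPrime.ne_top inferInstance)
        rw [Ideal.span_singleton_le_iff_mem, Ideal.mem_comap]
        simpa using hlQ
      have o1 := ho P hP hlP
      have o2 := ho q hq hlq
      obtain ⟨ρ, hρ⟩ := Ideal.exists_smul_eq_of_isGaloisGroup (Ideal.span {(l : ℤ)}) P q Gal(K/ℚ)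
      obtain ⟨s, rfl⟩ := σ.surjective ρ
      exact hqS (Finset.mem_image.2 ⟨s, Finset.mem_univ _, hρ⟩)
    obtain ⟨c, hc⟩ := hd.trans (away_dvd q hqb hl.out hlq z hz hfix β hβ0 α (l - 1) hβ)
    rw [hc, pow_mul, hXr q hqb, one_pow])
  rw [hXp β hβ0, Finset.prod_image hinj.injOn] at hprod
  have h1 : ∀ s : (ZMod r)ˣ, X (σ s • P) ^ vv (σ s • P) (Ideal.span {β}) = X P ^ k 1 := by
    intro s
    rw [hXσ s P hPb, ← pow_mul]
    apply pow_eq_of_cast _ (hXr P hPb)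
    rw [Nat.cast_mul, ZMod.natCast_zmod_val, mul_comm]
    exact hexp s
  rw [Finset.prod_congr rfl (fun s _ => h1 s), Finset.prod_const, Finset.card_univ, ZMod.card_units, ← pow_mul] at hprod
  by_cases hX1 : X P = 1
  · exact Or.inl hX1
  right
  have hXord : orderOf (X P) = r := orderOf_eq_prime (hXr P hPb) hX1
  have h2 := orderOf_dvd_of_pow_eq_one hprod.symm
  rw [hXord] at h2
  have h3 : r ∣ k 1 := by
    rcases hr.out.dvd_mul.1 h2 with h | h
    · exact h
    · have := Nat.le_of_dvd (by omega) h
      omega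
  obtain ⟨c, hc⟩ := h3
  have h4 := hkq 1
  rw [map_one, one_smul, hc] at h4
  have hPm : P.IsMaximal := hP.isMaximal hPb
  have hgP : (g : 𝓞 K) ^ c ∉ P := by
    intro h
    apply hP.ne_top
    rw [Ideal.eq_top_iff_one]
    have h5 := P.mul_mem_left (eta r ζ) (P.pow_mem_of_mem h r hr.out.pos)
    rw [← pow_mul, mul_comm c r] at h5
    have := P.sub_mem h5 h4
    rwa [sub_sub_cancel] at this
  obtain ⟨y, hy⟩ := hPm.exists_inv hgP
  obtain ⟨i, hi, hyi⟩ := hy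
  refine ⟨y, ?_⟩
  rw [← Ideal.Quotient.eq_zero_iff_mem]
  rw [← Ideal.Quotient.eq_zero_iff_mem] at h4 hi
  have e1 : Ideal.Quotient.mk P y * Ideal.Quotient.mk P (g : 𝓞 K) ^ c = 1 := by
    rw [← map_pow, ← map_mul, ← map_one (Ideal.Quotient.mk P), ← hyi, map_add, hi, add_zero]
  have e2 : Ideal.Quotient.mk P (eta r ζ) * Ideal.Quotient.mk P (g : 𝓞 K) ^ (r * c) = 1 := by
    rw [map_sub, map_mul, map_pow, map_one, sub_eq_zero] at h4
    exact h4
  rw [map_sub, map_pow, sub_eq_zero]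
  calc Ideal.Quotient.mk P (eta r ζ) = Ideal.Quotient.mk P (eta r ζ) * (Ideal.Quotient.mk P y * Ideal.Quotient.mk P (g : 𝓞 K) ^ c) ^ r := by rw [e1, one_pow, mul_one]
    _ = (Ideal.Quotient.mk P (eta r ζ) * Ideal.Quotient.mk P (g : 𝓞 K) ^ (r * c)) * Ideal.Quotient.mk P y ^ r := by ring
    _ = _ := by rw [e2, one_mul]
end Thaine2
end ModE6
end OmegaSq


namespace OmegaSq
section ModG
open NumberField IsDedekindDomain Filter Topology
open scoped nonZeroDivisors
section Final
open scoped Pointwise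

theorem smul_nz {K : Type*} [Field K] [NumberField K] (g : Gal(K/ℚ)) (I : Ideal (𝓞 K)) (hI : I ≠ ⊥) : g • I ≠ ⊥ := by
  intro h
  apply hI
  have := congrArg (fun J => g⁻¹ • J) h
  simpa using this

theorem exists_act {K : Type*} [Field K] [NumberField K] (g : Gal(K/ℚ)) :
    ∃ a : ClassGroup (𝓞 K) →* ClassGroup (𝓞 K), ∀ I J : (Ideal (𝓞 K))⁰, (J : Ideal (𝓞 K)) = g • (I : Ideal (𝓞 K)) →
      a (ClassGroup.mk0 I) = ClassGroup.mk0 J := by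
  have hne : ∀ I : (Ideal (𝓞 K))⁰, (I : Ideal (𝓞 K)) ≠ ⊥ := fun I => nonZeroDivisors.ne_zero I.2
  let f : (Ideal (𝓞 K))⁰ → (Ideal (𝓞 K))⁰ := fun I => ⟨g • (I : Ideal (𝓞 K)), mem_nonZeroDivisors_of_ne_zero (smul_nz g _ (hne I))⟩
  have hf : ∀ I J, ClassGroup.mk0 I = ClassGroup.mk0 J → ClassGroup.mk0 (f I) = ClassGroup.mk0 (f J) := by
    intro I J h
    obtain ⟨x, y, hx, hy, hxy⟩ := (ClassGroup.mk0_eq_mk0_iff).1 h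
    refine (ClassGroup.mk0_eq_mk0_iff).2 ⟨g • x, g • y, ?_, ?_, ?_⟩
    · exact (smul_ne_zero_iff_ne g).2 hx
    · exact (smul_ne_zero_iff_ne g).2 hy
    · have := congrArg (fun J => g • J) hxy
      simp only [Ideal.pointwise_smul_def, Ideal.map_mul, Ideal.map_span, Set.image_singleton] at this
      exact this
  have hfm : ∀ I J, f (I * J) = f I * f J := by
    intro I J
    apply Subtype.ext
    simp only [f, Submonoid.coe_mul, Ideal.pointwise_smul_def, Ideal.map_mul]
  have hs : ∀ x : ClassGroup (𝓞 K), ClassGroup.mk0 (Function.surjInv ClassGroup.mk0_surjective x) = x := 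
    Function.surjInv_eq ClassGroup.mk0_surjective
  refine ⟨MonoidHom.mk' (fun x => ClassGroup.mk0 (f (Function.surjInv ClassGroup.mk0_surjective x))) ?_, ?_⟩
  · intro x y
    rw [← map_mul, ← hfm]
    apply hf
    rw [map_mul, hs, hs, hs]
  · intro I J hIJ
    have : J = f I := Subtype.ext hIJ
    rw [this]
    exact hf _ _ (hs _)

theorem final {K : Type} [Field K] [NumberField K] {r : ℕ} [hr : Fact r.Prime] (hr5 : 5 ≤ r) [IsCyclotomicExtension {r} ℚ K]
    (ζ : 𝓞 K) (hζ : IsPrimitiveRoot ζ r) (σ : (ZMod r)ˣ ≃* Gal(K/ℚ)) (hσ : ∀ s : (ZMod r)ˣ, σ s • ζ = ζ ^ (s : ZMod r).val)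
    (χ : ClassGroup (𝓞 K) →* ℂˣ) (hχ : χ ≠ 1) (hχr : ∀ x, χ x ^ r = 1)
    (hχσ : ∀ (s : (ZMod r)ˣ) (I J : (Ideal (𝓞 K))⁰), (J : Ideal (𝓞 K)) = σ s • (I : Ideal (𝓞 K)) → 
      χ (ClassGroup.mk0 J) = χ (ClassGroup.mk0 I) ^ ((s : ZMod r) ^ 2).val) : False := by
  have hnr : NeZero r := ⟨hr.out.ne_zero⟩
  have hX : ∀ I : (Ideal (𝓞 K))⁰, Lf χ 0 I = (χ (ClassGroup.mk0 I) : ℂ) := by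
    intro I; rw [Lf_apply]; simp
  have hX' : ∀ (I : Ideal (𝓞 K)) (hI : I ≠ ⊥), Lf χ 0 I = (χ (ClassGroup.mk0 ⟨I, mem_nonZeroDivisors_of_ne_zero hI⟩) : ℂ) :=
    fun I hI => hX ⟨I, mem_nonZeroDivisors_of_ne_zero hI⟩
  have hth : ∀ P : HeightOneSpectrum (𝓞 K), (Ideal.absNorm P.asIdeal).Prime → (r : 𝓞 K) ∉ P.asIdeal → 
      χ (ClassGroup.mk0 (pz P)) = 1 ∨ ∃ y, eta r ζ - y ^ r ∈ P.asIdeal := by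
    intro P hl hrP
    have : Fact (Ideal.absNorm P.asIdeal).Prime := ⟨hl⟩
    have hlr : Ideal.absNorm P.asIdeal ≠ r := by
      intro h
      exact hrP (h ▸ Ideal.absNorm_mem P.asIdeal)
    have hPp : P.asIdeal.IsPrime := P.isPrime
    have := thaine hr5 hlr ζ hζ σ hσ (Lf χ 0) (fun I hI => by
        rw [hX' I hI, ← Units.val_pow_eq_pow_val, hχr, Units.val_one]) (fun x hx => by
        have hsp : Ideal.span {x} ≠ ⊥ := by rwa [Ne, Ideal.span_singleton_eq_bot]
        rw [hX' _ hsp, (ClassGroup.mk0_eq_one_iff _).2 ⟨⟨x, rfl⟩⟩, map_one, Units.val_one]) (fun s I hI => by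
        rw [hX' I hI, hX' _ (smul_nz _ I hI), ← Units.val_pow_eq_pow_val]
        exact congrArg Units.val (hχσ s ⟨I, _⟩ ⟨_, _⟩ rfl)) P.asIdeal rfl
    refine this.imp_left fun h => ?_
    have h2 := hX (pz P)
    exact Units.ext (h2.symm.trans h)
  have hη0 : eta r ζ ≠ 0 := by
    refine Finset.prod_ne_zero_iff.2 fun u _ => pow_ne_zero _ (sub_ne_zero.2 (Ne.symm ?_))
    intro h
    have h1 := (hζ.pow_eq_one_iff_dvd _).1 h
    have h2 : 0 < (u : ZMod r).val := Nat.pos_of_ne_zero (by rw [ZMod.val_ne_zero]; exact u.ne_zero)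
    exact absurd (Nat.le_of_dvd h2 h1) (not_le.2 (ZMod.val_lt _))
  have hηK : ((eta r ζ : 𝓞 K) : K) = eta r (ζ : K) := by
    simp [eta, map_prod]
  have hηp : ∀ x : K, x ^ r ≠ (eta r ζ : 𝓞 K) := by
    intro x hx
    rw [hηK] at hx
    exact eta_not_pow hr5 (ζ : K) (hζ.map_of_injective (FaithfulSMul.algebraMap_injective (𝓞 K) K)) x hx
  have hr0 : (r : 𝓞 K) ≠ 0 := Nat.cast_ne_zero.2 hr.out.ne_zero
  set E0 : Set (HeightOneSpectrum (𝓞 K)) := {P | (r : 𝓞 K) ∈ P.asIdeal ∨ eta r ζ ∈ P.asIdeal} with hE0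
  have hE0f : E0.Finite := by
    have := Ideal.finite_factors (I := Ideal.span {(r : 𝓞 K) * eta r ζ}) (by rw [Ne, Ideal.zero_eq_bot, Ideal.span_singleton_eq_bot]; exact mul_ne_zero hr0 hη0)
    refine this.subset fun P hP => ?_
    simp only [Set.mem_ofPred_eq]
    rw [Ideal.dvd_span_singleton]
    rcases hP with h | h
    · exact Ideal.mul_mem_right _ _ h
    · exact Ideal.mul_mem_left _ _ h
  set D : Set (HeightOneSpectrum (𝓞 K)) := {P | ¬ (Ideal.absNorm P.asIdeal).Prime} with hD
  set T : Set (HeightOneSpectrum (𝓞 K)) := {P | eta r ζ ∉ P.asIdeal ∧ (r : 𝓞 K) ∉ P.asIdeal ∧ ∃ y, eta r ζ - y ^ r ∈ P.asIdeal} with hT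
  obtain ⟨C1, h1⟩ := L_bounds K
  obtain ⟨C2, δ2, hδ2, -, h2⟩ := prime_sum_log K
  obtain ⟨C3, h3⟩ := nondeg_bounded K
  obtain ⟨C4, δ4, hδ4, -, h4⟩ := L_bounded χ hχ
  obtain ⟨C5, δ5, hδ5, -, h5⟩ := kummer_bound K hr.out ζ hζ (eta r ζ) hηp
  have key : ∀ s, 1 < s → s < 1 + δ2 → s < 1 + δ4 → s < 1 + δ5 → s < 2 →
      (3/5) * Real.log (1 / (s - 1)) ≤ Real.log (max C4 1) + C1 + C2 + 2 * |C5| + 2 * C3 + 2 * hE0f.toFinset.card := by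
    intro s hs hs2 hs4 hs5 hs22
    obtain ⟨hpos, hL⟩ := h1 χ s hs
    have hLb : Real.log ‖∑' I, Lf χ s I‖ ≤ Real.log (max C4 1) := Real.log_le_log hpos ((h4 s hs hs4).trans (le_max_left _ _))
    set a : HeightOneSpectrum (𝓞 K) → ℝ := fun P => (Ideal.absNorm P.asIdeal : ℝ) ^ (-s) with ha
    have ha0 : ∀ P, 0 ≤ a P := fun P => by positivity
    have ha1 : ∀ P, a P ≤ 1 := fun P => Real.rpow_le_one_of_one_le_of_nonpos (by linarith [two_le_norm P]) (by linarith)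
    have hsa : Summable a := summable_primes s hs
    have hre : ∀ P : HeightOneSpectrum (𝓞 K), -1 ≤ (χ (ClassGroup.mk0 (pz P)) : ℂ).re ∧ (χ (ClassGroup.mk0 (pz P)) : ℂ).re ≤ 1 := by
      intro P
      have := Complex.abs_re_le_norm (χ (ClassGroup.mk0 (pz P)) : ℂ)
      rw [norm_chi] at this
      exact abs_le.1 this
    have hsc : Summable (fun P => (χ (ClassGroup.mk0 (pz P)) : ℂ).re * a P) := by
      refine Summable.of_norm_bounded hsa fun P => ?_
      rw [Real.norm_eq_abs, abs_mul, abs_of_nonneg (ha0 P)]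
      exact mul_le_of_le_one_left (ha0 P) (abs_le.2 (hre P))
    have hsT : Summable (T.indicator a) := hsa.indicator T
    have hsD : Summable (D.indicator a) := hsa.indicator D
    have hsE : Summable (E0.indicator a) := hsa.indicator E0
    have hpt : ∀ P, a P ≤ (χ (ClassGroup.mk0 (pz P)) : ℂ).re * a P + 2 * T.indicator a P + 2 * D.indicator a P + 2 * E0.indicator a P := by
      intro P
      have n1 : 0 ≤ T.indicator a P := Set.indicator_nonneg (fun P _ => ha0 P) P
      have n2 : 0 ≤ D.indicator a P := Set.indicator_nonneg (fun P _ => ha0 P) P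
      have n3 : 0 ≤ E0.indicator a P := Set.indicator_nonneg (fun P _ => ha0 P) P
      have n4 : - a P ≤ (χ (ClassGroup.mk0 (pz P)) : ℂ).re * a P := by nlinarith [(hre P).1, ha0 P]
      by_cases hE : P ∈ E0
      · rw [Set.indicator_of_mem hE] at *; linarith
      by_cases hDm : P ∈ D
      · rw [Set.indicator_of_mem hDm] at *; linarith
      by_cases hTm : P ∈ T
      · rw [Set.indicator_of_mem hTm] at *; linarith
      have hE' : (r : 𝓞 K) ∉ P.asIdeal ∧ eta r ζ ∉ P.asIdeal := not_or.1 hE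
      rcases hth P (not_not.1 hDm) hE'.1 with h | h
      · rw [h, Units.val_one, Complex.one_re, one_mul]; linarith
      · exact absurd ⟨hE'.2, hE'.1, h⟩ hTm
    have hle := Summable.tsum_le_tsum hpt hsa (((hsc.add (hsT.mul_left 2)).add (hsD.mul_left 2)).add (hsE.mul_left 2))
    rw [((hsc.add (hsT.mul_left 2)).add (hsD.mul_left 2)).tsum_add (hsE.mul_left 2), (hsc.add (hsT.mul_left 2)).tsum_add (hsD.mul_left 2),
      hsc.tsum_add (hsT.mul_left 2), tsum_mul_left, tsum_mul_left, tsum_mul_left] at hle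
    have b1 := abs_le.1 hL
    have b2 := abs_le.1 (h2 s hs hs2)
    have b3 := h3 s hs D (fun P hP => hP)
    have b5 := h5 s hs hs5 T (fun P hP => hP)
    have b6 : ∑' P, E0.indicator a P ≤ hE0f.toFinset.card := by
      rw [tsum_eq_sum (s := hE0f.toFinset) (fun P hP => Set.indicator_of_notMem (fun h => hP (hE0f.mem_toFinset.2 h)) a)]
      calc _ ≤ ∑ P ∈ hE0f.toFinset, (1 : ℝ) := Finset.sum_le_sum fun P hP => by
            rw [Set.indicator_of_mem (hE0f.mem_toFinset.1 hP)]; exact ha1 P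
        _ = _ := by simp
    have hT0 : 0 ≤ ∑' P, T.indicator a P := tsum_nonneg fun P => Set.indicator_nonneg (fun P _ => ha0 P) P
    have hr5' : (5 : ℝ) ≤ r := by exact_mod_cast hr5
    have b7 : 5 * ∑' P, T.indicator a P ≤ Real.log (1 / (s - 1)) + |C5| :=
      (mul_le_mul_of_nonneg_right hr5' hT0).trans (b5.trans (by linarith [le_abs_self C5]))
    have hC5 := abs_nonneg C5
    linarith [b1.1, b1.2, b2.1, b2.2]
  set B := Real.log (max C4 1) + C1 + C2 + 2 * |C5| + 2 * C3 + 2 * hE0f.toFinset.card with hB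
  obtain ⟨ε, hε0, hε2, hε4, hε5, hε1, hεB⟩ : ∃ ε : ℝ, 0 < ε ∧ ε < δ2 ∧ ε < δ4 ∧ ε < δ5 ∧ ε < 1 ∧ ε ≤ Real.exp (-(5/3 * (B + 1))) := by
    have hp := Real.exp_pos (-(5/3 * (B + 1)))
    refine ⟨min (min (δ2/2) (δ4/2)) (min (δ5/2) (min (1/2) (Real.exp (-(5/3 * (B + 1)))))), ?_, ?_, ?_, ?_, ?_, ?_⟩
    · simp only [lt_min_iff]; exact ⟨⟨by linarith, by linarith⟩, by linarith, by norm_num, hp⟩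
    · exact ((min_le_left _ _).trans (min_le_left _ _)).trans_lt (by linarith)
    · exact ((min_le_left _ _).trans (min_le_right _ _)).trans_lt (by linarith)
    · exact ((min_le_right _ _).trans (min_le_left _ _)).trans_lt (by linarith)
    · exact ((min_le_right _ _).trans ((min_le_right _ _).trans (min_le_left _ _))).trans_lt (by norm_num)
    · exact (min_le_right _ _).trans ((min_le_right _ _).trans (min_le_right _ _))
  have hk := key (1 + ε) (by linarith) (by linarith) (by linarith) (by linarith) (by linarith)
  have hl : Real.log ε ≤ -(5/3 * (B + 1)) := by
    have := Real.log_le_log hε0 hεB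
    rwa [Real.log_exp] at this
  rw [add_sub_cancel_left, one_div, Real.log_inv] at hk
  linarith

theorem main {K : Type} [Field K] [NumberField K] {r : ℕ} [hr : Fact r.Prime] (hr5 : 5 ≤ r) [IsCyclotomicExtension {r} ℚ K]
    (c : ClassGroup (𝓞 K)) (hcr : c ^ r = 1)
    (heig : ∀ (σ : 𝓞 K ≃+* 𝓞 K) (s : ℕ) (ζ : 𝓞 K), IsPrimitiveRoot ζ r → σ ζ = ζ ^ s →
      ∀ J J' : (Ideal (𝓞 K))⁰, (J' : Ideal (𝓞 K)) = Ideal.map (σ : 𝓞 K →+* 𝓞 K) (J : Ideal (𝓞 K)) →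
      ClassGroup.mk0 J = c → ClassGroup.mk0 J' = c ^ (s ^ 2)) : c = 1 := by
  by_contra hc
  have hnr : NeZero r := ⟨hr.out.ne_zero⟩
  have hz := IsCyclotomicExtension.zeta_spec r ℚ K
  let e := IsCyclotomicExtension.autEquivPow K (Polynomial.cyclotomic.irreducible_rat hr.out.pos)
  have hσ : ∀ s : (ZMod r)ˣ, e.symm s • hz.toInteger = hz.toInteger ^ (s : ZMod r).val := by
    intro s
    apply RingOfIntegers.ext
    have h1 : (e.symm s) (IsCyclotomicExtension.zeta r ℚ K) = IsCyclotomicExtension.zeta r ℚ K ^ (e (e.symm s) : ZMod r).val :=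
      (hz.autToPow_spec ℚ (e.symm s)).symm
    rw [e.apply_symm_apply] at h1
    exact h1
  choose a ha using fun s : (ZMod r)ˣ => exists_act (e.symm s)
  have hsm : ∀ (s : (ZMod r)ˣ) (I : (Ideal (𝓞 K))⁰), ∃ J : (Ideal (𝓞 K))⁰, (J : Ideal (𝓞 K)) = e.symm s • (I : Ideal (𝓞 K)) := fun s I =>
    ⟨⟨_, mem_nonZeroDivisors_of_ne_zero (smul_nz (e.symm s) _ (nonZeroDivisors.ne_zero I.2))⟩, rfl⟩
  obtain ⟨χ, hχ, hχr, hχa⟩ := exists_char a (fun s t x => by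
    obtain ⟨I, rfl⟩ := ClassGroup.mk0_surjective x
    obtain ⟨J, hJ⟩ := hsm t I
    obtain ⟨J', hJ'⟩ := hsm s J
    rw [ha t I J hJ, ha s J J' hJ', ha (s * t) I J' (by rw [hJ', hJ, map_mul, mul_smul])]) c hc hcr (fun s => by
    obtain ⟨I, hI⟩ := ClassGroup.mk0_surjective c
    obtain ⟨J, hJ⟩ := hsm s I
    rw [← hI, ha s I J hJ, hI]
    have := heig (MulSemiringAction.toRingEquiv Gal(K/ℚ) (𝓞 K) (e.symm s)) (s : ZMod r).val hz.toInteger hz.toInteger_isPrimitiveRoot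
      (hσ s) I J (by rw [hJ]; rfl) hI
    rw [this]
    exact pow_eq_of_cast c hcr _ _ (by rw [Nat.cast_pow, ZMod.natCast_zmod_val, ZMod.natCast_zmod_val]))
  refine final hr5 hz.toInteger hz.toInteger_isPrimitiveRoot e.symm hσ χ hχ hχr fun s I J hIJ => ?_
  rw [← ha s I J hIJ, hχa]

end Final
end ModG
end OmegaSq

/-- Let `r ≥ 5` be a prime, `K = ℚ(ζ_r)` the `r`-th cyclotomic field with ring of
integers `O_K = ℤ[ζ_r]`. Suppose a class `c` in the ideal class group `Cl(O_K)`
satisfies `c^r = 1` and lies in the `ω²`-eigenspace: for every automorphism `σ` of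
`O_K` with `σ(ζ) = ζ^s` for a primitive `r`-th root of unity `ζ` (so `σ = σ_s`),
`σ` maps `c` to `c^{s²}` (the action on classes being induced by `𝔞 ↦ σ(𝔞)` on
ideals). Then `c = 1`. -/
theorem omega_sq_eigenspace_trivial
    (r : ℕ) (hr : r.Prime) (hr5 : 5 ≤ r)
    (c : ClassGroup (NumberField.RingOfIntegers (CyclotomicField (⟨r, hr.pos⟩ : ℕ+) ℚ)))
    (hcr : c ^ r = 1)
    (heig : ∀ (σ : NumberField.RingOfIntegers (CyclotomicField (⟨r, hr.pos⟩ : ℕ+) ℚ) ≃+*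
          NumberField.RingOfIntegers (CyclotomicField (⟨r, hr.pos⟩ : ℕ+) ℚ))
        (s : ℕ) (ζ : NumberField.RingOfIntegers (CyclotomicField (⟨r, hr.pos⟩ : ℕ+) ℚ)),
        IsPrimitiveRoot ζ r → σ ζ = ζ ^ s →
        ∀ J J' : (Ideal (NumberField.RingOfIntegers (CyclotomicField (⟨r, hr.pos⟩ : ℕ+) ℚ)))⁰,
          (J' : Ideal (NumberField.RingOfIntegers (CyclotomicField (⟨r, hr.pos⟩ : ℕ+) ℚ))) =
            Ideal.map (σ : NumberField.RingOfIntegers (CyclotomicField (⟨r, hr.pos⟩ : ℕ+) ℚ) →+*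
              NumberField.RingOfIntegers (CyclotomicField (⟨r, hr.pos⟩ : ℕ+) ℚ))
              (J : Ideal (NumberField.RingOfIntegers (CyclotomicField (⟨r, hr.pos⟩ : ℕ+) ℚ))) →
          ClassGroup.mk0 J = c → ClassGroup.mk0 J' = c ^ (s ^ 2)) :
    c = 1 := by
  have : Fact r.Prime := ⟨hr⟩
  have : IsCyclotomicExtension {r} ℚ (CyclotomicField (⟨r, hr.pos⟩ : ℕ+) ℚ) :=
    CyclotomicField.isCyclotomicExtension r ℚ
  exact OmegaSq.main hr5 c hcr heig
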